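/- Let p and q be prime numbers with p ≡ 5 (mod 8), q ≡ 3 (mod 8), and Legendre symbol (p/q) = 1. Then the 2-class group of the field F = ℚ(√p, √(2q), i) is isomorphic to ℤ/2ℤ × ℤ/2ℤ. -/

import Mathlib

/-- The 2-class group of a subfield `K` of `ℂ` (i.e. the 2-Sylow subgroup of
the class group of its ring of integers) is of type `(2,2)`,
i.e. isomorphic to `ℤ/2ℤ × ℤ/2ℤ`. -/
def TwoClassGroupIsTypeTwoTwo (K : IntermediateField ℚ ℂ) : Prop :=
  ∀ P : Sylow 2 (ClassGroup (integralClosure ℤ K)),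
    Nonempty (P ≃* Multiplicative (ZMod 2 × ZMod 2))

open NumberField Ideal
open scoped Pointwise

set_option linter.unusedSectionVars false

section Quadratic

variable {M L : Type*} [Field M] [Field L] [NumberField M] [NumberField L] [Algebra M L]
  [Algebra.IsQuadraticExtension M L] {τ : Gal(L/M)}

theorem quadratic_gal_eq (hτ : τ ≠ 1) (g : Gal(L/M)) : g = 1 ∨ g = τ := by
  have h2 : Nat.card Gal(L/M) = 2 := by
    rw [IsGalois.card_aut_eq_finrank, Algebra.IsQuadraticExtension.finrank_eq_two]
  obtain ⟨x, y, hxy, hu⟩ := Nat.card_eq_two_iff.mp h2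
  have h : ∀ z : Gal(L/M), z = x ∨ z = y := fun z => by
    have : z ∈ ({x, y} : Set _) := hu ▸ Set.mem_univ z
    simpa using this
  rcases h 1 with h1 | h1 <;> rcases h τ with h3 | h3 <;> rcases h g with h4 | h4 <;> simp_all

theorem quadratic_gal_mul_self (hτ : τ ≠ 1) : τ * τ = 1 := by
  rcases quadratic_gal_eq hτ (τ * τ) with h | h
  · exact h
  · exact absurd (by simpa using h) hτ

theorem quadratic_gal_apply_apply (hτ : τ ≠ 1) (x : L) : τ (τ x) = x := by
  rw [← AlgEquiv.mul_apply, quadratic_gal_mul_self hτ, AlgEquiv.one_apply]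

theorem quadratic_norm_eq (hτ : τ ≠ 1) (x : L) :
    algebraMap M L (Algebra.norm M x) = x * τ x := by
  classical
  rw [Algebra.norm_eq_prod_automorphisms]
  have : (Finset.univ : Finset Gal(L/M)) = {1, τ} := by
    ext g
    simpa using quadratic_gal_eq hτ g
  rw [this, Finset.prod_pair hτ.symm, AlgEquiv.one_apply]

theorem smul_smul_quadratic (hτ : τ ≠ 1) {X : Type*} [MulAction Gal(L/M) X] (x : X) :
    τ • τ • x = x := by
  rw [smul_smul, quadratic_gal_mul_self hτ, one_smul]

theorem absNorm_smul (g : Gal(L/M)) (I : Ideal (𝓞 L)) : absNorm (g • I) = absNorm I := by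
  rw [← absNorm_relNorm (𝓞 M) (𝓞 L) (g • I), relNorm_smul, absNorm_relNorm]

theorem quadratic_intNorm_eq (hτ : τ ≠ 1) (x : 𝓞 L) :
    algebraMap (𝓞 M) (𝓞 L) (Algebra.intNorm (𝓞 M) (𝓞 L) x) = x * τ • x := by
  apply RingOfIntegers.ext
  have h := Algebra.algebraMap_intNorm (A := 𝓞 M) (B := 𝓞 L) (K := M) (L := L) x
  have h2 := quadratic_norm_eq hτ (x : L)
  rw [← h] at h2
  exact h2

theorem Ideal.eq_of_le_of_absNorm_eq {K : Type*} [Field K] [NumberField K] {I J : Ideal (𝓞 K)}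
    (hJ : J ≠ ⊥) (h : I ≤ J) (hn : absNorm J = absNorm I) : I = J := by
  obtain ⟨C, rfl⟩ := Ideal.dvd_iff_le.mpr h
  rw [map_mul] at hn
  have h0 : absNorm J ≠ 0 := by rwa [Ne, absNorm_eq_zero_iff]
  have : absNorm C = 1 := by
    have := Nat.eq_of_mul_eq_mul_left (Nat.pos_of_ne_zero h0) ((mul_one _).trans hn)
    exact this.symm
  rw [absNorm_eq_one_iff] at this
  rw [this, mul_top]

theorem quadratic_map_relNorm (hτ : τ ≠ 1) (I : Ideal (𝓞 L)) :
    (relNorm (𝓞 M) I).map (algebraMap (𝓞 M) (𝓞 L)) = I * τ • I := by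
  by_cases hI : I = ⊥
  · subst hI; simp
  apply Ideal.eq_of_le_of_absNorm_eq
  · intro h
    rcases Ideal.mul_eq_bot.mp h with h | h
    · exact hI h
    · apply hI
      have := congrArg (fun J => τ • J) h
      simpa [smul_smul_quadratic hτ] using this
  · rw [relNorm_apply, Ideal.map_span, Ideal.span_le]
    rintro _ ⟨_, ⟨x, hx, rfl⟩, rfl⟩
    rw [quadratic_intNorm_eq hτ]
    exact Ideal.mul_mem_mul hx (Ideal.smul_mem_pointwise_smul τ x I hx)
  · rw [absNorm_algebraMap, absNorm_relNorm, map_mul, absNorm_smul,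
      ← IsFractionRing.finrank_eq (𝓞 M) M (𝓞 L) L, Algebra.IsQuadraticExtension.finrank_eq_two, pow_two]

/-- A prime fixed by the involution is either extended from below or the involution acts
trivially on its residue field. -/
theorem quadratic_prime_cases (hτ : τ ≠ 1) {P : Ideal (𝓞 L)} [P.IsPrime] (hP : P ≠ ⊥)
    (h : τ • P = P) :
    (∃ I : Ideal (𝓞 M), I.map (algebraMap (𝓞 M) (𝓞 L)) = P) ∨ ∀ x : 𝓞 L, τ • x - x ∈ P := by
  have hPmax : P.IsMaximal := ‹P.IsPrime›.isMaximal hP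
  let p := P.under (𝓞 M)
  obtain ⟨s, hs⟩ := exists_relNorm_eq_pow_of_isPrime P p
  have hm := quadratic_map_relNorm hτ P
  rw [h, hs, Ideal.map_pow] at hm
  have hdvd : P ∣ p.map (algebraMap (𝓞 M) (𝓞 L)) := Ideal.dvd_iff_le.mpr Ideal.map_comap_le
  obtain ⟨C, hC⟩ := hdvd
  rcases s with _ | _ | s
  · rw [pow_zero, one_eq_top] at hm
    exact absurd (top_le_iff.mp (hm.le.trans Ideal.mul_le_right)) ‹P.IsPrime›.ne_top
  · right
    have hn : absNorm p = absNorm P := by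
      rw [← absNorm_relNorm (𝓞 M) (𝓞 L) P, hs, zero_add, pow_one]
    have hn0 : absNorm P ≠ 0 := by rwa [Ne, absNorm_eq_zero_iff]
    have hfin : Finite (𝓞 L ⧸ P) := Ideal.finiteQuotientOfFreeOfNeBot P hP
    have hinj : Function.Injective (algebraMap (𝓞 M ⧸ p) (𝓞 L ⧸ P)) :=
      Ideal.algebraMap_quotient_injective
    have hbij := (Nat.bijective_iff_injective_and_card
      (algebraMap (𝓞 M ⧸ p) (𝓞 L ⧸ P))).mpr ⟨hinj, hn⟩
    intro x
    obtain ⟨m, hm⟩ := hbij.2 (Ideal.Quotient.mk P x)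
    obtain ⟨m, rfl⟩ := Ideal.Quotient.mk_surjective m
    have h1 : algebraMap (𝓞 M) (𝓞 L) m - x ∈ P := by
      rw [← Ideal.Quotient.eq]; exact hm
    have h2 := Ideal.smul_mem_pointwise_smul τ _ P h1
    rw [h, smul_sub, smul_algebraMap] at h2
    have := sub_mem h1 h2
    simpa using this
  · left
    refine ⟨p, ?_⟩
    have h0 : P ^ 2 ≠ 0 := pow_ne_zero _ hP
    have : C = ⊤ := by
      rw [hC, mul_pow, ← pow_two] at hm
      have h3 : P ^ 2 * (P ^ s * C ^ (s + 2)) = P ^ 2 * 1 := by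
        rw [mul_one, ← mul_assoc, ← pow_add, add_comm 2 s]; exact hm
      have h4 := mul_left_cancel₀ h0 h3
      have h5 : IsUnit C := by
        have : IsUnit (P ^ s * C ^ (s + 2)) := h4 ▸ isUnit_one
        exact (isUnit_pow_iff (by omega)).mp (isUnit_of_mul_isUnit_right this)
      exact Ideal.isUnit_iff.mp h5
    rw [hC, this, mul_top]

/-- Induction principle for ideals invariant under the involution of a quadratic extension. -/
theorem quadratic_invariant_induction (hτ : τ ≠ 1) {S : Ideal (𝓞 L) → Prop}
    (hmul : ∀ I J, S I → S J → S (I * J))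
    (hext : ∀ I : Ideal (𝓞 M), I ≠ ⊥ → S (I.map (algebraMap (𝓞 M) (𝓞 L))))
    (hram : ∀ P : Ideal (𝓞 L), P.IsPrime → P ≠ ⊥ → τ • P = P → (∀ x : 𝓞 L, τ • x - x ∈ P) → S P)
    (I : Ideal (𝓞 L)) (hI : I ≠ ⊥) (h : τ • I = I) : S I := by
  generalize hn : absNorm I = n
  induction n using Nat.strong_induction_on generalizing I with
  | _ n ih =>
  by_cases htop : I = ⊤
  · have := hext ⊤ top_ne_bot
    rwa [Ideal.map_top, ← htop] at this
  obtain ⟨P, hPm, hP⟩ := Ideal.exists_le_maximal I htop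
  have hPb : P ≠ ⊥ := fun h => hI (le_bot_iff.mp (h ▸ hP))
  have key : ∀ Q : Ideal (𝓞 L), Q ≠ ⊥ → Q ≠ ⊤ → τ • Q = Q → S Q → Q ∣ I → S I := by
    rintro Q hQb hQt hQ hSQ ⟨C, rfl⟩
    have hCb : C ≠ ⊥ := fun h => hI (by rw [h, Ideal.mul_bot])
    apply hmul _ _ hSQ
    apply ih (absNorm C) _ C hCb _ rfl
    · rw [← hn, map_mul]
      have h1 : absNorm Q ≠ 0 := by rwa [Ne, absNorm_eq_zero_iff]
      have h2 : absNorm Q ≠ 1 := by rwa [Ne, absNorm_eq_one_iff]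
      have h3 : absNorm C ≠ 0 := by rwa [Ne, absNorm_eq_zero_iff]
      exact lt_mul_of_one_lt_left (by omega) (by omega)
    · rw [smul_mul', hQ] at h
      exact mul_left_cancel₀ hQb h
  by_cases hτP : τ • P = P
  · apply key P hPb hPm.ne_top hτP _ (Ideal.dvd_iff_le.mpr hP)
    rcases quadratic_prime_cases hτ hPb hτP with ⟨J, hJ⟩ | hJ
    · rw [← hJ]
      exact hext J (fun h => hPb (by rw [← hJ, h, Ideal.map_bot]))
    · exact hram P hPm.isPrime hPb hτP hJ
  · have hne : P * τ • P ≠ ⊥ := by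
      intro h
      rcases Ideal.mul_eq_bot.mp h with h | h
      · exact hPb h
      · apply hPb
        have := congrArg (fun J => τ • J) h
        simpa [smul_smul_quadratic hτ] using this
    apply key (P * τ • P) hne _ _ _ _
    · intro h
      exact hPm.ne_top (top_le_iff.mp (h.symm.le.trans Ideal.mul_le_left))
    · rw [smul_mul', smul_smul_quadratic hτ, mul_comm]
    · rw [← quadratic_map_relNorm hτ]
      apply hext
      rwa [Ne, relNorm_eq_bot_iff]
    · have hd1 : P ∣ I := Ideal.dvd_iff_le.mpr hP
      have hd2 : τ • P ∣ I := by
        rw [Ideal.dvd_iff_le]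
        rw [← h]
        exact (Ideal.pointwise_smul_le_pointwise_smul_iff).mpr hP
      have hpP : Prime P := Ideal.prime_of_isPrime hPb hPm.isPrime
      obtain ⟨C, hC⟩ := hd2
      rw [hC] at hd1
      rcases hpP.dvd_or_dvd hd1 with h1 | h1
      · exfalso
        apply hτP
        rw [Ideal.dvd_iff_le] at h1
        exact Ideal.eq_of_le_of_absNorm_eq hPb h1 (absNorm_smul τ P).symm
      · rw [hC, mul_comm]
        exact mul_dvd_mul_left _ h1

end Quadratic

section ClassHelpers

variable {R S : Type*} [CommRing R] [IsDedekindDomain R] [CommRing S] [IsDedekindDomain S]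

open Classical in
/-- The class of an ideal, with the zero ideal sent to the trivial class. -/
noncomputable def idealCls (I : Ideal R) : ClassGroup R :=
  if h : I = ⊥ then 1 else ClassGroup.mk0 ⟨I, mem_nonZeroDivisors_iff_ne_zero.mpr h⟩

theorem idealCls_of_ne_bot {I : Ideal R} (h : I ≠ ⊥) :
    idealCls I = ClassGroup.mk0 ⟨I, mem_nonZeroDivisors_iff_ne_zero.mpr h⟩ := dif_neg h

theorem idealCls_mul {I J : Ideal R} (hI : I ≠ ⊥) (hJ : J ≠ ⊥) :
    idealCls (I * J) = idealCls I * idealCls J := by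
  have h : I * J ≠ ⊥ := mul_ne_zero hI hJ
  rw [idealCls_of_ne_bot hI, idealCls_of_ne_bot hJ, idealCls_of_ne_bot h, ← map_mul]
  rfl

theorem idealCls_surjective (c : ClassGroup R) : ∃ I : Ideal R, I ≠ ⊥ ∧ idealCls I = c := by
  obtain ⟨⟨I, hI⟩, rfl⟩ := ClassGroup.mk0_surjective c
  have h : I ≠ ⊥ := mem_nonZeroDivisors_iff_ne_zero.mp hI
  exact ⟨I, h, idealCls_of_ne_bot h⟩

theorem idealCls_eq_iff {I J : Ideal R} (hI : I ≠ ⊥) (hJ : J ≠ ⊥) :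
    idealCls I = idealCls J ↔ ∃ x y : R, x ≠ 0 ∧ y ≠ 0 ∧ span {x} * I = span {y} * J := by
  rw [idealCls_of_ne_bot hI, idealCls_of_ne_bot hJ, ClassGroup.mk0_eq_mk0_iff]
  simp only [exists_prop]

theorem idealCls_span (x : R) : idealCls (span {x}) = 1 := by
  by_cases hx : x = 0
  · rw [idealCls, dif_pos (by simp [hx])]
  have h : span {x} ≠ ⊥ := by simpa using hx
  rw [idealCls_of_ne_bot h, ClassGroup.mk0_eq_one_iff]
  exact ⟨⟨x, rfl⟩⟩

theorem idealCls_eq_one_iff {I : Ideal R} (hI : I ≠ ⊥) :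
    idealCls I = 1 ↔ ∃ x : R, I = span {x} := by
  refine ⟨fun h => ?_, fun ⟨x, hx⟩ => hx ▸ idealCls_span x⟩
  rw [idealCls_of_ne_bot hI, ClassGroup.mk0_eq_one_iff] at h
  exact h.1

theorem idealCls_pow {I : Ideal R} (hI : I ≠ ⊥) (n : ℕ) :
    idealCls (I ^ n) = idealCls I ^ n := by
  induction n with
  | zero => rw [pow_zero, pow_zero, one_eq_top, ← span_singleton_one, idealCls_span]
  | succ n ih => rw [pow_succ, idealCls_mul (pow_ne_zero n hI) hI, ih, pow_succ]

/-- A multiplicative map on ideals preserving principal ideals induces a map on class groups. -/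
noncomputable def idealClsMap (φ : Ideal R →* Ideal S) (h0 : ∀ I, I ≠ ⊥ → φ I ≠ ⊥)
    (hp : ∀ x : R, ∃ y : S, φ (span {x}) = span {y}) : ClassGroup R →* ClassGroup S :=
  have key : ∀ I J : Ideal R, I ≠ ⊥ → J ≠ ⊥ → idealCls I = idealCls J →
      idealCls (φ I) = idealCls (φ J) := by
    intro I J hI hJ h
    obtain ⟨x, y, hx, hy, h⟩ := (idealCls_eq_iff hI hJ).mp h
    have h2 := congrArg φ h
    rw [map_mul, map_mul] at h2
    have hx' := h0 (span {x}) (by simpa using hx)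
    have hy' := h0 (span {y}) (by simpa using hy)
    have h3 := congrArg idealCls h2
    obtain ⟨x', hx2⟩ := hp x
    obtain ⟨y', hy2⟩ := hp y
    rw [idealCls_mul hx' (h0 I hI), idealCls_mul hy' (h0 J hJ), hx2, hy2, idealCls_span,
      idealCls_span, one_mul, one_mul] at h3
    exact h3
  MonoidHom.mk' (fun c => idealCls (φ (idealCls_surjective c).choose)) (by
    intro a b
    have ha := (idealCls_surjective a).choose_spec
    have hb := (idealCls_surjective b).choose_spec
    have hab := (idealCls_surjective (a * b)).choose_spec
    rw [← idealCls_mul (h0 _ ha.1) (h0 _ hb.1), ← map_mul]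
    apply key _ _ hab.1 (mul_ne_zero ha.1 hb.1)
    rw [hab.2, idealCls_mul ha.1 hb.1, ha.2, hb.2])

theorem idealClsMap_idealCls (φ : Ideal R →* Ideal S) (h0 : ∀ I, I ≠ ⊥ → φ I ≠ ⊥)
    (hp : ∀ x : R, ∃ y : S, φ (span {x}) = span {y}) {I : Ideal R} (hI : I ≠ ⊥) :
    idealClsMap φ h0 hp (idealCls I) = idealCls (φ I) := by
  have hs := (idealCls_surjective (idealCls I)).choose_spec
  obtain ⟨x, y, hx, hy, h⟩ := (idealCls_eq_iff hs.1 hI).mp hs.2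
  change idealCls (φ (idealCls_surjective (idealCls I)).choose) = _
  have h2 := congrArg φ h
  rw [map_mul, map_mul] at h2
  have hx' := h0 (span {x}) (by simpa using hx)
  have hy' := h0 (span {y}) (by simpa using hy)
  have h3 := congrArg idealCls h2
  obtain ⟨x', hx2⟩ := hp x
  obtain ⟨y', hy2⟩ := hp y
  rw [idealCls_mul hx' (h0 _ hs.1), idealCls_mul hy' (h0 _ hI), hx2, hy2, idealCls_span,
    idealCls_span, one_mul, one_mul] at h3
  exact h3

end ClassHelpers

section GalAct

theorem RingOfIntegers.ext_algebraMap {K : Type*} [Field K] {x y : 𝓞 K}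
    (h : algebraMap (𝓞 K) K x = algebraMap (𝓞 K) K y) : x = y :=
  FaithfulSMul.algebraMap_injective _ _ h

theorem norm_div_field {M L : Type*} [Field M] [Field L] [Algebra M L] [FiniteDimensional M L]
    (x y : L) : Algebra.norm M (x / y) = Algebra.norm M x / Algebra.norm M y := by
  by_cases hy : y = 0
  · have h0 : Algebra.norm M (0 : L) = 0 := Algebra.norm_eq_zero_iff.mpr rfl
    rw [hy, div_zero, h0, div_zero]
  · rw [eq_div_iff (by simpa [Algebra.norm_eq_zero_iff] using hy), ← map_mul, div_mul_cancel₀ _ hy]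

variable {M L : Type*} [Field M] [Field L] [NumberField M] [NumberField L] [Algebra M L]

theorem smul_span_singleton (g : Gal(L/M)) (x : 𝓞 L) : g • span {x} = span {g • x} := by
  rw [Ideal.pointwise_smul_def, Ideal.map_span, Set.image_singleton]
  rfl

theorem smul_ne_bot (g : Gal(L/M)) {I : Ideal (𝓞 L)} (hI : I ≠ ⊥) : g • I ≠ ⊥ := by
  intro h
  apply hI
  have := congrArg (fun J => g⁻¹ • J) h
  simpa using this

/-- The action of an automorphism on the class group. -/
noncomputable def galCls (g : Gal(L/M)) : ClassGroup (𝓞 L) →* ClassGroup (𝓞 L) :=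
  idealClsMap (MulDistribMulAction.toMonoidHom (Ideal (𝓞 L)) g) (fun _ hI => smul_ne_bot g hI)
    (fun x => ⟨g • x, smul_span_singleton g x⟩)

theorem galCls_idealCls (g : Gal(L/M)) {I : Ideal (𝓞 L)} (hI : I ≠ ⊥) :
    galCls g (idealCls I) = idealCls (g • I) :=
  idealClsMap_idealCls _ _ _ hI

variable (M L) in
/-- Extension of ideal classes. -/
noncomputable def extCls : ClassGroup (𝓞 M) →* ClassGroup (𝓞 L) :=
  idealClsMap (Ideal.mapHom (algebraMap (𝓞 M) (𝓞 L)) : Ideal (𝓞 M) →* Ideal (𝓞 L))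
    (fun I hI => by
      have hi : Function.Injective (algebraMap (𝓞 M) (𝓞 L)) := FaithfulSMul.algebraMap_injective _ _
      simpa [Ideal.map_eq_bot_iff_of_injective hi] using hI)
    (fun x => ⟨algebraMap (𝓞 M) (𝓞 L) x, by simp [Ideal.map_span]⟩)

theorem map_ne_bot' {I : Ideal (𝓞 M)} (hI : I ≠ ⊥) : I.map (algebraMap (𝓞 M) (𝓞 L)) ≠ ⊥ := by
  have hi : Function.Injective (algebraMap (𝓞 M) (𝓞 L)) := FaithfulSMul.algebraMap_injective _ _
  simpa [Ideal.map_eq_bot_iff_of_injective hi] using hI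

theorem extCls_idealCls {I : Ideal (𝓞 M)} (hI : I ≠ ⊥) :
    extCls M L (idealCls I) = idealCls (I.map (algebraMap (𝓞 M) (𝓞 L))) :=
  idealClsMap_idealCls _ _ _ hI

variable (M L) in
/-- Norm of ideal classes. -/
noncomputable def relNormCls : ClassGroup (𝓞 L) →* ClassGroup (𝓞 M) :=
  idealClsMap (relNorm (𝓞 M) : Ideal (𝓞 L) →*₀ Ideal (𝓞 M)).toMonoidHom
    (fun I hI => by
      change relNorm (𝓞 M) I ≠ ⊥
      rwa [Ne, relNorm_eq_bot_iff])
    (fun x => ⟨_, relNorm_singleton (𝓞 M) x⟩)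

theorem relNormCls_idealCls {I : Ideal (𝓞 L)} (hI : I ≠ ⊥) :
    relNormCls M L (idealCls I) = idealCls (relNorm (𝓞 M) I) :=
  idealClsMap_idealCls _ _ _ hI

variable [Algebra.IsQuadraticExtension M L] {τ : Gal(L/M)}

theorem mul_galCls (hτ : τ ≠ 1) (c : ClassGroup (𝓞 L)) :
    c * galCls τ c = extCls M L (relNormCls M L c) := by
  obtain ⟨I, hI, rfl⟩ := idealCls_surjective c
  rw [galCls_idealCls τ hI, ← idealCls_mul hI (smul_ne_bot τ hI), relNormCls_idealCls hI,
    extCls_idealCls (by rwa [Ne, relNorm_eq_bot_iff]), quadratic_map_relNorm hτ]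

theorem galCls_galCls (hτ : τ ≠ 1) (c : ClassGroup (𝓞 L)) : galCls τ (galCls τ c) = c := by
  obtain ⟨I, hI, rfl⟩ := idealCls_surjective c
  rw [galCls_idealCls τ hI, galCls_idealCls τ (smul_ne_bot τ hI), smul_smul_quadratic hτ]

/-- Hilbert 90 for a quadratic extension, with an integral witness. -/
theorem quadratic_hilbert90 (hτ : τ ≠ 1) {t : L} (ht : t * τ t = 1) :
    ∃ w : 𝓞 L, w ≠ 0 ∧ t * (w : L) = τ w := by
  have key : ∃ w : L, w ≠ 0 ∧ t * w = τ w := by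
    by_cases h : 1 + τ t = 0
    · have ht1 : t = -1 := by
        have h1 : τ t = -1 := by linear_combination h
        rw [h1] at ht
        linear_combination -ht
      obtain ⟨x, hx⟩ : ∃ x, τ x ≠ x := by
        by_contra! hc
        exact hτ (AlgEquiv.ext hc)
      refine ⟨x - τ x, sub_ne_zero.mpr hx.symm, ?_⟩
      rw [map_sub, quadratic_gal_apply_apply hτ, ht1]
      ring
    · refine ⟨1 + τ t, h, ?_⟩
      rw [map_add, map_one, quadratic_gal_apply_apply hτ, mul_add, ht]
      ring
  obtain ⟨w, hw, h⟩ := key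
  obtain ⟨⟨n, hn⟩, m, hm⟩ :=
    IsLocalization.exists_integer_multiple (Algebra.algebraMapSubmonoid (𝓞 L) (nonZeroDivisors ℤ)) w
  obtain ⟨k, hk, rfl⟩ := hn
  have hk0 : (k : L) ≠ 0 := by
    have := nonZeroDivisors.ne_zero hk
    exact_mod_cast this
  have hm' : (m : L) = k * w := by
    have : (m : L) = algebraMap (𝓞 L) L (algebraMap ℤ (𝓞 L) k) * w := hm.trans (Algebra.smul_def _ _)
    simpa using this
  refine ⟨m, ?_, ?_⟩
  · rintro rfl
    exact (mul_ne_zero hk0 hw) (by rw [← hm']; simp)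
  · rw [hm', map_mul, map_intCast, ← h]
    ring

/-- An ambiguous class contains an invariant ideal, when unit norms are norms of units. -/
theorem exists_invariant_ideal (hτ : τ ≠ 1)
    (hu : ∀ (u : (𝓞 M)ˣ) (x : L), Algebra.norm M x = (u : 𝓞 M) →
      ∃ v : (𝓞 L)ˣ, Algebra.norm M ((v : 𝓞 L) : L) = (u : 𝓞 M))
    {c : ClassGroup (𝓞 L)} (hc : galCls τ c = c) :
    ∃ J : Ideal (𝓞 L), J ≠ ⊥ ∧ τ • J = J ∧ idealCls J = c := by
  obtain ⟨I, hI, rfl⟩ := idealCls_surjective c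
  rw [galCls_idealCls τ hI] at hc
  obtain ⟨x, y, hx, hy, h⟩ := (idealCls_eq_iff (smul_ne_bot τ hI) hI).mp hc
  have hN := congrArg (relNorm (𝓞 M)) h
  rw [map_mul, map_mul, relNorm_smul, relNorm_singleton, relNorm_singleton] at hN
  have hN2 := mul_right_cancel₀ (by rw [Ne, Ideal.zero_eq_bot, relNorm_eq_bot_iff]; exact hI) hN
  rw [span_singleton_eq_span_singleton] at hN2
  obtain ⟨u, hu1⟩ := hN2
  have hxL : (x : L) ≠ 0 := by simpa using hx
  have hyL : (y : L) ≠ 0 := by simpa using hy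
  have hnx : algebraMap (𝓞 M) M (Algebra.intNorm (𝓞 M) (𝓞 L) x) = Algebra.norm M (x : L) :=
    Algebra.algebraMap_intNorm (A := 𝓞 M) (B := 𝓞 L) (K := M) (L := L) x
  have hny : algebraMap (𝓞 M) M (Algebra.intNorm (𝓞 M) (𝓞 L) y) = Algebra.norm M (y : L) :=
    Algebra.algebraMap_intNorm (A := 𝓞 M) (B := 𝓞 L) (K := M) (L := L) y
  have hu2 := congrArg (algebraMap (𝓞 M) M) hu1
  rw [map_mul, hnx, hny] at hu2
  have hnx0 : Algebra.norm M (x : L) ≠ 0 := by simpa [Algebra.norm_eq_zero_iff] using hx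
  obtain ⟨v, hv⟩ := hu u ((y : L) / x) (by
    rw [norm_div_field, ← hu2]; field_simp)
  obtain ⟨w, hw, hw2⟩ := quadratic_hilbert90 hτ (t := (x : L) * (v : 𝓞 L) / y) (by
    rw [← quadratic_norm_eq hτ, norm_div_field, map_mul, hv, hu2, div_self, map_one]
    simpa [Algebra.norm_eq_zero_iff] using hy)
  have hw3 : x * v * w = y * τ • w := by
    apply RingOfIntegers.ext_algebraMap
    have h1 : algebraMap (𝓞 L) L (τ • w) = τ (algebraMap (𝓞 L) L w) := rfl
    rw [map_mul, map_mul, map_mul, h1, ← hw2]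
    field_simp
  have hwb : span {w} ≠ ⊥ := by simpa using hw
  refine ⟨span {w} * I, mul_ne_zero hwb hI, ?_, ?_⟩
  · rw [smul_mul', smul_span_singleton]
    have hy' : span {y} ≠ (0 : Ideal (𝓞 L)) := by simpa using hy
    apply mul_left_cancel₀ hy'
    rw [← mul_assoc, span_singleton_mul_span_singleton, ← hw3, ← mul_assoc,
      mul_comm (span {y}), mul_assoc (span {w}), ← h, ← mul_assoc, span_singleton_mul_span_singleton]
    congr 1
    rw [span_singleton_eq_span_singleton]
    exact ⟨v⁻¹, by rw [mul_right_comm x, mul_assoc _ (v : 𝓞 L)]; simp [mul_comm]⟩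
  · rw [idealCls_mul hwb hI, idealCls_span, one_mul]

end GalAct

section KleinFour

variable {G : Type*} [CommGroup G] [Finite G]

/-- The 2-part of a finite abelian group with an involution whose fixed 2-power-torsion points are
few is a Klein four-group. -/
theorem sylow_kleinFour_of_involution (t : G →* G) (ht : ∀ c, t (t c) = c) (l b : G)
    (hl1 : l * l = 1)
    (hfix : ∀ c, (∃ n : ℕ, c ^ 2 ^ n = 1) → t c = c → c = 1 ∨ c = l)
    (hl : ¬ IsSquare l) (hb : ¬ IsSquare b) (hlb : ¬ IsSquare (l * b)) (P : Sylow 2 G) :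
    Nonempty (P ≃* Multiplicative (ZMod 2 × ZMod 2)) := by
  have hmem : ∀ c : G, c ∈ P ↔ ∃ n : ℕ, c ^ 2 ^ n = 1 := by
    intro c
    constructor
    · intro hc
      obtain ⟨n, hn⟩ := P.isPGroup' ⟨c, hc⟩
      exact ⟨n, by simpa [Subtype.ext_iff] using hn⟩
    · rintro ⟨n, hn⟩
      have hp : IsPGroup 2 (Subgroup.zpowers c) := by
        rintro ⟨_, k, rfl⟩
        refine ⟨n, ?_⟩
        apply Subtype.ext
        change (c ^ k) ^ 2 ^ n = 1
        rw [← zpow_natCast, ← zpow_mul, mul_comm, zpow_mul, zpow_natCast, hn, one_zpow]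
      exact hp.le_sylow_of_normal P (Subgroup.mem_zpowers c)
  -- elements inverted by the involution
  have hinv : ∀ d : G, (∃ n : ℕ, d ^ 2 ^ n = 1) → t d = d⁻¹ → d = 1 ∨ d = l := by
    rintro d ⟨n, hn⟩ htd
    have hdd : d ^ 2 ^ 1 = 1 := by
      induction n with
      | zero => rw [pow_zero, pow_one] at hn; rw [hn, one_pow]
      | succ n ih =>
        rcases Nat.eq_zero_or_pos n with rfl | hn0
        · exact hn
        apply ih
        have hsq : IsSquare (d ^ 2 ^ n) := by
          obtain ⟨m, rfl⟩ := Nat.exists_eq_add_of_lt hn0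
          exact ⟨d ^ 2 ^ m, by rw [← pow_add]; congr 1; ring⟩
        rcases hfix (d ^ 2 ^ n) ⟨1, by rw [← pow_mul, ← pow_add, hn]⟩ (by
          rw [map_pow, htd, inv_pow, inv_eq_iff_mul_eq_one, ← pow_add, ← two_mul, ← pow_succ', hn])
          with h | h
        · exact h
        · exact absurd (h ▸ hsq) hl
    apply hfix d ⟨1, hdd⟩
    rw [htd, inv_eq_iff_mul_eq_one, ← pow_two]
    exact hdd
  have hpow : ∀ {c : G}, (∃ n : ℕ, c ^ 2 ^ n = 1) → ∃ n : ℕ, (c / t c) ^ 2 ^ n = 1 := by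
    rintro c ⟨n, hn⟩
    exact ⟨n, by rw [div_pow, ← map_pow, hn, map_one, div_one]⟩
  have hd : ∀ c : G, (∃ n : ℕ, c ^ 2 ^ n = 1) → c / t c = 1 ∨ c / t c = l := by
    intro c hc
    apply hinv _ (hpow hc)
    rw [map_div, ht, inv_div]
  have hexp : ∀ c : G, (∃ n : ℕ, c ^ 2 ^ n = 1) → c * c = 1 := by
    intro c hc
    rcases hd c hc with h | h
    · rcases hfix c hc (div_eq_one.mp h).symm with rfl | rfl
      · exact one_mul 1
      · exact hl1
    · have h2 : c * t c = 1 ∨ c * t c = l := by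
        apply hfix
        · obtain ⟨n, hn⟩ := hc
          exact ⟨n, by rw [mul_pow, ← map_pow, hn, map_one, one_mul]⟩
        · rw [map_mul, ht, mul_comm]
      have h3 : c * c = (c / t c) * (c * t c) := by
        rw [div_mul_eq_mul_div, ← mul_assoc, mul_div_cancel_right]
      rw [h] at h3
      rcases h2 with h2 | h2
      · rw [h2, mul_one] at h3
        exact absurd ⟨c, h3.symm⟩ hl
      · rw [h3, h2, hl1]
  -- replace `b` by an odd power
  obtain ⟨k, m, hm, hcard⟩ : ∃ k m : ℕ, ¬ 2 ∣ m ∧ Nat.card G = 2 ^ k * m :=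
    Nat.exists_eq_pow_mul_and_not_dvd Nat.card_pos.ne' 2 (by norm_num)
  obtain ⟨j, rfl⟩ : ∃ j, m = 2 * j + 1 := ⟨m / 2, by omega⟩
  set B := b ^ (2 * j + 1) with hBdef
  have hB : ∃ n : ℕ, B ^ 2 ^ n = 1 :=
    ⟨k, by rw [hBdef, ← pow_mul, mul_comm, ← hcard, pow_card_eq_one']⟩
  have hBb : B = b ^ j * b ^ j * b := by rw [hBdef, pow_succ, two_mul, pow_add]
  have hBsq : ¬ IsSquare B := by
    rintro ⟨y, hy⟩
    apply hb
    refine ⟨y * (b ^ j)⁻¹, ?_⟩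
    rw [mul_mul_mul_comm, ← hy, hBb]
    group
  have hlBsq : ¬ IsSquare (l * B) := by
    rintro ⟨y, hy⟩
    apply hlb
    refine ⟨y * (b ^ j)⁻¹, ?_⟩
    rw [mul_mul_mul_comm, ← hy, hBb, mul_comm (b ^ j * b ^ j), ← mul_assoc l, mul_assoc (l * b)]
    group
  have hB1 : B ≠ 1 := fun h => hBsq (h ▸ IsSquare.one)
  have hlB1 : l * B ≠ 1 := fun h => hlBsq (h ▸ IsSquare.one)
  have hl_one : l ≠ 1 := fun h => hl (h ▸ IsSquare.one)
  have hBl : B ≠ l := fun h => hlB1 (by rw [h, hl1])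
  have hBd : B / t B = l := by
    rcases hd B hB with h | h
    · rcases hfix B hB (div_eq_one.mp h).symm with h | h
      · exact absurd h hB1
      · exact absurd h hBl
    · exact h
  have hlP : ∃ n : ℕ, l ^ 2 ^ n = 1 := ⟨1, by rw [pow_one, pow_two, hl1]⟩
  have hset : (P : Set G) = {1, l, B, l * B} := by
    ext c
    simp only [Set.mem_insert_iff, Set.mem_singleton_iff, SetLike.mem_coe]
    constructor
    · intro hcP
      have hc := (hmem c).mp hcP
      rcases hd c hc with h | h
      · rcases hfix c hc (div_eq_one.mp h).symm with h | h
        · exact Or.inl h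
        · exact Or.inr (Or.inl h)
      · have h2 : t (c * B) = c * B := by
          symm
          rw [← div_eq_one, map_mul, mul_div_mul_comm, h, hBd, hl1]
        have h3 : ∃ n : ℕ, (c * B) ^ 2 ^ n = 1 := by
          rw [← hmem]
          exact mul_mem hcP ((hmem B).mpr hB)
        have hBB := hexp B hB
        rcases hfix _ h3 h2 with h4 | h4
        · right; right; left
          rw [eq_inv_of_mul_eq_one_left h4, inv_eq_iff_mul_eq_one, hBB]
        · right; right; right
          rw [← h4, mul_assoc, hBB, mul_one]
    · rintro (rfl | rfl | rfl | rfl)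
      · exact one_mem P
      · exact (hmem _).mpr hlP
      · exact (hmem _).mpr hB
      · exact mul_mem ((hmem _).mpr hlP) ((hmem _).mpr hB)
  have hcard4 : Nat.card P = 4 := by
    change Nat.card (P : Set G) = 4
    rw [hset, Nat.card_coe_set_eq]
    have h1 : l ≠ l * B := by simpa using hB1
    have h2 : B ≠ l * B := by simpa using hl_one
    rw [Set.ncard_insert_of_notMem (by simp [hl_one.symm, hB1.symm, hlB1.symm]) (Set.toFinite _),
      Set.ncard_insert_of_notMem (by simp [hBl.symm, hB1]) (Set.toFinite _),
      Set.ncard_pair h2]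
  have hexp2 : Monoid.exponent P = 2 := by
    have hdvd : Monoid.exponent P ∣ 2 := by
      apply Monoid.exponent_dvd_of_forall_pow_eq_one
      rintro ⟨c, hc⟩
      apply Subtype.ext
      change c ^ 2 = 1
      rw [pow_two]
      exact hexp c ((hmem c).mp hc)
    rcases (Nat.dvd_prime Nat.prime_two).mp hdvd with h | h
    · exfalso
      rw [Monoid.exp_eq_one_iff] at h
      have h4 : Nat.card P = 1 := Nat.card_of_subsingleton 1
      have h5 : (1 : ℕ) = 4 := h4.symm.trans hcard4
      omega
    · exact h
  have : IsKleinFour P := ⟨hcard4, hexp2⟩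
  exact IsKleinFour.nonempty_mulEquiv

end KleinFour

section Descent

theorem coprime_mul_eq_mul_sq {d u w v : ℕ} (hd : 0 < d) (huw : u.Coprime w)
    (h : u * w = d * v ^ 2) :
    ∃ d₁ d₂ a b : ℕ, d₁ * d₂ = d ∧ w = d₁ * a ^ 2 ∧ u = d₂ * b ^ 2 := by
  have hg : d.gcd u * d.gcd w = d := by
    rw [← Nat.Coprime.gcd_mul d huw, h, Nat.gcd_mul_right_right]
  obtain ⟨n, hwm⟩ := Nat.gcd_dvd_right d w
  obtain ⟨m, hum⟩ := Nat.gcd_dvd_right d u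
  have h1 : d * (m * n) = d * v ^ 2 := by
    rw [← h]
    conv_lhs => rw [← hg]
    conv_rhs => rw [hum, hwm]
    ring
  have h2 := Nat.eq_of_mul_eq_mul_left hd h1
  have hcop : m.Coprime n :=
    Nat.Coprime.coprime_dvd_left ⟨_, hum.trans (mul_comm _ _)⟩
      (Nat.Coprime.coprime_dvd_right ⟨_, hwm.trans (mul_comm _ _)⟩ huw)
  obtain ⟨b, hb⟩ := exists_eq_pow_of_mul_eq_pow (by rw [(show gcd m n = 1 from hcop)]; exact isUnit_one) h2
  obtain ⟨a, ha⟩ := exists_eq_pow_of_mul_eq_pow (by rw [(show gcd n m = 1 from hcop.symm)]; exact isUnit_one)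
    ((mul_comm _ _).trans h2)
  exact ⟨d.gcd w, d.gcd u, a, b, by rw [mul_comm, hg], by rw [← ha, ← hwm], by rw [← hb, ← hum]⟩

/-- Factoring the minimal solution of the Pell equation. -/
theorem pell_descent {d : ℕ} (hd : ¬ IsSquare d)
    (hpar : ∀ X Y : ℕ, X ^ 2 = d * Y ^ 2 + 1 → X % 2 = 1 ∧ Y % 2 = 0) :
    ∃ d₁ d₂ a b : ℕ, d₁ * d₂ = d ∧ d₁ * a ^ 2 = d₂ * b ^ 2 + 1 ∧ d₁ ≠ 1 := by
  have hd0 : 0 < d := Nat.pos_of_ne_zero (by rintro rfl; exact hd ⟨0, rfl⟩)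
  have hex : ∃ X : ℕ, 1 < X ∧ ∃ Y : ℕ, X ^ 2 = d * Y ^ 2 + 1 := by
    obtain ⟨x, y, hxy, hy⟩ := Pell.exists_of_not_isSquare (d := (d : ℤ)) (by exact_mod_cast hd0)
      (by simpa using hd)
    have h : x.natAbs ^ 2 = d * y.natAbs ^ 2 + 1 := by
      zify
      rw [sq_abs, sq_abs]
      linear_combination hxy
    refine ⟨x.natAbs, ?_, y.natAbs, h⟩
    by_contra hc
    have h1 : x.natAbs ^ 2 ≤ 1 := by
      have : x.natAbs ≤ 1 := by omega
      exact pow_le_one₀ (Nat.zero_le _) this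
    have h2 : 0 < d * y.natAbs ^ 2 := by
      have := Int.natAbs_pos.mpr hy
      positivity
    omega
  classical
  obtain ⟨hX1, Y, hXY⟩ := Nat.find_spec hex
  have hmin := fun m => Nat.find_min hex (m := m)
  set X := Nat.find hex
  obtain ⟨hXo, hYe⟩ := hpar X Y hXY
  obtain ⟨u, hu⟩ : ∃ u, X = 2 * u + 1 := ⟨X / 2, by omega⟩
  obtain ⟨v, hv⟩ : ∃ v, Y = 2 * v := ⟨Y / 2, by omega⟩
  have huv : u * (u + 1) = d * v ^ 2 := by
    rw [hu, hv] at hXY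
    have : 4 * (u * (u + 1)) = 4 * (d * v ^ 2) := by linarith
    omega
  obtain ⟨d₁, d₂, a, b, h12, ha, hb⟩ :=
    coprime_mul_eq_mul_sq hd0 (Nat.coprime_self_add_right.mpr (Nat.coprime_one_right u)) huv
  refine ⟨d₁, d₂, a, b, h12, by omega, ?_⟩
  rintro rfl
  have hu0 : 0 < u := by omega
  have haX : a < X := by nlinarith
  apply hmin a haX
  refine ⟨?_, b, ?_⟩
  · by_contra hc
    have : a ≤ 1 := by omega
    nlinarith
  · rw [one_mul] at h12 ha
    rw [← ha, hb, h12]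

theorem sq_mod_eight (n : ℕ) : n % 2 = 0 ∧ n ^ 2 % 4 = 0 ∨ n % 2 = 1 ∧ n ^ 2 % 8 = 1 := by
  rcases Nat.mod_two_eq_zero_or_one n with h | h
  · left
    obtain ⟨k, rfl⟩ : ∃ k, n = 2 * k := ⟨n / 2, by omega⟩
    exact ⟨h, by rw [mul_pow]; omega⟩
  · right
    obtain ⟨k, rfl⟩ : ∃ k, n = 2 * k + 1 := ⟨n / 2, by omega⟩
    refine ⟨h, ?_⟩
    have h2 : k * (k + 1) % 2 = 0 := Nat.even_iff.mp (Nat.even_mul_succ_self k)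
    have h3 : (2 * k + 1) ^ 2 = 4 * (k * (k + 1)) + 1 := by ring
    omega

theorem not_isSquare_zmod_of_mod_eight {q : ℕ} [Fact q.Prime] (h : q % 8 = 3 ∨ q % 8 = 5) :
    ¬ IsSquare (2 : ZMod q) := by
  have h2 : q ≠ 2 := by rintro rfl; omega
  rw [ZMod.exists_sq_eq_two_iff h2]
  omega

theorem two_ne_zero_zmod {q : ℕ} [Fact q.Prime] (h : q % 2 = 1) : (2 : ZMod q) ≠ 0 := by
  have : ((2 : ℕ) : ZMod q) ≠ 0 := by
    rw [Ne, ZMod.natCast_eq_zero_iff]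
    intro hd
    have := (Nat.prime_dvd_prime_iff_eq Fact.out Nat.prime_two).mp hd
    omega
  exact_mod_cast this

theorem isSquare_mul_self_right {K : Type*} [Field K] {x y : K} (hy : IsSquare y) (hy0 : y ≠ 0)
    (h : IsSquare (x * y)) : IsSquare x := by
  have := h.div hy
  rwa [mul_div_cancel_right₀ _ hy0] at this

/-- In a finite field the product of two nonsquares is a square. -/
theorem isSquare_mul_of_not_isSquare {p : ℕ} [Fact p.Prime] {x y : ZMod p}
    (hx : ¬ IsSquare x) (hy : ¬ IsSquare y) : IsSquare (x * y) := by
  have hp2 : ringChar (ZMod p) ≠ 2 := by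
    rw [ZMod.ringChar_zmod_n]
    rintro rfl
    exact hx (FiniteField.isSquare_of_char_two (by rw [ZMod.ringChar_zmod_n]) x)
  rw [← quadraticChar_neg_one_iff_not_isSquare] at hx hy
  have hx0 : x ≠ 0 := by rintro rfl; simp at hx
  have hy0 : y ≠ 0 := by rintro rfl; simp at hy
  rw [← quadraticChar_one_iff_isSquare (mul_ne_zero hx0 hy0), map_mul, hx, hy]
  norm_num

variable {p q : ℕ} [hpp : Fact p.Prime] [hqp : Fact q.Prime]

theorem pell_neg_one (hp : p % 4 = 1) : ∃ x y : ℕ, x ^ 2 + 1 = p * y ^ 2 := by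
  have hns : ¬ IsSquare p := (Nat.Prime.prime hpp.out).not_isSquare
  obtain ⟨d₁, d₂, a, b, h12, h, h1⟩ := pell_descent hns (by
    intro X Y h
    have h1 := Nat.mul_mod p (Y ^ 2) 4
    rw [hp] at h1
    rcases sq_mod_eight X with ⟨hX, hX2⟩ | ⟨hX, hX2⟩ <;>
      rcases sq_mod_eight Y with ⟨hY, hY2⟩ | ⟨hY, hY2⟩ <;> omega)
  rcases (Nat.dvd_prime hpp.out).mp ⟨d₂, h12.symm⟩ with h3 | h3
  · exact absurd h3 h1
  · subst h3
    have : d₂ = 1 := by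
      have := Nat.eq_of_mul_eq_mul_left hpp.out.pos (h12.trans (mul_one _).symm)
      exact this
    subst this
    exact ⟨b, a, by rw [h, one_mul]⟩

theorem even_parity {m : ℕ} (hm : m % 2 = 1) (X Y : ℕ) (h : X ^ 2 = 2 * m * Y ^ 2 + 1) :
    X % 2 = 1 ∧ Y % 2 = 0 := by
  have h1 := Nat.mul_mod m (Y ^ 2) 4
  rw [mul_assoc] at h
  rcases sq_mod_eight X with ⟨hX, hX2⟩ | ⟨hX, hX2⟩ <;>
    rcases sq_mod_eight Y with ⟨hY, hY2⟩ | ⟨hY, hY2⟩ <;>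
    rcases (by omega : m % 4 = 1 ∨ m % 4 = 3) with hm4 | hm4 <;>
    rw [hm4] at h1 <;> omega

theorem not_isSquare_neg_one_zmod (hq : q % 4 = 3) : ¬ IsSquare (-1 : ZMod q) := by
  rw [ZMod.exists_sq_eq_neg_one_iff]
  omega

theorem isSquare_neg_one_zmod (hp : p % 4 = 1) : IsSquare (-1 : ZMod p) := by
  rw [ZMod.exists_sq_eq_neg_one_iff]
  omega

theorem not_isSquare_two_mul {m : ℕ} (hm : m % 2 = 1) : ¬ IsSquare (2 * m) := by
  rintro ⟨r, hr⟩
  have h1 := congrArg (· % 4) hr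
  simp only [Nat.mul_mod r r] at h1
  have hX : r % 4 < 4 := Nat.mod_lt _ (by norm_num)
  generalize r % 4 = A at *
  interval_cases A <;> omega

theorem pell_two_q (hq : q % 8 = 3) : ∃ a b : ℕ, q * a ^ 2 = 2 * b ^ 2 + 1 := by
  obtain ⟨d₁, d₂, a, b, h12, h, h1⟩ := pell_descent (d := 2 * q)
    (not_isSquare_two_mul (by omega)) (even_parity (by omega))
  have hmod := congrArg (Nat.cast : ℕ → ZMod q) h
  push_cast at hmod
  obtain ⟨x, y, hx, hy, rfl⟩ := (Nat.dvd_mul).mp ⟨d₂, h12.symm⟩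
  have hq0 : (q : ZMod q) = 0 := by simp
  have hqpos := hqp.out.pos
  have n1 := not_isSquare_neg_one_zmod (q := q) (by omega)
  have n2 := not_isSquare_zmod_of_mod_eight (q := q) (Or.inl hq)
  have t0 := two_ne_zero_zmod (q := q) (by omega)
  rcases (Nat.dvd_prime Nat.prime_two).mp hx with rfl | rfl <;>
    rcases (Nat.dvd_prime hqp.out).mp hy with rfl | rfl
  · exact absurd rfl h1
  · have : d₂ = 2 := by
      have : y * d₂ = y * 2 := by linarith
      exact Nat.eq_of_mul_eq_mul_left hqpos this
    subst this
    exact ⟨a, b, by linarith⟩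
  · have : d₂ = q := by omega
    subst this
    rw [hq0] at hmod
    exfalso
    apply n2
    have ha : (a : ZMod d₂) ≠ 0 := by
      intro h0
      rw [h0] at hmod
      simp at hmod
    apply isSquare_mul_self_right (y := (a : ZMod d₂) ^ 2) ⟨a, pow_two _⟩ (pow_ne_zero 2 ha)
    refine ⟨1, ?_⟩
    push_cast at hmod
    linear_combination hmod
  · have : d₂ = 1 := by
      have : 2 * y * d₂ = 2 * y * 1 := by linarith
      exact Nat.eq_of_mul_eq_mul_left (by omega) this
    subst this
    exfalso
    push_cast at hmod
    rw [hq0] at hmod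
    apply n1
    exact ⟨b, by linear_combination hmod⟩

theorem isSquare_q_zmod_p (hp : p % 4 = 1) (hq : q % 2 = 1)
    (hleg : legendreSym q (p : ℤ) = 1) : IsSquare (q : ZMod p) ∧ (q : ZMod p) ≠ 0 := by
  have hq2 : q ≠ 2 := by rintro rfl; omega
  have h1 : legendreSym p (q : ℤ) = 1 := by
    rw [← legendreSym.quadratic_reciprocity_one_mod_four hp hq2, hleg]
  have h0 : ((q : ℤ) : ZMod p) ≠ 0 := by
    intro h
    rw [(legendreSym.eq_zero_iff p (q : ℤ)).mpr h] at h1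
    norm_num at h1
  exact ⟨by simpa using (legendreSym.eq_one_iff p h0).mp h1, by simpa using h0⟩

theorem isSquare_p_zmod_q (hleg : legendreSym q (p : ℤ) = 1) :
    IsSquare (p : ZMod q) ∧ (p : ZMod q) ≠ 0 := by
  have h0 : ((p : ℤ) : ZMod q) ≠ 0 := by
    intro h
    rw [(legendreSym.eq_zero_iff q (p : ℤ)).mpr h] at hleg
    norm_num at hleg
  exact ⟨by simpa using (legendreSym.eq_one_iff q h0).mp hleg, by simpa using h0⟩

theorem pell_two_p_q (hp : p % 8 = 5) (hq : q % 8 = 3) (hleg : legendreSym q (p : ℤ) = 1) :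
    ∃ a b : ℕ, q * a ^ 2 = 2 * p * b ^ 2 + 1 := by
  have hpo : p % 2 = 1 := by omega
  have hqo : q % 2 = 1 := by omega
  obtain ⟨d₁, d₂, a, b, h12, h, h1⟩ := pell_descent (d := 2 * (p * q))
    (not_isSquare_two_mul (by rw [Nat.mul_mod, hpo, hqo])) (even_parity (by
      rw [Nat.mul_mod, hpo, hqo]))
  obtain ⟨x, y', hx, hy', rfl⟩ := (Nat.dvd_mul).mp ⟨d₂, h12.symm⟩
  obtain ⟨y, z, hy, hz, rfl⟩ := (Nat.dvd_mul).mp hy'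
  have hq0 : (q : ZMod q) = 0 := by simp
  have hp0 : (p : ZMod p) = 0 := by simp
  have hqpos := hqp.out.pos
  have hppos := hpp.out.pos
  have nq1 := not_isSquare_neg_one_zmod (q := q) (by omega)
  have nq2 := not_isSquare_zmod_of_mod_eight (q := q) (Or.inl hq)
  obtain ⟨nqp, nqp0⟩ := isSquare_p_zmod_q (p := p) (q := q) hleg
  have np1 := isSquare_neg_one_zmod (p := p) (by omega)
  have np2 := not_isSquare_zmod_of_mod_eight (q := p) (Or.inr hp)
  obtain ⟨npq, npq0⟩ := isSquare_q_zmod_p (p := p) (q := q) (by omega) (by omega) hleg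
  -- a relation `u * a ^ 2 = v` forces `u` and `v` to be squares simultaneously
  have key : ∀ (ℓ : ℕ) [Fact ℓ.Prime] (u : ZMod ℓ) (n : ℕ), u * (n : ZMod ℓ) ^ 2 = 1 →
      IsSquare u := by
    intro ℓ _ u n hn
    have hn0 : (n : ZMod ℓ) ≠ 0 := by
      intro h0
      rw [h0] at hn
      simp at hn
    exact isSquare_mul_self_right (y := (n : ZMod ℓ) ^ 2) ⟨n, pow_two _⟩ (pow_ne_zero 2 hn0)
      ⟨1, by linear_combination hn⟩
  have hmq := congrArg (Nat.cast : ℕ → ZMod q) h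
  have hmp := congrArg (Nat.cast : ℕ → ZMod p) h
  have hd2 : ∀ m, x * (y * z) * m = 2 * (p * q) → 0 < x * (y * z) → d₂ = m := by
    intro m hm hpos
    exact Nat.eq_of_mul_eq_mul_left hpos (h12.trans hm.symm)
  rcases (Nat.dvd_prime Nat.prime_two).mp hx with rfl | rfl <;>
    rcases (Nat.dvd_prime hpp.out).mp hy with rfl | rfl <;>
    rcases (Nat.dvd_prime hqp.out).mp hz with rfl | rfl
  · exact absurd rfl h1
  · have := hd2 (2 * p) (by ring) (by positivity)
    subst this
    exact ⟨a, b, by linarith⟩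
  · exfalso
    have := hd2 (2 * q) (by ring) (by positivity)
    subst this
    push_cast at hmp
    rw [hp0] at hmp
    have h3 := key y (-(2 * q)) b (by linear_combination hmp)
    apply np2
    apply isSquare_mul_self_right (npq.mul np1) (mul_ne_zero npq0 (neg_ne_zero.mpr one_ne_zero))
    convert h3 using 1
    ring
  · exfalso
    have := hd2 2 (by ring) (by positivity)
    subst this
    push_cast at hmp
    rw [hp0] at hmp
    have h3 := key y (-2) b (by linear_combination hmp)
    apply np2
    apply isSquare_mul_self_right np1 (neg_ne_zero.mpr one_ne_zero)
    convert h3 using 1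
    ring
  · exfalso
    have := hd2 (p * q) (by ring) (by positivity)
    subst this
    push_cast at hmq
    rw [hq0] at hmq
    exact nq2 (key q 2 a (by linear_combination hmq))
  · exfalso
    have := hd2 p (by ring) (by positivity)
    subst this
    push_cast at hmp
    rw [hp0] at hmp
    have h3 := key d₂ (2 * z) a (by linear_combination hmp)
    exact np2 (isSquare_mul_self_right npq npq0 h3)
  · exfalso
    have := hd2 q (by ring) (by positivity)
    subst this
    push_cast at hmq
    rw [hq0] at hmq
    have h3 := key d₂ (2 * y) a (by linear_combination hmq)
    exact nq2 (isSquare_mul_self_right nqp nqp0 h3)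
  · exfalso
    have := hd2 1 (by ring) (by positivity)
    subst this
    push_cast at hmq
    rw [hq0] at hmq
    exact nq1 ⟨b, by linear_combination hmq⟩

/-- If `t ^ 2 - 4 = p s ^ 2` then `t + 2` is a square or `p` times a square. -/
theorem add_two_of_sq_sub_four (hp : p % 4 = 1) {t : ℕ} {s : ℤ} (ht : 2 ≤ t)
    (h : (t : ℤ) ^ 2 - 4 = p * s ^ 2) : ∃ m : ℕ, t + 2 = m ^ 2 ∨ t + 2 = p * m ^ 2 := by
  obtain ⟨k, rfl⟩ := Nat.exists_eq_add_of_le ht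
  have hk : k * (k + 4) = p * s.natAbs ^ 2 := by
    zify
    rw [sq_abs, ← h]
    push_cast
    ring
  generalize s.natAbs = S at hk
  have hfin : ∀ {d₁ d₂ w a : ℕ}, d₁ * d₂ = p → w = d₁ * a ^ 2 → w = a ^ 2 ∨ w = p * a ^ 2 := by
    intro d₁ d₂ w a h12 hw
    rcases (Nat.dvd_prime hpp.out).mp ⟨d₂, h12.symm⟩ with rfl | rfl
    · left; rw [hw, one_mul]
    · right; exact hw
  rcases Nat.mod_two_eq_zero_or_one k with hk2 | hk2
  · obtain ⟨j, rfl⟩ : ∃ j, k = 2 * j := ⟨k / 2, by omega⟩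
    have hS := Nat.mul_mod p (S ^ 2) 4
    rw [hp] at hS
    have hS2 : S % 2 = 0 := by
      have : 2 * j * (2 * j + 4) = 4 * (j * (j + 2)) := by ring
      rcases sq_mod_eight S with ⟨h1, h2⟩ | ⟨h1, h2⟩
      · exact h1
      · omega
    obtain ⟨T, rfl⟩ : ∃ T, S = 2 * T := ⟨S / 2, by omega⟩
    have hj : j * (j + 2) = p * T ^ 2 := by
      have h1 : 4 * (j * (j + 2)) = 4 * (p * T ^ 2) := by linarith
      omega
    have hj2 : (j + 1) ^ 2 = p * T ^ 2 + 1 := by rw [← hj]; ring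
    have hT := Nat.mul_mod p (T ^ 2) 4
    rw [hp] at hT
    have hje : j % 2 = 0 := by
      rcases sq_mod_eight (j + 1) with ⟨h1, h2⟩ | ⟨h1, h2⟩ <;>
        rcases sq_mod_eight T with ⟨h3, h4⟩ | ⟨h3, h4⟩ <;> omega
    have hTe : T % 2 = 0 := by
      rcases sq_mod_eight (j + 1) with ⟨h1, h2⟩ | ⟨h1, h2⟩ <;>
        rcases sq_mod_eight T with ⟨h3, h4⟩ | ⟨h3, h4⟩ <;> omega
    obtain ⟨u, rfl⟩ : ∃ u, j = 2 * u := ⟨j / 2, by omega⟩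
    obtain ⟨v, rfl⟩ : ∃ v, T = 2 * v := ⟨T / 2, by omega⟩
    have huv : u * (u + 1) = p * v ^ 2 := by
      have h1 : 4 * (u * (u + 1)) = 4 * (p * v ^ 2) := by linarith
      omega
    obtain ⟨d₁, d₂, a, b, h12, ha, hb⟩ := coprime_mul_eq_mul_sq hpp.out.pos
      (Nat.coprime_self_add_right.mpr (Nat.coprime_one_right u)) huv
    refine ⟨2 * a, ?_⟩
    rcases hfin h12 ha with h1 | h1
    · left; rw [mul_pow, ← h1]; ring
    · right
      have : p * (2 * a) ^ 2 = 4 * (p * a ^ 2) := by ring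
      rw [this, ← h1]; ring
  · have hcop : k.Coprime (k + 4) := by
      rw [Nat.coprime_self_add_right]
      have : (4 : ℕ) = 2 ^ 2 := rfl
      rw [this]
      apply Nat.Coprime.pow_right
      rw [Nat.coprime_comm, Nat.Prime.coprime_iff_not_dvd Nat.prime_two]
      omega
    obtain ⟨d₁, d₂, a, b, h12, ha, hb⟩ := coprime_mul_eq_mul_sq hpp.out.pos hcop hk
    refine ⟨a, ?_⟩
    rcases hfin h12 ha with h1 | h1
    · left; omega
    · right; omega

end Descent

section Local

variable {q : ℕ} [hqp : Fact q.Prime]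

theorem toZMod_eq_zero_iff_norm_lt (x : ℤ_[q]) : PadicInt.toZMod x = 0 ↔ ‖x‖ < 1 := by
  rw [← RingHom.mem_ker, PadicInt.ker_toZMod, IsLocalRing.mem_maximalIdeal, PadicInt.mem_nonunits]

theorem padicInt_isSquare (hq : q % 2 = 1) {x : ℤ_[q]} (h0 : PadicInt.toZMod x ≠ 0)
    (h : IsSquare (PadicInt.toZMod x)) : IsSquare x := by
  obtain ⟨y, hy⟩ := h
  obtain ⟨z, rfl⟩ := ZMod.ringHom_surjective PadicInt.toZMod y
  have hz0 : (PadicInt.toZMod z : ZMod q) ≠ 0 := by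
    intro hz
    rw [hz, mul_zero] at hy
    exact h0 hy
  have hF : Polynomial.aeval z (Polynomial.X ^ 2 - Polynomial.C x : Polynomial ℤ_[q]).derivative =
      2 * z := by
    simp [one_add_one_eq_two]
  have hE : Polynomial.aeval z (Polynomial.X ^ 2 - Polynomial.C x : Polynomial ℤ_[q]) = z ^ 2 - x := by
    simp
  have hn2 : ‖(2 * z : ℤ_[q])‖ = 1 := by
    have h1 : ¬ ‖(2 * z : ℤ_[q])‖ < 1 := by
      rw [← toZMod_eq_zero_iff_norm_lt, map_mul, map_ofNat]
      exact mul_ne_zero (two_ne_zero_zmod hq) hz0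
    exact le_antisymm (PadicInt.norm_le_one _) (not_lt.mp h1)
  obtain ⟨r, hr, -⟩ := hensels_lemma (p := q) (F := Polynomial.X ^ 2 - Polynomial.C x) (a := z) (by
    rw [hE, hF, hn2, one_pow,
      ← toZMod_eq_zero_iff_norm_lt, map_sub, map_pow, hy]
    ring)
  refine ⟨r, ?_⟩
  simp only [map_sub, map_pow, Polynomial.aeval_X, Polynomial.aeval_C, Algebra.algebraMap_self,
    RingHom.id_apply] at hr
  linear_combination -hr

theorem padic_isSquare_of_zmod (hq : q % 2 = 1) {n : ℤ} (h0 : (n : ZMod q) ≠ 0)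
    (h : IsSquare (n : ZMod q)) : IsSquare (n : ℚ_[q]) := by
  have := padicInt_isSquare hq (x := (n : ℤ_[q])) (by simpa using h0) (by simpa using h)
  have h2 := this.map (PadicInt.Coe.ringHom (p := q))
  simpa using h2

theorem zmod_isSquare_of_padic {n : ℤ} (h0 : (n : ZMod q) ≠ 0)
    (h : IsSquare (n : ℚ_[q])) : IsSquare (n : ZMod q) := by
  obtain ⟨y, hy⟩ := h
  have hn : ‖(n : ℚ_[q])‖ = 1 := by
    refine le_antisymm (Padic.norm_int_le_one n) (not_lt.mp fun hlt => h0 ?_)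
    rwa [ZMod.intCast_zmod_eq_zero_iff_dvd, ← Padic.norm_intCast_lt_one_iff]
  have hy1 : ‖y‖ ≤ 1 := by
    rw [hy, norm_mul] at hn
    nlinarith [norm_nonneg y]
  obtain ⟨y, rfl⟩ : ∃ y' : ℤ_[q], (y' : ℚ_[q]) = y := ⟨⟨y, hy1⟩, rfl⟩
  refine ⟨PadicInt.toZMod y, ?_⟩
  rw [← map_mul]
  have : y * y = (n : ℤ_[q]) := by
    apply PadicInt.ext
    simpa using hy.symm
  rw [this, map_intCast]

/-- The value of the norm form of a biquadratic extension at a unit-normalised vector. -/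
theorem normForm_isSquare_of_le_one (hq : q % 4 = 3) {a b c d : ℤ_[q]}
    (h : PadicInt.toZMod a ≠ 0 ∨ PadicInt.toZMod b ≠ 0 ∨ PadicInt.toZMod c ≠ 0 ∨
      PadicInt.toZMod d ≠ 0) :
    IsSquare ((a ^ 2 - b ^ 2 - 2 * q * (c ^ 2 - d ^ 2)) ^ 2 +
      (2 * a * b - 4 * q * c * d) ^ 2 : ℤ_[q]) := by
  have hns := not_isSquare_neg_one_zmod (q := q) hq
  have hsum : ∀ x y : ZMod q, x ≠ 0 ∨ y ≠ 0 → x ^ 2 + y ^ 2 ≠ 0 := by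
    intro x y hxy h0
    rcases eq_or_ne y 0 with rfl | hy
    · simp_all
    · apply hns
      refine ⟨x / y, ?_⟩
      field_simp
      linear_combination -h0
  have hq0 : PadicInt.toZMod (q : ℤ_[q]) = 0 := by simp
  by_cases hab : PadicInt.toZMod a ≠ 0 ∨ PadicInt.toZMod b ≠ 0
  · have hval : PadicInt.toZMod ((a ^ 2 - b ^ 2 - 2 * q * (c ^ 2 - d ^ 2)) ^ 2 +
        (2 * a * b - 4 * q * c * d) ^ 2 : ℤ_[q]) =
        (PadicInt.toZMod a ^ 2 + PadicInt.toZMod b ^ 2) * (PadicInt.toZMod a ^ 2 + PadicInt.toZMod b ^ 2) := by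
      simp only [map_add, map_sub, map_mul, map_pow, hq0, map_ofNat]
      ring
    apply padicInt_isSquare (by omega)
    · rw [hval]
      exact mul_ne_zero (hsum _ _ hab) (hsum _ _ hab)
    · rw [hval]
      exact ⟨_, rfl⟩
  · push Not at hab
    have hcd : PadicInt.toZMod c ≠ 0 ∨ PadicInt.toZMod d ≠ 0 := by tauto
    have hdiv : ∀ x : ℤ_[q], PadicInt.toZMod x = 0 → ∃ y, x = q * y := by
      intro x hx
      rw [toZMod_eq_zero_iff_norm_lt, PadicInt.norm_lt_one_iff_dvd] at hx
      exact hx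
    obtain ⟨a, rfl⟩ := hdiv a hab.1
    obtain ⟨b, rfl⟩ := hdiv b hab.2
    have hval : PadicInt.toZMod ((q * (a ^ 2 - b ^ 2) - 2 * (c ^ 2 - d ^ 2)) ^ 2 +
        (2 * q * a * b - 4 * c * d) ^ 2 : ℤ_[q]) =
        (2 * (PadicInt.toZMod c ^ 2 + PadicInt.toZMod d ^ 2)) *
          (2 * (PadicInt.toZMod c ^ 2 + PadicInt.toZMod d ^ 2)) := by
      simp only [map_add, map_sub, map_mul, map_pow, hq0, map_ofNat]
      ring
    have h2 := two_ne_zero_zmod (q := q) (by omega)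
    have hsq := padicInt_isSquare (q := q) (by omega) (by
      rw [hval]
      exact mul_ne_zero (mul_ne_zero h2 (hsum _ _ hcd)) (mul_ne_zero h2 (hsum _ _ hcd)))
      (by rw [hval]; exact ⟨_, rfl⟩)
    obtain ⟨r, hr⟩ := hsq
    exact ⟨q * r, by linear_combination (q : ℤ_[q]) ^ 2 * hr⟩

/-- Norms from `ℚ_q(i, √(2q))` to `ℚ_q` of degree four are squares. -/
theorem normForm_isSquare (hq : q % 4 = 3) (a b c d : ℚ_[q]) :
    IsSquare ((a ^ 2 - b ^ 2 - 2 * q * (c ^ 2 - d ^ 2)) ^ 2 +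
      (2 * a * b - 4 * q * c * d) ^ 2 : ℚ_[q]) := by
  obtain ⟨e, he, hmem⟩ : ∃ e : ℚ_[q], (‖a‖ ≤ ‖e‖ ∧ ‖b‖ ≤ ‖e‖ ∧ ‖c‖ ≤ ‖e‖ ∧ ‖d‖ ≤ ‖e‖) ∧
      (e = a ∨ e = b ∨ e = c ∨ e = d) := by
    classical
    obtain ⟨e, he, hmax⟩ := ({a, b, c, d} : Finset ℚ_[q]).exists_max_image (fun x => ‖x‖) (by simp)
    simp only [Finset.mem_insert, Finset.mem_singleton, forall_eq_or_imp, forall_eq] at hmax he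
    exact ⟨e, hmax, he⟩
  by_cases he0 : e = 0
  · subst he0
    simp only [norm_zero, norm_le_zero_iff] at he
    obtain ⟨rfl, rfl, rfl, rfl⟩ := he
    simp
  have hscale : ∀ x : ℚ_[q], ‖x‖ ≤ ‖e‖ → ∃ y : ℤ_[q], x = y * e := by
    intro x hx
    refine ⟨⟨x / e, ?_⟩, ?_⟩
    · rw [norm_div]
      exact div_le_one_of_le₀ hx (norm_nonneg e)
    · exact (div_mul_cancel₀ _ he0).symm
  obtain ⟨a, rfl⟩ := hscale a he.1
  obtain ⟨b, rfl⟩ := hscale b he.2.1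
  obtain ⟨c, rfl⟩ := hscale c he.2.2.1
  obtain ⟨d, rfl⟩ := hscale d he.2.2.2
  have hone : ∀ x : ℤ_[q], e = x * e → PadicInt.toZMod x ≠ 0 := by
    intro x hx
    have h1 : (x : ℚ_[q]) = 1 := by
      have : ((x : ℚ_[q]) - 1) * e = 0 := by linear_combination -hx
      rcases mul_eq_zero.mp this with h | h
      · linear_combination h
      · exact absurd h he0
    have : x = 1 := PadicInt.ext (by simpa using h1)
    rw [this, map_one]
    exact one_ne_zero
  obtain ⟨r, hr⟩ := normForm_isSquare_of_le_one (a := a) (b := b) (c := c) (d := d) hq (by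
    rcases hmem with h | h | h | h
    · exact Or.inl (hone _ h)
    · exact Or.inr (Or.inl (hone _ h))
    · exact Or.inr (Or.inr (Or.inl (hone _ h)))
    · exact Or.inr (Or.inr (Or.inr (hone _ h))))
  have hr2 := congrArg (PadicInt.Coe.ringHom (p := q)) hr
  simp only [map_add, map_sub, map_mul, map_pow, map_ofNat, map_natCast] at hr2
  have hcoe : ∀ x : ℤ_[q], PadicInt.Coe.ringHom x = (x : ℚ_[q]) := fun _ => rfl
  simp only [hcoe] at hr2
  exact ⟨r * e ^ 2, by linear_combination e ^ 4 * hr2⟩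

/-- A fourth root of unity is not a norm from `ℚ_p(√p)` when `p ≡ 5 (mod 8)`. -/
theorem padic_norm_ne_fourth_root {p : ℕ} [hpp : Fact p.Prime] (hp : p % 8 = 5) {a b c : ℚ_[p]}
    (hc : c ^ 2 = -1) : a ^ 2 - p * b ^ 2 ≠ c := by
  intro h
  have hp2 : p ≠ 2 := by rintro rfl; omega
  have hn8 : ∀ x : ZMod p, x ^ 4 ≠ -1 := by
    intro x hx
    have hx0 : x ≠ 0 := by rintro rfl; simp at hx
    have h1 := ZMod.pow_card_sub_one_eq_one hx0
    obtain ⟨k, hk⟩ : ∃ k, p - 1 = 4 * (2 * k + 1) := ⟨p / 8, by omega⟩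
    rw [hk, pow_mul, hx, pow_succ, pow_mul] at h1
    have h2 : (2 : ZMod p) = 0 := by
      norm_num at h1
      linear_combination -h1
    exact two_ne_zero_zmod (by omega) h2
  have hcn : ‖c‖ ≤ 1 := by
    have := congrArg norm hc
    rw [norm_pow, norm_neg, norm_one] at this
    nlinarith [norm_nonneg c]
  obtain ⟨c, rfl⟩ : ∃ y : ℤ_[p], c = y := ⟨⟨c, hcn⟩, rfl⟩
  have hc' : c ^ 2 = -1 := PadicInt.ext (by simpa using hc)
  have hp0 : PadicInt.toZMod (p : ℤ_[p]) = 0 := by simp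
  obtain ⟨e, he, hmem⟩ : ∃ e : ℚ_[p], (‖a‖ ≤ ‖e‖ ∧ ‖b‖ ≤ ‖e‖ ∧ ‖(1 : ℚ_[p])‖ ≤ ‖e‖) ∧
      (e = a ∨ e = b ∨ e = 1) := by
    classical
    obtain ⟨e, he, hmax⟩ := ({a, b, 1} : Finset ℚ_[p]).exists_max_image (fun x => ‖x‖) (by simp)
    simp only [Finset.mem_insert, Finset.mem_singleton, forall_eq_or_imp, forall_eq] at hmax he
    exact ⟨e, hmax, he⟩
  have he0 : e ≠ 0 := by
    rintro rfl
    have := he.2.2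
    norm_num at this
  have hscale : ∀ x : ℚ_[p], ‖x‖ ≤ ‖e‖ → ∃ y : ℤ_[p], x = y * e := by
    intro x hx
    refine ⟨⟨x / e, ?_⟩, ?_⟩
    · rw [norm_div]
      exact div_le_one_of_le₀ hx (norm_nonneg e)
    · exact (div_mul_cancel₀ _ he0).symm
  obtain ⟨a, rfl⟩ := hscale a he.1
  obtain ⟨b, rfl⟩ := hscale b he.2.1
  obtain ⟨d, hd⟩ := hscale 1 he.2.2
  have hone : ∀ x : ℤ_[p], e = x * e → PadicInt.toZMod x ≠ 0 := by
    intro x hx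
    have h1 : (x : ℚ_[p]) = 1 := by
      have : ((x : ℚ_[p]) - 1) * e = 0 := by linear_combination -hx
      rcases mul_eq_zero.mp this with h | h
      · linear_combination h
      · exact absurd h he0
    have : x = 1 := PadicInt.ext (by simpa using h1)
    rw [this, map_one]
    exact one_ne_zero
  have heq : a ^ 2 - p * b ^ 2 = c * d ^ 2 := by
    have h1 : ((a : ℚ_[p]) ^ 2 - p * (b : ℚ_[p]) ^ 2 - c * d ^ 2) * e ^ 2 = 0 := by
      linear_combination h + (c : ℚ_[p]) * (1 + d * e) * hd
    rcases mul_eq_zero.mp h1 with h2 | h2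
    · have h3 : (a : ℚ_[p]) ^ 2 - p * (b : ℚ_[p]) ^ 2 = c * d ^ 2 := by linear_combination h2
      exact PadicInt.ext (by simpa using h3)
    · exact absurd h2 (pow_ne_zero 2 he0)
  have hred := congrArg PadicInt.toZMod heq
  have hredc := congrArg PadicInt.toZMod hc'
  simp only [map_sub, map_mul, map_pow, hp0, zero_mul, sub_zero, map_neg, map_one] at hred hredc
  by_cases hd0 : PadicInt.toZMod d = 0
  · rw [hd0] at hred
    have ha0 : PadicInt.toZMod a = 0 := by simpa using hred
    have hb0 : PadicInt.toZMod b ≠ 0 := by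
      rcases hmem with h1 | h1 | h1
      · exact absurd ha0 (hone _ h1)
      · exact hone _ h1
      · exact absurd hd0 (hone _ (by rw [← hd, h1]))
    have hdiv : ∀ x : ℤ_[p], PadicInt.toZMod x = 0 → ∃ y, x = p * y := by
      intro x hx
      rw [toZMod_eq_zero_iff_norm_lt, PadicInt.norm_lt_one_iff_dvd] at hx
      exact hx
    obtain ⟨a', rfl⟩ := hdiv a ha0
    obtain ⟨d', rfl⟩ := hdiv d hd0
    have hpne : (p : ℤ_[p]) ≠ 0 := by exact_mod_cast hpp.out.ne_zero
    have h2 : b ^ 2 = p * (a' ^ 2 - c * d' ^ 2) := by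
      apply mul_left_cancel₀ hpne
      linear_combination -heq
    have h3 := congrArg PadicInt.toZMod h2
    rw [map_pow, map_mul, hp0, zero_mul] at h3
    exact hb0 (by simpa using h3)
  · apply hn8 (PadicInt.toZMod a / PadicInt.toZMod d)
    rw [div_pow, div_eq_iff (pow_ne_zero 4 hd0)]
    linear_combination (PadicInt.toZMod a ^ 2 + PadicInt.toZMod c * PadicInt.toZMod d ^ 2) * hred + PadicInt.toZMod d ^ 4 * hredc

end Local

open NumberField

/-- `L = M(s)` is a quadratic extension of `M`, where `s ^ 2 = d`. -/
structure QuadBy (M L : Type*) [Field M] [Field L] [Algebra M L] (s : L) (d : M) : Prop where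
  sq : s ^ 2 = algebraMap M L d
  gen : ∀ x : L, ∃ a b : M, x = algebraMap M L a + algebraMap M L b * s
  nsq : ¬ IsSquare d

namespace QuadBy

variable {M L : Type*} [Field M] [Field L] [Algebra M L] {s : L} {d : M}

theorem not_mem_range (h : QuadBy M L s d) (a : M) : algebraMap M L a ≠ s := by
  rintro rfl
  apply h.nsq
  refine ⟨a, (algebraMap M L).injective ?_⟩
  rw [← h.sq, map_mul, pow_two]

theorem eq_zero (h : QuadBy M L s d) {a b : M}
    (hab : algebraMap M L a + algebraMap M L b * s = 0) : a = 0 ∧ b = 0 := by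
  rcases eq_or_ne b 0 with rfl | hb
  · simpa using hab
  · exfalso
    apply h.not_mem_range (-a / b)
    have hb' : algebraMap M L b ≠ 0 := by simpa using hb
    rw [map_div₀, map_neg]
    field_simp
    linear_combination -hab

theorem eq_iff (h : QuadBy M L s d) {a b a' b' : M}
    (hab : algebraMap M L a + algebraMap M L b * s = algebraMap M L a' + algebraMap M L b' * s) :
    a = a' ∧ b = b' := by
  have h1 := h.eq_zero (a := a - a') (b := b - b') (by
    rw [map_sub, map_sub]
    linear_combination hab)
  exact ⟨sub_eq_zero.mp h1.1, sub_eq_zero.mp h1.2⟩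

theorem ne_zero (h : QuadBy M L s d) : s ≠ 0 := by
  have := h.not_mem_range 0
  rw [map_zero] at this
  exact this.symm

/-- The coordinate isomorphism of a quadratic extension. -/
noncomputable def coordEquiv (h : QuadBy M L s d) : (M × M) ≃ₗ[M] L :=
  LinearEquiv.ofBijective
    ((Algebra.linearMap M L).coprod ((LinearMap.mulRight M s).comp (Algebra.linearMap M L))) (by
      constructor
      · rw [injective_iff_map_eq_zero]
        rintro ⟨a, b⟩ hab
        have := h.eq_zero (a := a) (b := b) (by simpa using hab)
        exact Prod.ext this.1 this.2
      · intro x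
        obtain ⟨a, b, rfl⟩ := h.gen x
        exact ⟨(a, b), by simp⟩)

theorem isQuadraticExtension (h : QuadBy M L s d) : Algebra.IsQuadraticExtension M L where
  finrank_eq_two' := by
    rw [← h.coordEquiv.finrank_eq]
    simp

theorem moduleFinite (h : QuadBy M L s d) : Module.Finite M L :=
  Module.Finite.equiv h.coordEquiv

theorem exists_lift (h : QuadBy M L s d) {E : Type*} [Field E] (f : M →+* E) {e : E}
    (he : e ^ 2 = f d) : ∃ g : L →+* E, (∀ x, g (algebraMap M L x) = f x) ∧ g s = e := by
  choose a b hab using h.gen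
  have key : ∀ u v : M, ∀ x : L, x = algebraMap M L u + algebraMap M L v * s →
      a x = u ∧ b x = v := fun u v x hx => h.eq_iff ((hab x).symm.trans hx)
  have hs := h.sq
  have h1 := key 1 0 1 (by simp)
  have h0 := key 0 0 0 (by simp)
  have hadd := fun x y => key (a x + a y) (b x + b y) (x + y) (by
    rw [map_add, map_add]
    linear_combination hab x + hab y)
  have hmul := fun x y => key (a x * a y + b x * b y * d) (a x * b y + b x * a y) (x * y) (by
    conv_lhs => rw [hab x, hab y]
    simp only [map_add, map_mul]
    linear_combination (algebraMap M L (b x) * algebraMap M L (b y)) * hs)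
  have hc := fun u => key u 0 (algebraMap M L u) (by simp)
  have hss := key 0 1 s (by simp)
  refine ⟨{ toFun := fun x => f (a x) + f (b x) * e, map_one' := ?_, map_mul' := ?_,
            map_zero' := ?_, map_add' := ?_ }, ?_, ?_⟩
  · simp [h1]
  · intro x y
    rw [(hmul x y).1, (hmul x y).2]
    simp only [map_add, map_mul]
    linear_combination -(f (b x) * f (b y)) * he
  · simp [h0]
  · intro x y
    rw [(hadd x y).1, (hadd x y).2]
    simp only [map_add]
    ring
  · intro u
    change f (a _) + f (b _) * e = f u
    rw [(hc u).1, (hc u).2]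
    simp
  · change f (a _) + f (b _) * e = e
    rw [hss.1, hss.2]
    simp

theorem isSquare_descent [CharZero M] (h : QuadBy M L s d) {e : M}
    (he : IsSquare (algebraMap M L e)) : IsSquare e ∨ IsSquare (e * d) := by
  obtain ⟨x, hx⟩ := he
  obtain ⟨a, b, rfl⟩ := h.gen x
  have h1 := h.eq_iff (a := e) (b := 0) (a' := a ^ 2 + d * b ^ 2) (b' := 2 * a * b) (by
    rw [hx]
    simp only [map_add, map_mul, map_pow, map_ofNat, map_zero]
    linear_combination (algebraMap M L b) ^ 2 * h.sq)
  have hab : a = 0 ∨ b = 0 := by simpa using h1.2.symm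
  rcases hab with rfl | rfl
  · right
    exact ⟨d * b, by rw [h1.1]; ring⟩
  · left
    exact ⟨a, by rw [h1.1]; ring⟩

section Galois

variable [NumberField M] [NumberField L] [h2 : Algebra.IsQuadraticExtension M L]

theorem exists_conj (h : QuadBy M L s d) : ∃ τ : Gal(L/M), τ ≠ 1 ∧ τ s = -s := by
  obtain ⟨g, hg, hgs⟩ := h.exists_lift (algebraMap M L) (e := -s) (by rw [neg_sq, h.sq])
  let φ : L →ₐ[M] L := { g with commutes' := hg }
  have hφ : φ s = -s := hgs
  have : Module.Finite M L := h.moduleFinite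
  refine ⟨AlgEquiv.ofBijective φ (Algebra.IsAlgebraic.algHom_bijective φ), ?_, ?_⟩
  · intro h1
    have h2 := congrArg (fun ψ : Gal(L/M) => ψ s) h1
    have h3 : φ s = s := h2
    rw [hφ] at h3
    have h4 : (algebraMap M L 2) * s = 0 := by
      rw [map_ofNat]
      linear_combination -h3
    rcases mul_eq_zero.mp h4 with h5 | h5
    · rw [map_eq_zero] at h5
      exact two_ne_zero h5
    · exact h.ne_zero h5
  · exact hφ

theorem conj_apply (h : QuadBy M L s d) {τ : Gal(L/M)} (hτ : τ ≠ 1) : τ s = -s := by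
  obtain ⟨σ, hσ, hs⟩ := h.exists_conj
  rcases quadratic_gal_eq hσ τ with h1 | h1
  · exact absurd h1 hτ
  · rw [h1, hs]

theorem norm_eq (h : QuadBy M L s d) (a b : M) :
    Algebra.norm M (algebraMap M L a + algebraMap M L b * s) = a ^ 2 - d * b ^ 2 := by
  obtain ⟨σ, hσ, hs⟩ := h.exists_conj
  apply (algebraMap M L).injective
  rw [quadratic_norm_eq hσ, map_add, map_mul, hs, AlgEquiv.commutes, AlgEquiv.commutes]
  simp only [map_sub, map_mul, map_pow]
  linear_combination -(algebraMap M L b) ^ 2 * h.sq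

end Galois

theorem mem_adjoin {K F : Type*} [Field K] [Field F] [Algebra K F] {s : F} {d : K}
    (hs : s ^ 2 = algebraMap K F d) (hd : ¬ IsSquare d) {x : F}
    (hx : x ∈ IntermediateField.adjoin K {s}) :
    ∃ a b : K, x = algebraMap K F a + algebraMap K F b * s := by
  induction hx using IntermediateField.adjoin_induction with
  | mem x hx =>
    rw [Set.mem_singleton_iff] at hx
    exact ⟨0, 1, by simp [hx]⟩
  | algebraMap x => exact ⟨x, 0, by simp⟩
  | add x y hx hy hx' hy' =>
    obtain ⟨a, b, rfl⟩ := hx'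
    obtain ⟨a', b', rfl⟩ := hy'
    exact ⟨a + a', b + b', by simp only [map_add]; ring⟩
  | mul x y hx hy hx' hy' =>
    obtain ⟨a, b, rfl⟩ := hx'
    obtain ⟨a', b', rfl⟩ := hy'
    refine ⟨a * a' + b * b' * d, a * b' + b * a', ?_⟩
    simp only [map_add, map_mul]
    linear_combination (algebraMap K F b * algebraMap K F b') * hs
  | inv x hx hx' =>
    obtain ⟨a, b, rfl⟩ := hx'
    rcases eq_or_ne (a ^ 2 - d * b ^ 2) 0 with h0 | h0
    · have hb : b = 0 := by
        by_contra hb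
        apply hd
        refine ⟨a / b, ?_⟩
        field_simp
        linear_combination -h0
      subst hb
      exact ⟨a⁻¹, 0, by simp⟩
    · refine ⟨a / (a ^ 2 - d * b ^ 2), -b / (a ^ 2 - d * b ^ 2), ?_⟩
      have h1 : algebraMap K F (a ^ 2 - d * b ^ 2) ≠ 0 := (map_ne_zero _).mpr h0
      have h2 : (algebraMap K F a + algebraMap K F b * s) *
          (algebraMap K F a - algebraMap K F b * s) = algebraMap K F (a ^ 2 - d * b ^ 2) := by
        simp only [map_sub, map_mul, map_pow]
        linear_combination -(algebraMap K F b) ^ 2 * hs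
      have h3 : algebraMap K F a + algebraMap K F b * s ≠ 0 := by
        intro h
        rw [h, zero_mul] at h2
        exact h1 h2.symm
      apply mul_left_cancel₀ h3
      rw [mul_inv_cancel₀ h3, map_div₀, map_div₀, map_neg]
      field_simp
      linear_combination -h2

theorem adjoin {K F : Type*} [Field K] [Field F] [Algebra K F] {s : F} {d : K}
    (hs : s ^ 2 = algebraMap K F d) (hd : ¬ IsSquare d) :
    QuadBy K (IntermediateField.adjoin K {s})
      (⟨s, IntermediateField.mem_adjoin_simple_self K s⟩ : IntermediateField.adjoin K {s}) d where
  sq := Subtype.ext hs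
  gen := fun x => by
    obtain ⟨a, b, hab⟩ := mem_adjoin hs hd x.2
    exact ⟨a, b, Subtype.ext hab⟩
  nsq := hd

theorem of_adjoin_eq_top {K F : Type*} [Field K] [Field F] [Algebra K F] {s : F} {d : K}
    (hs : s ^ 2 = algebraMap K F d) (hd : ¬ IsSquare d)
    (htop : IntermediateField.adjoin K {s} = ⊤) : QuadBy K F s d where
  sq := hs
  gen := fun _ => mem_adjoin hs hd (htop ▸ IntermediateField.mem_top)
  nsq := hd

end QuadBy

section General

variable {L : Type*} [Field L] [NumberField L]

theorem exists_ringOfIntegers {x : L} (hx : IsIntegral ℤ x) : ∃ y : 𝓞 L, algebraMap (𝓞 L) L y = x :=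
  ⟨⟨x, hx⟩, rfl⟩

theorem absNorm_span_sq {w : 𝓞 L} {n : ℕ} (h : span {w ^ 2} = span {(n : 𝓞 L)}) :
    absNorm (span {w}) ^ 2 = n ^ Module.finrank ℚ L := by
  rw [← map_pow, span_singleton_pow, h, absNorm_span_natCast, RingOfIntegers.rank]

theorem eq_span_of_absNorm_prime {P : Ideal (𝓞 L)} [hP : P.IsPrime] {w : 𝓞 L}
    (hw : w ∈ P) (h : (absNorm (span {w})).Prime) : P = span {w} := by
  have hle : span {w} ≤ P := (span_singleton_le_iff_mem P).mpr hw
  have hne : P ≠ ⊥ := by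
    rintro rfl
    rw [mem_bot] at hw
    subst hw
    simp [Nat.not_prime_zero] at h
  refine (Ideal.eq_of_le_of_absNorm_eq hne hle ?_).symm
  rcases (Nat.dvd_prime h).mp (absNorm_dvd_absNorm_of_le hle) with h1 | h1
  · exact absurd (absNorm_eq_one_iff.mp h1) hP.ne_top
  · exact h1

theorem eq_span_of_absNorm_prime_sq {P : Ideal (𝓞 L)} [hP : P.IsPrime] {w : 𝓞 L} {l : ℕ}
    (hl : l.Prime) (hw : w ∈ P) (h : absNorm (span {w}) = l ^ 2) (hPl : absNorm P ≠ l) :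
    P = span {w} := by
  have hle : span {w} ≤ P := (span_singleton_le_iff_mem P).mpr hw
  have hne : P ≠ ⊥ := by
    rintro rfl
    rw [mem_bot] at hw
    subst hw
    have := pow_ne_zero 2 hl.ne_zero
    rw [← h] at this
    simp at this
  refine (Ideal.eq_of_le_of_absNorm_eq hne hle ?_).symm
  have hd := absNorm_dvd_absNorm_of_le hle
  rw [h] at hd ⊢
  obtain ⟨i, hi, hi2⟩ := (Nat.dvd_prime_pow hl).mp hd
  interval_cases i
  · exact absurd (absNorm_eq_one_iff.mp (by simpa using hi2)) hP.ne_top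
  · exact absurd (by simpa using hi2) hPl
  · exact hi2

theorem pow_absNorm_sub_one_mem {P : Ideal (𝓞 L)} [hP : P.IsPrime] (hne : P ≠ ⊥) {x : 𝓞 L}
    (hx : x ∉ P) : x ^ (absNorm P - 1) - 1 ∈ P := by
  have : P.IsMaximal := hP.isMaximal hne
  let _ : Field (𝓞 L ⧸ P) := Ideal.Quotient.field P
  have : Finite (𝓞 L ⧸ P) := Ideal.finiteQuotientOfFreeOfNeBot P hne
  have := Fintype.ofFinite (𝓞 L ⧸ P)
  have h0 : Ideal.Quotient.mk P x ≠ 0 := by rwa [Ne, Ideal.Quotient.eq_zero_iff_mem]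
  have h1 := FiniteField.pow_card_sub_one_eq_one _ h0
  have h2 : Fintype.card (𝓞 L ⧸ P) = absNorm P := by
    rw [absNorm_apply, Submodule.cardQuot_apply, Nat.card_eq_fintype_card]
  rw [← Ideal.Quotient.eq_zero_iff_mem, map_sub, map_pow, map_one, ← h2, h1, sub_self]

/-- An odd order criterion for the class group. -/
theorem odd_classNumber_of_two_torsion (h : ∀ c : ClassGroup (𝓞 L), c * c = 1 → c = 1) :
    Odd (classNumber L) := by
  rw [← Nat.not_even_iff_odd]
  intro he
  obtain ⟨c, hc⟩ := exists_prime_orderOf_dvd_card 2 (G := ClassGroup (𝓞 L)) (even_iff_two_dvd.mp he)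
  have h1 := h c (by rw [← pow_two, ← hc, pow_orderOf_eq_one])
  rw [h1, orderOf_one] at hc
  omega

variable {M : Type*} [Field M] [NumberField M] [Algebra M L] [Algebra.IsQuadraticExtension M L]
  {τ : Gal(L/M)}

/-- Classes of invariant ideals are generated by extended classes and ramified primes. -/
theorem idealCls_mem_of_invariant (hτ : τ ≠ 1) (H : Subgroup (ClassGroup (𝓞 L)))
    (hext : ∀ c : ClassGroup (𝓞 M), extCls M L c ∈ H)
    (hram : ∀ P : Ideal (𝓞 L), P.IsPrime → P ≠ ⊥ → τ • P = P → (∀ x : 𝓞 L, τ • x - x ∈ P) →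
      idealCls P ∈ H) {I : Ideal (𝓞 L)} (hI : I ≠ ⊥) (h : τ • I = I) : idealCls I ∈ H := by
  refine (quadratic_invariant_induction hτ (S := fun I => I ≠ ⊥ ∧ idealCls I ∈ H) ?_ ?_ ?_ I hI h).2
  · rintro I J ⟨hI, hI2⟩ ⟨hJ, hJ2⟩
    exact ⟨mul_ne_zero hI hJ, by rw [idealCls_mul hI hJ]; exact H.mul_mem hI2 hJ2⟩
  · intro I hI
    exact ⟨map_ne_bot' hI, by rw [← extCls_idealCls hI]; exact hext _⟩
  · intro P h1 h2 h3 h4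
    exact ⟨h2, hram P h1 h2 h3 h4⟩

end General

theorem idealCls_rat_eq_one (c : ClassGroup (𝓞 ℚ)) : c = 1 := by
  obtain ⟨I, hI, rfl⟩ := idealCls_surjective c
  have : IsPrincipalIdealRing (𝓞 ℚ) := IsPrincipalIdealRing.of_surjective
    Rat.ringOfIntegersEquiv.symm.toRingHom Rat.ringOfIntegersEquiv.symm.surjective
  obtain ⟨x, hx⟩ := (IsPrincipalIdealRing.principal I).principal
  exact (idealCls_eq_one_iff hI).mpr ⟨x, hx⟩

theorem rat_unit_cases (u : (𝓞 ℚ)ˣ) : ((u : 𝓞 ℚ) : ℚ) = 1 ∨ ((u : 𝓞 ℚ) : ℚ) = -1 := by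
  have h := Int.isUnit_iff.mp (u.isUnit.map Rat.ringOfIntegersEquiv)
  change algebraMap (𝓞 ℚ) ℚ u = 1 ∨ algebraMap (𝓞 ℚ) ℚ u = -1
  rw [← Rat.ringOfIntegersEquiv_apply_coe]
  rcases h with h | h
  · left; rw [h]; norm_num
  · right; rw [h]; norm_num

theorem rat_of_isIntegral {x : ℚ} (hx : IsIntegral ℤ x) : ∃ n : ℤ, (n : ℚ) = x :=
  IsIntegrallyClosed.isIntegral_iff.mp hx

theorem unit_of_mul_eq_one {L : Type*} [Field L] {x y : L} (hx : IsIntegral ℤ x)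
    (hy : IsIntegral ℤ y) (h : x * y = 1) : ∃ u : (𝓞 L)ˣ, algebraMap (𝓞 L) L (u : 𝓞 L) = x := by
  refine ⟨⟨⟨x, hx⟩, ⟨y, hy⟩, RingOfIntegers.ext_algebraMap h,
    RingOfIntegers.ext_algebraMap ((mul_comm _ _).trans h)⟩, rfl⟩

section RealQuadratic

variable {p : ℕ} [hpp : Fact p.Prime] {F : Type*} [Field F] [NumberField F] {r : F}

theorem QuadBy.sq_natCast {M L : Type*} [Field M] [Field L] [Algebra M L] {s : L} {n : ℕ}
    (h : QuadBy M L s (n : M)) : s ^ 2 = n := by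
  rw [h.sq, map_natCast]

theorem isIntegral_of_sq_eq_natCast {L : Type*} [Field L] {s : L} {n : ℕ} (h : s ^ 2 = n) :
    IsIntegral ℤ s := by
  apply IsIntegral.of_pow (n := 2) (by norm_num)
  rw [h, ← map_natCast (algebraMap ℤ L)]
  exact isIntegral_algebraMap

theorem two_torsion_of_prime_mod_four (hp : p % 4 = 1) (hF : QuadBy ℚ F r (p : ℚ))
    (c : ClassGroup (𝓞 F)) (hc : c * c = 1) : c = 1 := by
  have := hF.isQuadraticExtension
  obtain ⟨τ, hτ, hτr⟩ := hF.exists_conj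
  have hr2 : r ^ 2 = p := hF.sq_natCast
  have hrI : IsIntegral ℤ r := isIntegral_of_sq_eq_natCast hr2
  have hτc : galCls τ c = c := by
    have h1 := mul_galCls hτ c
    rw [idealCls_rat_eq_one (relNormCls ℚ F c), map_one] at h1
    exact mul_left_cancel (h1.trans hc.symm)
  obtain ⟨J, hJ, hτJ, rfl⟩ := exists_invariant_ideal hτ (by
    intro u x hx
    rcases rat_unit_cases u with h | h
    · exact ⟨1, by simp [h]⟩
    · obtain ⟨a, b, hab⟩ := pell_neg_one (p := p) hp
      have hab' : (a : F) ^ 2 + 1 = p * b ^ 2 := by exact_mod_cast hab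
      have hI : IsIntegral ℤ ((a : F) + b * r) := (isIntegral_natCast _).add ((isIntegral_natCast _).mul hrI)
      have hI2 : IsIntegral ℤ (-((a : F) - b * r)) := ((isIntegral_natCast _).sub ((isIntegral_natCast _).mul hrI)).neg
      obtain ⟨v, hv⟩ := unit_of_mul_eq_one hI hI2 (by
        linear_combination -hab' + (b : F) ^ 2 * hr2)
      refine ⟨v, ?_⟩
      rw [h]
      have h3 := hF.norm_eq (a : ℚ) b
      rw [map_natCast, map_natCast, ← hv] at h3
      rw [h3]
      have : (a : ℚ) ^ 2 + 1 = p * b ^ 2 := by exact_mod_cast hab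
      linear_combination this) hτc
  rw [← Subgroup.mem_bot]
  refine idealCls_mem_of_invariant hτ ⊥ ?_ ?_ hJ hτJ
  · intro c
    rw [idealCls_rat_eq_one c, map_one]
    exact Subgroup.one_mem _
  · intro P hP hPb _ hx
    obtain ⟨ρ, hρ⟩ := exists_ringOfIntegers hrI
    have hmem : ρ ∈ P := by
      obtain ⟨k, hk⟩ : ∃ k, p = 4 * k + 1 := ⟨p / 4, by omega⟩
      have hk' : (p : F) = 4 * k + 1 := by exact_mod_cast hk
      have hw : IsIntegral ℤ ((1 + r) / 2) := by
        refine ⟨Polynomial.X ^ 2 - Polynomial.X - Polynomial.C (k : ℤ), by monicity!, ?_⟩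
        simp
        linear_combination (1 / 4 : F) * hr2 + (1 / 4 : F) * hk'
      obtain ⟨w, hw⟩ := exists_ringOfIntegers hw
      have h1 := hx w
      have h2 : τ • w - w = -ρ := by
        apply RingOfIntegers.ext_algebraMap
        rw [map_sub, map_neg, hρ, hw]
        change τ (algebraMap (𝓞 F) F w) - _ = _
        rw [hw, map_div₀, map_add, map_one, hτr, map_ofNat]
        ring
      rw [h2] at h1
      simpa using h1
    have hsq : ρ ^ 2 = (p : 𝓞 F) := by
      apply RingOfIntegers.ext_algebraMap
      rw [map_pow, hρ, hr2, map_natCast]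
    have hn := absNorm_span_sq (by rw [hsq])
    rw [Algebra.IsQuadraticExtension.finrank_eq_two] at hn
    have hn' : absNorm (span {ρ}) = p := Nat.pow_left_injective (n := 2) (by norm_num) hn
    rw [eq_span_of_absNorm_prime hmem (by rw [hn']; exact hpp.out), idealCls_span]
    exact Subgroup.one_mem _

end RealQuadratic

section Units

variable {p : ℕ} [hpp : Fact p.Prime] {F : Type*} [Field F] [NumberField F] {r : F}

theorem QuadBy.norm_sum_sq_nonneg (hF : QuadBy ℚ F r (p : ℚ)) (x y : F) :
    0 ≤ Algebra.norm ℚ (x ^ 2 + y ^ 2) := by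
  have := hF.isQuadraticExtension
  have hr2 : r ^ 2 = p := hF.sq_natCast
  obtain ⟨a, b, rfl⟩ := hF.gen x
  obtain ⟨c, d, rfl⟩ := hF.gen y
  have h1 := hF.norm_eq (a ^ 2 + p * b ^ 2 + (c ^ 2 + p * d ^ 2)) (2 * a * b + 2 * c * d)
  have h2 : (algebraMap ℚ F a + algebraMap ℚ F b * r) ^ 2 +
      (algebraMap ℚ F c + algebraMap ℚ F d * r) ^ 2 =
      algebraMap ℚ F (a ^ 2 + p * b ^ 2 + (c ^ 2 + p * d ^ 2)) +
        algebraMap ℚ F (2 * a * b + 2 * c * d) * r := by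
    simp only [map_add, map_mul, map_pow, map_natCast, map_ofNat]
    linear_combination ((algebraMap ℚ F b) ^ 2 + (algebraMap ℚ F d) ^ 2) * hr2
  rw [h2, h1]
  have hp0 : (0 : ℚ) ≤ p := Nat.cast_nonneg p
  have h3 : (a ^ 2 + p * b ^ 2 + (c ^ 2 + p * d ^ 2)) ^ 2 - p * (2 * a * b + 2 * c * d) ^ 2 =
      (a ^ 2 - p * b ^ 2) ^ 2 + (c ^ 2 - p * d ^ 2) ^ 2 + 2 * (a * c - p * b * d) ^ 2 +
        2 * (p * (a * d - b * c) ^ 2) := by ring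
  rw [h3]
  positivity

/-- A totally positive unit of a real quadratic field of prime discriminant is a square. -/
theorem QuadBy.unit_isSquare (hp : p % 4 = 1) (hF : QuadBy ℚ F r (p : ℚ)) (v : (𝓞 F)ˣ) {x y : F}
    (hv : algebraMap (𝓞 F) F v = x ^ 2 + y ^ 2) : IsSquare (algebraMap (𝓞 F) F v) := by
  have := hF.isQuadraticExtension
  have hr2 : r ^ 2 = p := hF.sq_natCast
  have hrI : IsIntegral ℤ r := isIntegral_of_sq_eq_natCast hr2
  have hN : Algebra.norm ℚ (algebraMap (𝓞 F) F v) = 1 := by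
    have h1 := NumberField.isUnit_iff_norm.mp v.isUnit
    rw [RingOfIntegers.coe_norm] at h1
    rwa [abs_of_nonneg] at h1
    change 0 ≤ Algebra.norm ℚ (algebraMap (𝓞 F) F v)
    rw [hv]
    exact hF.norm_sum_sq_nonneg x y
  obtain ⟨a, b, hab⟩ := hF.gen (algebraMap (𝓞 F) F v)
  rw [hab, hF.norm_eq] at hN
  have ha0 : 0 ≤ a := by
    obtain ⟨x0, x1, rfl⟩ := hF.gen x
    obtain ⟨y0, y1, rfl⟩ := hF.gen y
    have h1 := (hF.eq_iff (a := a) (b := b) (a' := x0 ^ 2 + p * x1 ^ 2 + (y0 ^ 2 + p * y1 ^ 2))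
      (b' := 2 * x0 * x1 + 2 * y0 * y1) (by
        rw [← hab, hv]
        simp only [map_add, map_mul, map_pow, map_natCast, map_ofNat]
        linear_combination ((algebraMap ℚ F x1) ^ 2 + (algebraMap ℚ F y1) ^ 2) * hr2)).1
    rw [h1]
    positivity
  obtain ⟨τ, hτ, hτr⟩ := hF.exists_conj
  have hvI : IsIntegral ℤ (algebraMap ℚ F a + algebraMap ℚ F b * r) := by
    rw [← hab]
    exact RingOfIntegers.isIntegral_coe _
  have hvI' : IsIntegral ℤ (algebraMap ℚ F a - algebraMap ℚ F b * r) := by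
    have h1 := hvI.map (τ.restrictScalars ℤ)
    have h2 : (τ.restrictScalars ℤ) (algebraMap ℚ F a + algebraMap ℚ F b * r) =
        algebraMap ℚ F a - algebraMap ℚ F b * r := by
      change τ _ = _
      rw [map_add, map_mul, hτr, AlgEquiv.commutes, AlgEquiv.commutes]
      ring
    rwa [h2] at h1
  have hratI : ∀ z : ℚ, IsIntegral ℤ (algebraMap ℚ F z) → ∃ n : ℤ, (n : ℚ) = z := fun z hz =>
    rat_of_isIntegral ((isIntegral_algebraMap_iff (algebraMap ℚ F).injective).mp hz)
  obtain ⟨T, hT⟩ := hratI (2 * a) (by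
    have h1 : algebraMap ℚ F (2 * a) = (algebraMap ℚ F a + algebraMap ℚ F b * r) +
        (algebraMap ℚ F a - algebraMap ℚ F b * r) := by
      rw [map_mul, map_ofNat]
      ring
    rw [h1]
    exact hvI.add hvI')
  obtain ⟨N, hN2⟩ := hratI (p * (2 * b)) (by
    have h1 : algebraMap ℚ F (p * (2 * b)) = ((algebraMap ℚ F a + algebraMap ℚ F b * r) -
        (algebraMap ℚ F a - algebraMap ℚ F b * r)) * r := by
      simp only [map_mul, map_natCast, map_ofNat]
      linear_combination -2 * algebraMap ℚ F b * hr2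
    rw [h1]
    exact (hvI.sub hvI').mul hrI)
  have hpne : (p : ℚ) ≠ 0 := by exact_mod_cast hpp.out.ne_zero
  have hNT : N ^ 2 = p * (T ^ 2 - 4) := by
    have : (N : ℚ) ^ 2 = p * ((T : ℚ) ^ 2 - 4) := by
      rw [hN2, hT]
      linear_combination -4 * (p : ℚ) * hN
    exact_mod_cast this
  obtain ⟨s, rfl⟩ : (p : ℤ) ∣ N :=
    (Nat.prime_iff_prime_int.mp hpp.out).dvd_of_dvd_pow (Dvd.intro _ hNT.symm)
  have hpz : (p : ℤ) ≠ 0 := by exact_mod_cast hpp.out.ne_zero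
  have hTs : T ^ 2 - 4 = p * s ^ 2 := by
    apply mul_left_cancel₀ hpz
    linear_combination -hNT
  have hT0 : 0 ≤ T := by
    have : (0 : ℚ) ≤ T := by rw [hT]; positivity
    exact_mod_cast this
  have hT2 : 2 ≤ T := by
    have : 0 ≤ (p : ℤ) * s ^ 2 := by positivity
    nlinarith
  obtain ⟨t, rfl⟩ := Int.eq_ofNat_of_zero_le hT0
  obtain ⟨m, hm⟩ := add_two_of_sq_sub_four hp (by exact_mod_cast hT2) hTs
  have hvv : (1 + algebraMap (𝓞 F) F v) ^ 2 = algebraMap (𝓞 F) F v * (t + 2 : ℕ) := by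
    have h1 : (algebraMap ℚ F a) ^ 2 - p * (algebraMap ℚ F b) ^ 2 = 1 := by
      rw [← map_pow, ← map_pow, ← map_natCast (algebraMap ℚ F) p, ← map_mul, ← map_sub, hN, map_one]
    have h2 : (t : F) = 2 * algebraMap ℚ F a := by
      have := congrArg (algebraMap ℚ F) hT
      simpa using this
    push_cast
    rw [h2, hab]
    linear_combination -h1 + (algebraMap ℚ F b) ^ 2 * hr2
  have ht0 : ((t + 2 : ℕ) : F) ≠ 0 := by
    rw [Nat.cast_ne_zero]
    omega
  refine isSquare_mul_self_right (y := ((t + 2 : ℕ) : F)) ?_ ht0 ⟨_, by rw [← hvv, pow_two]⟩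
  rcases hm with hm | hm
  · exact ⟨m, by rw [hm]; push_cast; ring⟩
  · exact ⟨m * r, by rw [hm]; push_cast; linear_combination -(m : F) ^ 2 * hr2⟩

end Units

section Norms

variable {p q : ℕ} [hpp : Fact p.Prime] [hqq : Fact q.Prime]
  {F k L : Type*} [Field F] [NumberField F] [Field k] [NumberField k] [Field L] [NumberField L]
  [Algebra F k] [Algebra k L] [Algebra F L] [IsScalarTower F k L] {r : F} {ι : k} {s : L}

theorem norm_biquadratic (hk : QuadBy F k ι (-1)) (hL : QuadBy k L s (2 * q : k)) (hq : q % 4 = 3)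
    (x : L) : (∃ u v : F, Algebra.norm F x = u ^ 2 + v ^ 2) ∧
      ∀ φ : F →+* ℚ_[q], IsSquare (φ (Algebra.norm F x)) := by
  have := hk.isQuadraticExtension
  have := hL.isQuadraticExtension
  obtain ⟨A, B, rfl⟩ := hL.gen x
  obtain ⟨a, b, rfl⟩ := hk.gen A
  obtain ⟨c, d, rfl⟩ := hk.gen B
  have hι : ι ^ 2 = -1 := by rw [hk.sq, map_neg, map_one]
  have hN := hL.norm_eq (algebraMap F k a + algebraMap F k b * ι)
    (algebraMap F k c + algebraMap F k d * ι)
  have h2 : (algebraMap F k a + algebraMap F k b * ι) ^ 2 -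
      2 * q * (algebraMap F k c + algebraMap F k d * ι) ^ 2 =
      algebraMap F k (a ^ 2 - b ^ 2 - 2 * q * (c ^ 2 - d ^ 2)) +
        algebraMap F k (2 * a * b - 4 * q * c * d) * ι := by
    simp only [map_sub, map_mul, map_pow, map_natCast, map_ofNat]
    linear_combination ((algebraMap F k b) ^ 2 - 2 * q * (algebraMap F k d) ^ 2) * hι
  rw [← Algebra.norm_norm (S := k), hN, h2, hk.norm_eq]
  refine ⟨⟨a ^ 2 - b ^ 2 - 2 * q * (c ^ 2 - d ^ 2), 2 * a * b - 4 * q * c * d, by ring⟩, fun φ => ?_⟩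
  have h3 := normForm_isSquare hq (φ a) (φ b) (φ c) (φ d)
  convert h3 using 1
  simp only [map_sub, map_mul, map_pow, map_natCast, map_ofNat, map_neg, map_one]
  ring

/-- The norm of an ideal whose class is a square. -/
theorem relNorm_of_isSquare_cls
    (hk : QuadBy F k ι (-1)) (hL : QuadBy k L s (2 * q : k)) (hq : q % 4 = 3)
    {I : Ideal (𝓞 L)} (hI : I ≠ ⊥) (h : IsSquare (idealCls I)) :
    ∃ β : 𝓞 F, relNorm (𝓞 F) I ^ classNumber F = span {β} ∧
      (∃ u v : F, algebraMap (𝓞 F) F β = u ^ 2 + v ^ 2) ∧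
      ∀ φ : F →+* ℚ_[q], IsSquare (φ (algebraMap (𝓞 F) F β)) := by
  obtain ⟨c, hc⟩ := h
  obtain ⟨J, hJ, rfl⟩ := idealCls_surjective c
  rw [← idealCls_mul hJ hJ, idealCls_eq_iff hI (mul_ne_zero hJ hJ)] at hc
  obtain ⟨x, y, hx, hy, hxy⟩ := hc
  have hprin : ∀ J : Ideal (𝓞 L), J ≠ ⊥ → ∃ γ : 𝓞 F, relNorm (𝓞 F) J ^ classNumber F = span {γ} := by
    intro J hJ
    have hR : relNorm (𝓞 F) J ≠ ⊥ := by rwa [Ne, relNorm_eq_bot_iff]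
    refine (idealCls_eq_one_iff (pow_ne_zero _ hR)).mp ?_
    rw [idealCls_pow hR]
    exact pow_card_eq_one
  obtain ⟨γ, hγ⟩ := hprin J hJ
  obtain ⟨δ, hδ⟩ := hprin I hI
  have h1 := congrArg (fun K => relNorm (𝓞 F) K ^ classNumber F) hxy
  simp only [map_mul, mul_pow, hγ, hδ, relNorm_singleton, span_singleton_mul_span_singleton,
    span_singleton_pow] at h1
  rw [span_singleton_eq_span_singleton] at h1
  obtain ⟨u, hu⟩ := h1
  have hNx : algebraMap (𝓞 F) F (Algebra.intNorm (𝓞 F) (𝓞 L) x) =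
      Algebra.norm F (algebraMap (𝓞 L) L x) :=
    Algebra.algebraMap_intNorm (A := 𝓞 F) (B := 𝓞 L) (K := F) (L := L) x
  have hNy : algebraMap (𝓞 F) F (Algebra.intNorm (𝓞 F) (𝓞 L) y) =
      Algebra.norm F (algebraMap (𝓞 L) L y) :=
    Algebra.algebraMap_intNorm (A := 𝓞 F) (B := 𝓞 L) (K := F) (L := L) y
  have hx0 : Algebra.norm F (algebraMap (𝓞 L) L x) ≠ 0 := by
    rw [Ne, Algebra.norm_eq_zero_iff]
    simpa using hx
  have hβ : algebraMap (𝓞 F) F (δ * u) =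
      Algebra.norm F ((algebraMap (𝓞 L) L y / algebraMap (𝓞 L) L x) ^ classNumber F) *
        (algebraMap (𝓞 F) F γ) ^ 2 := by
    have hk1 := congrArg (algebraMap (𝓞 F) F) hu
    simp only [map_mul, map_pow, hNx, hNy] at hk1
    rw [map_pow, norm_div_field, div_pow, map_mul]
    field_simp
    linear_combination hk1
  have hnorm := norm_biquadratic hk hL hq
    ((algebraMap (𝓞 L) L y / algebraMap (𝓞 L) L x) ^ classNumber F)
  refine ⟨δ * u, ?_, ?_, fun φ => ?_⟩
  · rw [hδ, span_singleton_eq_span_singleton]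
    exact ⟨u, rfl⟩
  · obtain ⟨⟨v, w, hvw⟩, -⟩ := hnorm
    rw [hβ, hvw]
    exact ⟨v * algebraMap (𝓞 F) F γ, w * algebraMap (𝓞 F) F γ, by ring⟩
  · rw [hβ, map_mul, map_pow φ (algebraMap (𝓞 F) F γ)]
    exact (hnorm.2 φ).mul ⟨_, pow_two _⟩

theorem isSquare_of_pow_odd {K : Type*} [Field K] {x : K} (hx : x ≠ 0) {n : ℕ} (hn : Odd n)
    (h : IsSquare (x ^ n)) : IsSquare x := by
  obtain ⟨m, rfl⟩ := hn
  refine isSquare_mul_self_right (y := x ^ (2 * m)) ⟨x ^ m, by ring⟩ (pow_ne_zero _ hx) ?_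
  rwa [pow_succ, mul_comm] at h

theorem isSquare_absNorm_of_isSquare_cls (hp : p % 4 = 1) (hF : QuadBy ℚ F r (p : ℚ))
    (hk : QuadBy F k ι (-1)) (hL : QuadBy k L s (2 * q : k)) (hq : q % 4 = 3)
    (hpq : IsSquare ((p : ℤ) : ZMod q)) (hpq0 : ((p : ℤ) : ZMod q) ≠ 0)
    {I : Ideal (𝓞 L)} (hI : I ≠ ⊥) (h : IsSquare (idealCls I)) :
    IsSquare ((absNorm I : ℕ) : ℚ_[q]) := by
  have := hF.isQuadraticExtension
  obtain ⟨β, hβ, ⟨u, v, huv⟩, hφ⟩ := relNorm_of_isSquare_cls hk hL hq hI h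
  have hodd := odd_classNumber_of_two_torsion (two_torsion_of_prime_mod_four hp hF)
  have h1 := congrArg absNorm hβ
  rw [map_pow, absNorm_relNorm (𝓞 F) (𝓞 L) I, absNorm_span_singleton] at h1
  have h2 : ((Algebra.norm ℤ β : ℤ) : ℚ) = Algebra.norm ℚ (algebraMap (𝓞 F) F β) :=
    Algebra.coe_norm_int β
  have h3 : 0 ≤ Algebra.norm ℤ β := by
    have := hF.norm_sum_sq_nonneg u v
    rw [← huv, ← h2] at this
    exact_mod_cast this
  have h4 : ((absNorm I ^ classNumber F : ℕ) : ℚ) = Algebra.norm ℚ (algebraMap (𝓞 F) F β) := by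
    rw [← h2, h1]
    rw [← Int.cast_natCast, Int.natAbs_of_nonneg h3]
  obtain ⟨e, he⟩ := padic_isSquare_of_zmod (by omega) hpq0 hpq
  have he2 : e ^ 2 = (Rat.castHom ℚ_[q]) (p : ℚ) := by
    rw [map_natCast, pow_two, ← he]
    simp
  obtain ⟨φ₁, h11, h12⟩ := hF.exists_lift _ he2
  obtain ⟨φ₂, h21, h22⟩ := hF.exists_lift _ (e := -e) (by rw [neg_sq, he2])
  refine isSquare_of_pow_odd ?_ hodd ?_
  · rw [Nat.cast_ne_zero]
    exact fun h => hI (absNorm_eq_zero_iff.mp h)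
  · have h5 := (hφ φ₁).mul (hφ φ₂)
    obtain ⟨a, b, hab⟩ := hF.gen (algebraMap (𝓞 F) F β)
    rw [hab, hF.norm_eq] at h4
    have h6 := congrArg (Rat.castHom ℚ_[q]) h4
    rw [map_natCast, Nat.cast_pow] at h6
    have h7 : (Rat.castHom ℚ_[q]) (a ^ 2 - p * b ^ 2) =
        φ₁ (algebraMap (𝓞 F) F β) * φ₂ (algebraMap (𝓞 F) F β) := by
      rw [hab]
      simp only [map_sub, map_add, map_mul, map_pow, h11, h12, h21, h22]
      linear_combination ((Rat.castHom ℚ_[q]) b) ^ 2 * he2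
    rw [h6, h7]
    exact h5

theorem not_isSquare_cls_of_pow_four (hp : p % 4 = 1) (hF : QuadBy ℚ F r (p : ℚ))
    (hk : QuadBy F k ι (-1)) (hL : QuadBy k L s (2 * q : k)) (hq : q % 8 = 3)
    (hpq : IsSquare ((p : ℤ) : ZMod q)) (hpq0 : ((p : ℤ) : ZMod q) ≠ 0)
    {I : Ideal (𝓞 L)} (hI : I ^ 4 = span {2}) : ¬ IsSquare (idealCls I) := by
  intro h
  have := hF.isQuadraticExtension
  have := hk.isQuadraticExtension
  have := hL.isQuadraticExtension
  have hI0 : I ≠ ⊥ := by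
    rintro rfl
    rw [Ideal.bot_pow (by norm_num), eq_comm, span_singleton_eq_bot] at hI
    exact two_ne_zero hI
  obtain ⟨β, hβ, ⟨u, v, huv⟩, hφ⟩ := relNorm_of_isSquare_cls hk hL (by omega) hI0 h
  have hodd := odd_classNumber_of_two_torsion (two_torsion_of_prime_mod_four hp hF)
  have h2n : Algebra.intNorm (𝓞 F) (𝓞 L) 2 = 2 ^ 4 := by
    apply RingOfIntegers.ext_algebraMap
    have h1 : algebraMap (𝓞 F) F (Algebra.intNorm (𝓞 F) (𝓞 L) 2) =
        Algebra.norm F (algebraMap (𝓞 L) L 2) :=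
      Algebra.algebraMap_intNorm (A := 𝓞 F) (B := 𝓞 L) (K := F) (L := L) 2
    have h2 : algebraMap (𝓞 L) L 2 = algebraMap F L 2 := by rw [map_ofNat, map_ofNat]
    have h3 : Module.finrank F L = 4 := by
      rw [← Module.finrank_mul_finrank F k L, Algebra.IsQuadraticExtension.finrank_eq_two,
        Algebra.IsQuadraticExtension.finrank_eq_two]
    rw [h1, h2, Algebra.norm_algebraMap, h3, map_pow, map_ofNat]
  have h4 : span {β ^ 4} = span {((2 : 𝓞 F) ^ classNumber F) ^ 4} := by
    rw [← span_singleton_pow, ← hβ, ← pow_mul, mul_comm, pow_mul, ← map_pow, hI, relNorm_singleton,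
      h2n, span_singleton_pow, ← pow_mul, ← pow_mul, mul_comm]
  rw [span_singleton_eq_span_singleton] at h4
  obtain ⟨w, hw⟩ := h4
  have hw' := congrArg (algebraMap (𝓞 F) F) hw
  simp only [map_mul, map_pow, map_ofNat] at hw'
  set b := algebraMap (𝓞 F) F β with hb
  set n := classNumber F
  have h20 : (2 : F) ^ n ≠ 0 := pow_ne_zero _ two_ne_zero
  have hww : algebraMap (𝓞 F) F w * algebraMap (𝓞 F) F (w⁻¹ : (𝓞 F)ˣ) = 1 := by
    rw [← map_mul, ← Units.val_mul, mul_inv_cancel, Units.val_one, map_one]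
  have hb0 : b ≠ 0 := by
    intro h0
    rw [h0] at hw'
    exact pow_ne_zero 4 h20 (by rw [← hw']; ring)
  have hI1 : IsIntegral ℤ (b / 2 ^ n) := by
    apply IsIntegral.of_pow (n := 4) (by norm_num)
    have : (b / 2 ^ n) ^ 4 = algebraMap (𝓞 F) F (w⁻¹ : (𝓞 F)ˣ) := by
      rw [div_pow, div_eq_iff (pow_ne_zero 4 h20)]
      linear_combination algebraMap (𝓞 F) F (w⁻¹ : (𝓞 F)ˣ) * hw' - b ^ 4 * hww
    rw [this]
    exact RingOfIntegers.isIntegral_coe _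
  have hI2 : IsIntegral ℤ (2 ^ n / b) := by
    apply IsIntegral.of_pow (n := 4) (by norm_num)
    have : (2 ^ n / b) ^ 4 = algebraMap (𝓞 F) F w := by
      rw [div_pow, div_eq_iff (pow_ne_zero 4 hb0)]
      linear_combination -hw'
    rw [this]
    exact RingOfIntegers.isIntegral_coe _
  obtain ⟨t, ht⟩ := unit_of_mul_eq_one hI1 hI2 (by field_simp)
  have htsq : IsSquare (algebraMap (𝓞 F) F t) := by
    obtain ⟨m, hm⟩ := hodd
    refine hF.unit_isSquare hp t (x := (u + v) / 2 ^ (m + 1)) (y := (u - v) / 2 ^ (m + 1)) ?_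
    rw [ht, huv, hm]
    field_simp
    ring
  obtain ⟨e, he⟩ := padic_isSquare_of_zmod (by omega) hpq0 hpq
  have he2 : e ^ 2 = (Rat.castHom ℚ_[q]) (p : ℚ) := by
    rw [map_natCast, pow_two, ← he]
    simp
  obtain ⟨φ, -, -⟩ := hF.exists_lift _ he2
  have h5 : IsSquare ((2 : ℚ_[q]) ^ n) := by
    have h6 := htsq.map φ
    rw [ht, map_div₀, map_pow, map_ofNat] at h6
    have h7 := (hφ φ).div h6
    rwa [div_div_cancel₀ (by simpa using hb0)] at h7
  have h8 := isSquare_of_pow_odd two_ne_zero hodd h5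
  have h2z : ((2 : ℤ) : ZMod q) ≠ 0 := by
    have := two_ne_zero_zmod (q := q) (by omega)
    exact_mod_cast this
  have h9 := zmod_isSquare_of_padic (q := q) (n := 2) h2z (by exact_mod_cast h8)
  exact not_isSquare_zmod_of_mod_eight (q := q) (Or.inl hq) (by exact_mod_cast h9)

end Norms

section Gaussian

variable {K : Type*} [Field K] [NumberField K] {ι : K}

theorem QuadBy.gaussian_sq {M L : Type*} [Field M] [Field L] [Algebra M L] {s : L}
    (h : QuadBy M L s (-1)) : s ^ 2 = -1 := by
  rw [h.sq, map_neg, map_one]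

theorem isIntegral_of_sq_eq_neg_one {L : Type*} [Field L] {s : L} (h : s ^ 2 = -1) :
    IsIntegral ℤ s := by
  apply IsIntegral.of_pow (n := 2) (by norm_num)
  rw [h]
  exact isIntegral_one.neg

/-- The ring of integers of `ℚ(i)` is `ℤ[i]`. -/
theorem gaussian_integers (hK : QuadBy ℚ K ι (-1)) (x : 𝓞 K) :
    ∃ a b : ℤ, algebraMap (𝓞 K) K x = a + b * ι := by
  have := hK.isQuadraticExtension
  have hι := hK.gaussian_sq
  have hιI := isIntegral_of_sq_eq_neg_one hι
  obtain ⟨τ, hτ, hτι⟩ := hK.exists_conj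
  obtain ⟨a, b, hab⟩ := hK.gen (algebraMap (𝓞 K) K x)
  have hvI : IsIntegral ℤ (algebraMap ℚ K a + algebraMap ℚ K b * ι) := by
    rw [← hab]
    exact RingOfIntegers.isIntegral_coe _
  have hvI' : IsIntegral ℤ (algebraMap ℚ K a - algebraMap ℚ K b * ι) := by
    have h1 := hvI.map (τ.restrictScalars ℤ)
    have h2 : (τ.restrictScalars ℤ) (algebraMap ℚ K a + algebraMap ℚ K b * ι) =
        algebraMap ℚ K a - algebraMap ℚ K b * ι := by
      change τ _ = _
      rw [map_add, map_mul, hτι, AlgEquiv.commutes, AlgEquiv.commutes]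
      ring
    rwa [h2] at h1
  have hratI : ∀ z : ℚ, IsIntegral ℤ (algebraMap ℚ K z) → ∃ n : ℤ, (n : ℚ) = z := fun z hz =>
    rat_of_isIntegral ((isIntegral_algebraMap_iff (algebraMap ℚ K).injective).mp hz)
  obtain ⟨A, hA⟩ := hratI (2 * a) (by
    have h1 : algebraMap ℚ K (2 * a) = (algebraMap ℚ K a + algebraMap ℚ K b * ι) +
        (algebraMap ℚ K a - algebraMap ℚ K b * ι) := by
      rw [map_mul, map_ofNat]
      ring
    rw [h1]
    exact hvI.add hvI')
  obtain ⟨B, hB⟩ := hratI (2 * b) (by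
    have h1 : algebraMap ℚ K (2 * b) = ((algebraMap ℚ K a - algebraMap ℚ K b * ι) -
        (algebraMap ℚ K a + algebraMap ℚ K b * ι)) * ι := by
      rw [map_mul, map_ofNat]
      linear_combination 2 * algebraMap ℚ K b * hι
    rw [h1]
    exact (hvI'.sub hvI).mul hιI)
  obtain ⟨N, hN⟩ := hratI (a ^ 2 + b ^ 2) (by
    have h1 : algebraMap ℚ K (a ^ 2 + b ^ 2) = (algebraMap ℚ K a + algebraMap ℚ K b * ι) *
        (algebraMap ℚ K a - algebraMap ℚ K b * ι) := by
      simp only [map_add, map_pow]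
      linear_combination (algebraMap ℚ K b) ^ 2 * hι
    rw [h1]
    exact hvI.mul hvI')
  have h4 : A ^ 2 + B ^ 2 = 4 * N := by
    have : (A : ℚ) ^ 2 + B ^ 2 = 4 * N := by
      rw [hA, hB, hN]
      ring
    exact_mod_cast this
  have hmod : ∀ C : ℤ, C ^ 2 % 4 = 0 ∧ C % 2 = 0 ∨ C ^ 2 % 4 = 1 := by
    intro C
    rcases Int.even_or_odd' C with ⟨m, rfl | rfl⟩
    · left
      constructor
      · ring_nf; omega
      · omega
    · right
      ring_nf
      omega
  have hA2 : A % 2 = 0 ∧ B % 2 = 0 := by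
    rcases hmod A with h1 | h1 <;> rcases hmod B with h2 | h2 <;> omega
  refine ⟨A / 2, B / 2, ?_⟩
  have h5 : ((A / 2 : ℤ) : ℚ) = a := by
    have : (A / 2) * 2 = A := by omega
    have : ((A / 2 : ℤ) : ℚ) * 2 = A := by exact_mod_cast this
    rw [hA] at this
    linarith
  have h6 : ((B / 2 : ℤ) : ℚ) = b := by
    have : (B / 2) * 2 = B := by omega
    have : ((B / 2 : ℤ) : ℚ) * 2 = B := by exact_mod_cast this
    rw [hB] at this
    linarith
  rw [hab, ← h5, ← h6, map_intCast, map_intCast]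

theorem gaussian_pid (hK : QuadBy ℚ K ι (-1)) : IsPrincipalIdealRing (𝓞 K) := by
  have hι := hK.gaussian_sq
  obtain ⟨i, hi⟩ := exists_ringOfIntegers (isIntegral_of_sq_eq_neg_one hι)
  have hii : i * i = ((-1 : ℤ) : 𝓞 K) := by
    apply RingOfIntegers.ext_algebraMap
    rw [map_mul, hi, ← pow_two, hι, map_intCast]
    simp
  refine IsPrincipalIdealRing.of_surjective (Zsqrtd.lift ⟨i, hii⟩) fun x => ?_
  obtain ⟨a, b, hab⟩ := gaussian_integers hK x
  refine ⟨⟨a, b⟩, ?_⟩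
  apply RingOfIntegers.ext_algebraMap
  rw [hab, Zsqrtd.lift_apply_apply]
  simp only [map_add, map_mul, map_intCast, hi]

theorem gaussian_idealCls (hK : QuadBy ℚ K ι (-1)) (c : ClassGroup (𝓞 K)) : c = 1 := by
  obtain ⟨I, hI, rfl⟩ := idealCls_surjective c
  have := gaussian_pid hK
  obtain ⟨x, hx⟩ := (IsPrincipalIdealRing.principal I).principal
  exact (idealCls_eq_one_iff hI).mpr ⟨x, hx⟩

theorem gaussian_units (hK : QuadBy ℚ K ι (-1)) (u : (𝓞 K)ˣ) :
    ∃ n : ℕ, algebraMap (𝓞 K) K u = ι ^ n := by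
  have := hK.isQuadraticExtension
  have hι := hK.gaussian_sq
  obtain ⟨a, b, hab⟩ := gaussian_integers hK u
  have h1 := NumberField.isUnit_iff_norm.mp u.isUnit
  rw [RingOfIntegers.coe_norm] at h1
  change |Algebra.norm ℚ (algebraMap (𝓞 K) K u)| = 1 at h1
  have h2 := hK.norm_eq (a : ℚ) b
  rw [map_intCast, map_intCast, ← hab] at h2
  rw [h2, abs_of_nonneg (by nlinarith [sq_nonneg (a : ℚ), sq_nonneg (b : ℚ)])] at h1
  have h3 : a ^ 2 + b ^ 2 = 1 := by
    have : (a : ℚ) ^ 2 + b ^ 2 = 1 := by linarith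
    exact_mod_cast this
  rw [hab]
  have ha : a ^ 2 ≤ 1 := by nlinarith
  have hb : b ^ 2 ≤ 1 := by nlinarith
  have ha1 : -1 ≤ a ∧ a ≤ 1 := abs_le.mp ((sq_le_one_iff_abs_le_one a).mp ha)
  have hb1 : -1 ≤ b ∧ b ≤ 1 := abs_le.mp ((sq_le_one_iff_abs_le_one b).mp hb)
  obtain ⟨ha1, ha2⟩ := ha1
  obtain ⟨hb1, hb2⟩ := hb1
  interval_cases a <;> interval_cases b <;> simp at h3
  · exact ⟨2, by simp [hι]⟩
  · exact ⟨3, by push_cast; linear_combination -ι * hι⟩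
  · exact ⟨1, by simp⟩
  · exact ⟨0, by simp⟩

end Gaussian

section LIdeal

variable {R : Type*} [CommRing R]

/-- The ideal above `2` generated by `1 + i` and `1 + ρ`. -/
def lIdeal (i ρ : R) : Ideal R := span {1 + i, 1 + ρ}

theorem lIdeal_sq {i ρ : R} {q : ℕ} (hi : i ^ 2 = -1) (hρ : ρ ^ 2 = i * q) (hq : q % 2 = 1) :
    lIdeal i ρ ^ 2 = span {1 + i} := by
  obtain ⟨m, hm⟩ : ∃ m, q = 2 * m + 1 := ⟨q / 2, by omega⟩
  subst hm
  push_cast at hρ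
  apply le_antisymm
  · rw [sq, lIdeal, span_pair_mul_span_pair, span_le]
    rintro x (rfl | rfl | rfl | rfl)
    · exact mem_span_singleton.mpr ⟨1 + i, rfl⟩
    · exact mem_span_singleton.mpr ⟨1 + ρ, rfl⟩
    · exact mem_span_singleton.mpr ⟨1 + ρ, by ring⟩
    · exact mem_span_singleton.mpr ⟨1 + (1 - i) * (ρ + i * m), by
        linear_combination hρ + (ρ + i * m) * hi⟩
  · rw [span_singleton_le_iff_mem]
    have ha : 1 + i ∈ lIdeal i ρ := subset_span (by simp)
    have hb : 1 + ρ ∈ lIdeal i ρ := subset_span (by simp)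
    have h1 : 1 + i = (1 + ρ) ^ 2 + i * (ρ + i * m) * (1 + i) ^ 2 := by
      linear_combination -hρ - (i * (ρ + i * m) + 2 * (ρ + i * m)) * hi
    rw [h1]
    exact Ideal.add_mem _ (Ideal.pow_mem_pow hb 2) (Ideal.mul_mem_left _ _ (Ideal.pow_mem_pow ha 2))

theorem lIdeal_pow_four {i ρ : R} {q : ℕ} (hi : i ^ 2 = -1) (hρ : ρ ^ 2 = i * q)
    (hq : q % 2 = 1) : lIdeal i ρ ^ 4 = span {2} := by
  rw [show 4 = 2 * 2 from rfl, pow_mul, lIdeal_sq hi hρ hq, span_singleton_pow]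
  apply le_antisymm <;> rw [span_singleton_le_iff_mem, mem_span_singleton]
  · exact ⟨i, by linear_combination hi⟩
  · exact ⟨-i, by linear_combination (i + 2) * hi⟩

end LIdeal

section UnitNorm

variable {M L : Type*} [Field M] [NumberField M] [Field L] [NumberField L] [Algebra M L]
  [Algebra.IsQuadraticExtension M L] {τ : Gal(L/M)}

/-- An integer whose relative norm is a unit is a unit. -/
theorem exists_unit_of_norm (hτ : τ ≠ 1) {x : L} (hx : IsIntegral ℤ x) (u : (𝓞 M)ˣ)
    (h : Algebra.norm M x = algebraMap (𝓞 M) M (u : 𝓞 M)) :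
    ∃ v : (𝓞 L)ˣ, algebraMap (𝓞 L) L (v : 𝓞 L) = x := by
  have h1 := quadratic_norm_eq hτ x
  rw [h] at h1
  have hτx : IsIntegral ℤ (τ x) := hx.map (τ.restrictScalars ℤ)
  have hu : IsIntegral ℤ (algebraMap M L (algebraMap (𝓞 M) M ((u⁻¹ : (𝓞 M)ˣ) : 𝓞 M))) :=
    (RingOfIntegers.isIntegral_coe _).map (IsScalarTower.toAlgHom ℤ M L)
  refine unit_of_mul_eq_one hx (hτx.mul hu) ?_
  rw [← mul_assoc, ← h1, ← map_mul, ← map_mul, Units.mul_inv, map_one, map_one]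

end UnitNorm

section Quartic

variable {K E : Type*} [Field K] [NumberField K] [Field E] [NumberField E] [Algebra K E]
  {ι : K} {s : E} {q : ℕ}

theorem exists_norm_eq_i (hK : QuadBy ℚ K ι (-1)) (hE : QuadBy K E s (2 * q : K))
    (hq : q % 8 = 3) [Fact q.Prime] : ∃ v : (𝓞 E)ˣ, Algebra.norm K (algebraMap (𝓞 E) E v) = ι := by
  have := hE.isQuadraticExtension
  obtain ⟨σ, hσ, hσs⟩ := hE.exists_conj
  have hι := hK.gaussian_sq
  obtain ⟨a, b, hab⟩ := pell_two_q hq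
  have habK : (q : K) * a ^ 2 = 2 * b ^ 2 + 1 := by exact_mod_cast congrArg (Nat.cast : ℕ → K) hab
  have habE : (q : E) * a ^ 2 = 2 * b ^ 2 + 1 := by exact_mod_cast congrArg (Nat.cast : ℕ → E) hab
  have hs2 : s ^ 2 = 2 * q := by rw [hE.sq, map_mul, map_ofNat, map_natCast]
  have hιE : (algebraMap K E ι) ^ 2 = -1 := by rw [← map_pow, hι, map_neg, map_one]
  have hιI : IsIntegral ℤ ι := isIntegral_of_sq_eq_neg_one hι
  have hιEI : IsIntegral ℤ (algebraMap K E ι) := isIntegral_of_sq_eq_neg_one hιE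
  have hsI : IsIntegral ℤ s := isIntegral_of_sq_eq_natCast (n := 2 * q) (by rw [hs2]; push_cast; rfl)
  have hN := hE.norm_eq (b * (1 - ι)) (a * (1 - ι) / 2)
  have h1 : (b * (1 - ι)) ^ 2 - 2 * q * (a * (1 - ι) / 2) ^ 2 = ι := by
    linear_combination (-(1 - ι) ^ 2 / 2) * habK - hι / 2
  rw [h1] at hN
  obtain ⟨u, hu⟩ := unit_of_mul_eq_one hιI hιI.neg (by linear_combination -hι)
  obtain ⟨v, hv⟩ := exists_unit_of_norm hσ (x := algebraMap K E (b * (1 - ι)) +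
    algebraMap K E (a * (1 - ι) / 2) * s) (by
      apply IsIntegral.of_pow (n := 2) (by norm_num)
      have h2 : (algebraMap K E (b * (1 - ι)) + algebraMap K E (a * (1 - ι) / 2) * s) ^ 2 =
          -algebraMap K E ι * (((4 * b ^ 2 + 1 : ℕ) : E) + ((2 * a * b : ℕ) : E) * s) := by
        simp only [map_mul, map_sub, map_one, map_div₀, map_ofNat, map_natCast]
        push_cast
        linear_combination (((a : E) * (1 - algebraMap K E ι) / 2) ^ 2) * hs2 +
          (1 - algebraMap K E ι) ^ 2 / 2 * habE +
          (2 * (b : E) ^ 2 + 1 / 2 + a * b * s) * hιE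
      rw [h2]
      exact hιEI.neg.mul ((isIntegral_natCast _).add ((isIntegral_natCast _).mul hsI))) u
    (by rw [hN, hu])
  exact ⟨v, by rw [hv, hN]⟩

theorem unit_norm_lift (hK : QuadBy ℚ K ι (-1)) (hE : QuadBy K E s (2 * q : K))
    (hq : q % 8 = 3) [Fact q.Prime] (u : (𝓞 K)ˣ) :
    ∃ v : (𝓞 E)ˣ, Algebra.norm K ((v : 𝓞 E) : E) = (u : 𝓞 K) := by
  obtain ⟨v, hv⟩ := exists_norm_eq_i hK hE hq
  obtain ⟨n, hn⟩ := gaussian_units hK u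
  refine ⟨v ^ n, ?_⟩
  change Algebra.norm K (algebraMap (𝓞 E) E ((v ^ n : (𝓞 E)ˣ) : 𝓞 E)) =
    algebraMap (𝓞 K) K (u : 𝓞 K)
  rw [Units.val_pow_eq_pow_val, map_pow, map_pow, hv, hn]

variable {i ρ : 𝓞 E}

theorem ringOfIntegers_i_sq (hK : QuadBy ℚ K ι (-1))
    (hi : algebraMap (𝓞 E) E i = algebraMap K E ι) : i ^ 2 = -1 := by
  apply RingOfIntegers.ext_algebraMap
  rw [map_pow, hi, ← map_pow, hK.gaussian_sq]
  simp only [map_neg, map_one]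

theorem ringOfIntegers_rho_sq (hK : QuadBy ℚ K ι (-1)) (hE : QuadBy K E s (2 * q : K))
    (hi : algebraMap (𝓞 E) E i = algebraMap K E ι)
    (hρ : 2 * algebraMap (𝓞 E) E ρ = (1 + algebraMap K E ι) * s) : ρ ^ 2 = i * q := by
  apply RingOfIntegers.ext_algebraMap
  have hs2 : s ^ 2 = 2 * q := by rw [hE.sq, map_mul, map_ofNat, map_natCast]
  have hιE : (algebraMap K E ι) ^ 2 = -1 := by
    rw [← map_pow, hK.gaussian_sq, map_neg, map_one]
  rw [map_pow, map_mul, map_natCast, hi]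
  have h1 : algebraMap (𝓞 E) E ρ = (1 + algebraMap K E ι) * s / 2 := by
    rw [← hρ]; ring
  rw [h1]
  linear_combination (1 + algebraMap K E ι) ^ 2 / 4 * hs2 + q / 2 * hιE

theorem exists_i_rho (hK : QuadBy ℚ K ι (-1)) (hE : QuadBy K E s (2 * q : K)) :
    ∃ i ρ : 𝓞 E, algebraMap (𝓞 E) E i = algebraMap K E ι ∧
      2 * algebraMap (𝓞 E) E ρ = (1 + algebraMap K E ι) * s := by
  have hs2 : s ^ 2 = 2 * q := by rw [hE.sq, map_mul, map_ofNat, map_natCast]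
  have hιE : (algebraMap K E ι) ^ 2 = -1 := by
    rw [← map_pow, hK.gaussian_sq, map_neg, map_one]
  have hI := isIntegral_of_sq_eq_neg_one hιE
  obtain ⟨i, hi⟩ := exists_ringOfIntegers hI
  obtain ⟨ρ, hρ⟩ := exists_ringOfIntegers (x := (1 + algebraMap K E ι) * s / 2) (by
    apply IsIntegral.of_pow (n := 2) (by norm_num)
    have h1 : ((1 + algebraMap K E ι) * s / 2) ^ 2 = algebraMap K E ι * q := by
      linear_combination (1 + algebraMap K E ι) ^ 2 / 4 * hs2 + q / 2 * hιE
    rw [h1]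
    exact hI.mul (isIntegral_natCast _))
  exact ⟨i, ρ, hi, by rw [hρ]; ring⟩

variable {σ : Gal(E/K)}

theorem smul_i (hi : algebraMap (𝓞 E) E i = algebraMap K E ι) : σ • i = i := by
  apply RingOfIntegers.ext_algebraMap
  change σ (algebraMap (𝓞 E) E i) = _
  rw [hi, AlgEquiv.commutes]

theorem smul_rho (hE : QuadBy K E s (2 * q : K)) (hσ : σ ≠ 1)
    (hρ : 2 * algebraMap (𝓞 E) E ρ = (1 + algebraMap K E ι) * s) : σ • ρ = -ρ := by
  have := hE.isQuadraticExtension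
  apply RingOfIntegers.ext_algebraMap
  change σ (algebraMap (𝓞 E) E ρ) = algebraMap (𝓞 E) E (-ρ)
  have h1 : algebraMap (𝓞 E) E ρ = algebraMap K E ((1 + ι) / 2) * s := by
    rw [map_div₀, map_add, map_one, map_ofNat]
    linear_combination hρ / 2
  rw [map_neg, h1, map_mul, AlgEquiv.commutes, hE.conj_apply hσ]
  ring

theorem finrank_quartic (hK : QuadBy ℚ K ι (-1)) (hE : QuadBy K E s (2 * q : K)) :
    Module.finrank ℚ E = 4 := by
  have := hE.isQuadraticExtension
  have := hK.isQuadraticExtension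
  rw [← Module.finrank_mul_finrank ℚ K E, Algebra.IsQuadraticExtension.finrank_eq_two,
    Algebra.IsQuadraticExtension.finrank_eq_two]

theorem ramified_quartic (hK : QuadBy ℚ K ι (-1)) (hE : QuadBy K E s (2 * q : K))
    (hq : q % 8 = 3) [hqp : Fact q.Prime] (hσ : σ ≠ 1)
    (hi : algebraMap (𝓞 E) E i = algebraMap K E ι)
    (hρ : 2 * algebraMap (𝓞 E) E ρ = (1 + algebraMap K E ι) * s)
    {P : Ideal (𝓞 E)} (hP : P.IsPrime) (hne : P ≠ ⊥) (hin : ∀ x : 𝓞 E, σ • x - x ∈ P) :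
    P = span {ρ} ∨ P = lIdeal i ρ := by
  have hi2 := ringOfIntegers_i_sq hK hi
  have hρ2 := ringOfIntegers_rho_sq hK hE hi hρ
  have hiP : i ∉ P := fun h => hP.ne_top ((eq_top_iff_one P).mpr (by
    have := P.mul_mem_left (-i) h
    rwa [show -i * i = 1 by linear_combination -hi2] at this))
  have h1 := hin ρ
  rw [smul_rho hE hσ hρ] at h1
  have h2 : 2 * ρ ∈ P := by
    have := P.neg_mem h1
    rwa [show -(-ρ - ρ) = 2 * ρ by ring] at this
  have hrk := finrank_quartic hK hE
  rcases hP.mem_or_mem h2 with h2 | hρP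
  · right
    have hle : lIdeal i ρ ≤ P := by
      apply hP.le_of_pow_le (n := 4)
      rw [lIdeal_pow_four hi2 hρ2 (by omega)]
      exact (span_singleton_le_iff_mem P).mpr h2
    have hn : absNorm (lIdeal i ρ) = 2 := by
      have h3 := congrArg absNorm (lIdeal_pow_four hi2 hρ2 (by omega))
      rw [map_pow, show (2 : 𝓞 E) = ((2 : ℕ) : 𝓞 E) by norm_num, absNorm_span_natCast,
        RingOfIntegers.rank, hrk] at h3
      exact Nat.pow_left_injective (n := 4) (by norm_num) h3
    refine (Ideal.eq_of_le_of_absNorm_eq hne hle ?_).symm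
    have h4 := absNorm_dvd_absNorm_of_le hle
    rw [hn] at h4 ⊢
    rcases (Nat.dvd_prime Nat.prime_two).mp h4 with h | h
    · exact absurd (absNorm_eq_one_iff.mp h) hP.ne_top
    · exact h
  · left
    refine eq_span_of_absNorm_prime_sq hqp.out hρP ?_ ?_
    · have h3 := absNorm_span_sq (w := ρ) (n := q) (by
        rw [hρ2]
        apply le_antisymm <;> rw [span_singleton_le_iff_mem, mem_span_singleton]
        · exact ⟨i, by ring⟩
        · exact ⟨-i, by linear_combination q * hi2⟩)
      rw [hrk, show 4 = 2 * 2 from rfl, pow_mul] at h3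
      exact Nat.pow_left_injective (n := 2) (by norm_num) h3
    · intro h
      have h3 := pow_absNorm_sub_one_mem hne hiP
      obtain ⟨m, hm⟩ : ∃ m, q - 1 = 2 * (2 * m + 1) := ⟨q / 4, by omega⟩
      rw [h, hm, pow_mul, hi2, Odd.neg_one_pow ⟨m, rfl⟩] at h3
      have h4 : (q : 𝓞 E) ∈ P := by
        have := P.mul_mem_left (-i * ρ) hρP
        rwa [show -i * ρ * ρ = (q : 𝓞 E) by linear_combination (-i) * hρ2 - q * hi2] at this
      apply hP.ne_top
      rw [eq_top_iff_one]
      obtain ⟨k, hk⟩ : ∃ k, q = 2 * k + 1 := ⟨q / 2, by omega⟩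
      have h5 := P.add_mem h4 (P.mul_mem_left (k : 𝓞 E) h3)
      rwa [show (q : 𝓞 E) + k * (-1 - 1) = 1 by rw [hk]; push_cast; ring] at h5

theorem invariant_form_quartic (hK : QuadBy ℚ K ι (-1)) (hE : QuadBy K E s (2 * q : K))
    (hq : q % 8 = 3) [hqp : Fact q.Prime] (hσ : σ ≠ 1)
    (hi : algebraMap (𝓞 E) E i = algebraMap K E ι)
    (hρ : 2 * algebraMap (𝓞 E) E ρ = (1 + algebraMap K E ι) * s)
    {I : Ideal (𝓞 E)} (hI : I ≠ ⊥) (h : σ • I = I) :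
    ∃ y : 𝓞 E, y ≠ 0 ∧ (σ • y = y ∨ σ • y = -y) ∧
      (I = span {y} ∨ I = span {y} * lIdeal i ρ) := by
  have := hE.isQuadraticExtension
  have := gaussian_pid hK
  have hi2 := ringOfIntegers_i_sq hK hi
  have hρ2 := ringOfIntegers_rho_sq hK hE hi hρ
  have hsq := lIdeal_sq hi2 hρ2 (by omega)
  have hi0 : 1 + i ≠ 0 := by
    intro h0
    have h1 : (2 : 𝓞 E) = 0 := by linear_combination (1 - i) * h0 + hi2
    exact two_ne_zero h1
  refine quadratic_invariant_induction hσ (S := fun I => ∃ y : 𝓞 E, y ≠ 0 ∧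
    (σ • y = y ∨ σ • y = -y) ∧ (I = span {y} ∨ I = span {y} * lIdeal i ρ)) ?_ ?_ ?_ I hI h
  · rintro I J ⟨y, hy0, hy, hI⟩ ⟨z, hz0, hz, hJ⟩
    have hyz : σ • (y * z) = y * z ∨ σ • (y * z) = -(y * z) := by
      rw [smul_mul']
      rcases hy with hy | hy <;> rcases hz with hz | hz <;> rw [hy, hz]
      · left; rfl
      · right; ring
      · right; ring
      · left; ring
    rcases hI with rfl | rfl <;> rcases hJ with rfl | rfl
    · exact ⟨y * z, mul_ne_zero hy0 hz0, hyz, Or.inl (span_singleton_mul_span_singleton y z)⟩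
    · refine ⟨y * z, mul_ne_zero hy0 hz0, hyz, Or.inr ?_⟩
      rw [← span_singleton_mul_span_singleton, mul_assoc]
    · refine ⟨y * z, mul_ne_zero hy0 hz0, hyz, Or.inr ?_⟩
      rw [← span_singleton_mul_span_singleton]
      ring
    · refine ⟨y * z * (1 + i), mul_ne_zero (mul_ne_zero hy0 hz0) hi0, ?_, Or.inl ?_⟩
      · have h1 : σ • (1 + i) = 1 + i := by rw [smul_add, smul_one, smul_i hi]
        rw [smul_mul', h1]
        rcases hyz with h2 | h2 <;> rw [h2]
        · left; rfl
        · right; ring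
      · rw [← span_singleton_mul_span_singleton, ← span_singleton_mul_span_singleton, ← hsq]
        ring
  · intro I hI
    obtain ⟨g, rfl⟩ := (IsPrincipalIdealRing.principal I).principal
    rw [submodule_span_eq] at hI ⊢
    refine ⟨algebraMap (𝓞 K) (𝓞 E) g, ?_, Or.inl (smul_algebraMap σ g), Or.inl ?_⟩
    · intro h0
      rw [FaithfulSMul.algebraMap_eq_zero_iff] at h0
      exact hI (by rw [h0]; simp)
    · rw [Ideal.map_span, Set.image_singleton]
  · intro P hP hne _ hin
    rcases ramified_quartic hK hE hq hσ hi hρ hP hne hin with rfl | rfl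
    · refine ⟨ρ, ?_, Or.inr (smul_rho hE hσ hρ), Or.inl rfl⟩
      rintro rfl
      simp at hne
    · exact ⟨1, one_ne_zero, Or.inl (smul_one σ), Or.inr (by rw [span_singleton_one, top_mul])⟩

theorem lIdeal_ne_bot (hK : QuadBy ℚ K ι (-1)) (hE : QuadBy K E s (2 * q : K)) (hq : q % 8 = 3)
    (hi : algebraMap (𝓞 E) E i = algebraMap K E ι)
    (hρ : 2 * algebraMap (𝓞 E) E ρ = (1 + algebraMap K E ι) * s) : lIdeal i ρ ≠ ⊥ := by
  intro h
  have h1 := lIdeal_pow_four (ringOfIntegers_i_sq hK hi) (ringOfIntegers_rho_sq hK hE hi hρ)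
    (show q % 2 = 1 by omega)
  rw [h, ← Ideal.zero_eq_bot, zero_pow (by norm_num), eq_comm, Ideal.zero_eq_bot,
    span_singleton_eq_bot] at h1
  exact two_ne_zero h1

/-- The `2`-class group of `ℚ(√(2q), i)` has order at most two if `lIdeal` is not a square class. -/
theorem cls_quartic (hK : QuadBy ℚ K ι (-1)) (hE : QuadBy K E s (2 * q : K))
    (hq : q % 8 = 3) [hqp : Fact q.Prime]
    (hi : algebraMap (𝓞 E) E i = algebraMap K E ι)
    (hρ : 2 * algebraMap (𝓞 E) E ρ = (1 + algebraMap K E ι) * s)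
    (hns : ¬IsSquare (idealCls (lIdeal i ρ))) {n : ℕ} :
    ∀ c : ClassGroup (𝓞 E), c ^ 2 ^ n = 1 → c = 1 ∨ c = idealCls (lIdeal i ρ) := by
  have := hE.isQuadraticExtension
  obtain ⟨σ, hσ, hσs⟩ := hE.exists_conj
  induction n with
  | zero =>
    intro c hc
    left
    simpa using hc
  | succ n ih =>
    intro c hc
    rw [pow_succ', pow_mul] at hc
    rcases ih _ hc with h | h
    · have h1 := mul_galCls hσ c
      rw [gaussian_idealCls hK (relNormCls K E c), map_one] at h1
      have h2 : galCls σ c = c := by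
        apply mul_left_cancel (a := c)
        rw [h1, ← sq, h]
      obtain ⟨J, hJ, hJσ, rfl⟩ := exists_invariant_ideal hσ
        (fun u _ _ => unit_norm_lift hK hE hq u) h2
      obtain ⟨y, hy0, -, h3⟩ := invariant_form_quartic hK hE hq hσ hi hρ hJ hJσ
      rcases h3 with rfl | rfl
      · left
        exact idealCls_span y
      · right
        rw [idealCls_mul (by simpa using hy0) (lIdeal_ne_bot hK hE hq hi hρ), idealCls_span,
          one_mul]
    · exact absurd ⟨c, by rw [← h, sq]⟩ hns

/-- Units of relative norm one are squares up to powers of `i`. -/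
theorem unit_norm_one_quartic (hK : QuadBy ℚ K ι (-1)) (hE : QuadBy K E s (2 * q : K))
    (hq : q % 8 = 3) [hqp : Fact q.Prime]
    (hi : algebraMap (𝓞 E) E i = algebraMap K E ι)
    (hρ : 2 * algebraMap (𝓞 E) E ρ = (1 + algebraMap K E ι) * s)
    (hns : ¬IsSquare (idealCls (lIdeal i ρ))) (u : (𝓞 E)ˣ)
    (hu : Algebra.norm K (algebraMap (𝓞 E) E u) = 1) :
    ∃ (e : (𝓞 E)ˣ) (k : ℕ), (u : 𝓞 E) = i ^ k * (e : 𝓞 E) ^ 2 := by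
  have := hE.isQuadraticExtension
  obtain ⟨σ, hσ, hσs⟩ := hE.exists_conj
  have h1 := quadratic_norm_eq hσ (algebraMap (𝓞 E) E u)
  rw [hu, map_one] at h1
  obtain ⟨w, hw0, hw⟩ := quadratic_hilbert90 hσ h1.symm
  have hw2 : (u : 𝓞 E) * w = σ • w := by
    apply RingOfIntegers.ext_algebraMap
    rw [map_mul]
    exact hw
  have hinv : σ • (span {w} : Ideal (𝓞 E)) = span {w} := by
    rw [smul_span_singleton, ← hw2, span_singleton_mul_left_unit u.isUnit]
  obtain ⟨y, hy0, hy, h3⟩ := invariant_form_quartic hK hE hq hσ hi hρ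
    (by simpa using hw0) hinv
  rcases h3 with h3 | h3
  swap
  · exfalso
    have h4 := congrArg idealCls h3
    rw [idealCls_mul (by simpa using hy0) (lIdeal_ne_bot hK hE hq hi hρ), idealCls_span,
      idealCls_span, one_mul] at h4
    exact hns (by rw [← h4]; exact IsSquare.one)
  · rw [span_singleton_eq_span_singleton] at h3
    obtain ⟨f, hf⟩ := h3
    have hfσ := quadratic_norm_eq hσ (algebraMap (𝓞 E) E f)
    have hfn : ∃ k : ℕ, (f : 𝓞 E) * σ • (f : 𝓞 E) = i ^ k := by
      obtain ⟨n, hn⟩ := gaussian_units hK (Units.map (RingOfIntegers.norm K) f)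
      refine ⟨n, ?_⟩
      apply RingOfIntegers.ext_algebraMap
      rw [map_mul]
      change _ * σ (algebraMap (𝓞 E) E f) = _
      rw [← hfσ, map_pow, hi, ← map_pow, ← hn]
      rfl
    obtain ⟨k, hk⟩ := hfn
    -- `w * f = y`, hence `u = ± f * σ(f)⁻¹`
    have h5 : ∃ m : ℕ, (u : 𝓞 E) * σ • (f : 𝓞 E) = i ^ m * f := by
      have h6 : (u : 𝓞 E) * (σ • (f : 𝓞 E)) * y = f * (σ • y) := by
        rw [← hf, smul_mul', ← hw2]
        ring
      rcases hy with hy | hy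
      · refine ⟨0, mul_right_cancel₀ hy0 ?_⟩
        rw [h6, hy]; ring
      · refine ⟨2, mul_right_cancel₀ hy0 ?_⟩
        rw [h6, hy, ringOfIntegers_i_sq hK hi]; ring
    obtain ⟨m, hm⟩ := h5
    have hi2 := ringOfIntegers_i_sq hK hi
    have hi4 : i ^ 4 = 1 := by
      rw [show 4 = 2 * 2 from rfl, pow_mul, hi2]; norm_num
    have h6 : (u : 𝓞 E) * i ^ k = i ^ m * (f : 𝓞 E) ^ 2 := by
      rw [← hk]
      linear_combination (f : 𝓞 E) * hm
    refine ⟨f, 3 * k + m, ?_⟩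
    have h7 : i ^ k * i ^ (3 * k) = 1 := by
      rw [← pow_add, show k + 3 * k = 4 * k by ring, pow_mul, hi4, one_pow]
    rw [pow_add]
    linear_combination (i ^ (3 * k)) * h6 - (u : 𝓞 E) * h7

end Quartic

section GaussianSplit

variable {K : Type*} [Field K] [NumberField K] {ι : K}

theorem conj_pair_absNorm (hK : QuadBy ℚ K ι (-1)) {j : 𝓞 K} (hj : algebraMap (𝓞 K) K j = ι)
    {p : ℕ} (x y : ℤ) (h : x ^ 2 + y ^ 2 = p) :
    absNorm (span {(x : 𝓞 K) + y * j}) = p ∧ absNorm (span {(x : 𝓞 K) - y * j}) = p := by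
  have := hK.isQuadraticExtension
  obtain ⟨τ, hτ, hτι⟩ := hK.exists_conj
  have hτj : τ • j = -j := by
    apply RingOfIntegers.ext_algebraMap
    change τ (algebraMap (𝓞 K) K j) = _
    rw [map_neg, hj, hτι]
  have hj2 : j ^ 2 = -1 := by
    apply RingOfIntegers.ext_algebraMap
    rw [map_pow, hj, hK.gaussian_sq]
    simp only [map_neg, map_one]
  have h1 : τ • (span {(x : 𝓞 K) + y * j} : Ideal (𝓞 K)) = span {(x : 𝓞 K) - y * j} := by
    rw [smul_span_singleton]
    congr 2
    change (MulSemiringAction.toRingHom Gal(K/ℚ) (𝓞 K) τ) _ = _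
    rw [map_add, map_mul, map_intCast, map_intCast]
    change _ + _ * τ • j = _
    rw [hτj]
    ring
  have h2 := absNorm_smul τ (span {(x : 𝓞 K) + y * j} : Ideal (𝓞 K))
  rw [h1] at h2
  have h3 : absNorm (span {(x : 𝓞 K) + y * j}) * absNorm (span {(x : 𝓞 K) - y * j}) = p ^ 2 := by
    rw [← map_mul, span_singleton_mul_span_singleton,
      show ((x : 𝓞 K) + y * j) * (x - y * j) = (p : 𝓞 K) by
        have : (x : 𝓞 K) ^ 2 + y ^ 2 = p := by exact_mod_cast congrArg (Int.cast : ℤ → 𝓞 K) h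
        linear_combination this - y ^ 2 * hj2,
      absNorm_span_natCast, RingOfIntegers.rank, Algebra.IsQuadraticExtension.finrank_eq_two]
  rw [h2, ← sq] at h3
  have h4 := Nat.pow_left_injective (n := 2) (by norm_num) h3
  exact ⟨h4, h2.trans h4⟩

theorem gaussian_split (hK : QuadBy ℚ K ι (-1)) {j : 𝓞 K} (hj : algebraMap (𝓞 K) K j = ι)
    {p : ℕ} [hpp : Fact p.Prime] (hp : p % 4 = 1) {A B : ℕ} (h : A ^ 2 + 1 = p * B ^ 2) :
    ∃ (π π' g : 𝓞 K) (u : (𝓞 K)ˣ), 1 + j * A = u * π * g ^ 2 ∧ π * π' = p ∧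
      absNorm (span {π}) = p ∧ absNorm (span {π'}) = p := by
  have := gaussian_pid hK
  have hj2 : j ^ 2 = -1 := by
    apply RingOfIntegers.ext_algebraMap
    rw [map_pow, hj, hK.gaussian_sq]
    simp only [map_neg, map_one]
  have hp0 : (p : ℤ) ≠ 0 := by exact_mod_cast hpp.out.ne_zero
  have hpi : Prime (p : ℤ) := Nat.prime_iff_prime_int.mp hpp.out
  have hZ : (A : ℤ) ^ 2 + 1 = p * B ^ 2 := by exact_mod_cast h
  obtain ⟨x, y, hxy, hd⟩ : ∃ x y : ℤ, x ^ 2 + y ^ 2 = p ∧ (p : ℤ) ∣ x + A * y := by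
    obtain ⟨x, y, hxy⟩ := Nat.Prime.sq_add_sq (p := p) (by omega)
    have hxy' : (x : ℤ) ^ 2 + y ^ 2 = p := by exact_mod_cast hxy
    have : (p : ℤ) ∣ (x + A * y) * (x + A * (-y)) := ⟨1 - B ^ 2 * y ^ 2, by
      linear_combination hxy' - (y : ℤ) ^ 2 * hZ⟩
    rcases hpi.dvd_or_dvd this with h1 | h1
    · exact ⟨x, y, hxy', h1⟩
    · exact ⟨x, -y, by rw [neg_sq]; exact hxy', h1⟩
  obtain ⟨m, hm⟩ := hd
  obtain ⟨n, hn⟩ : (p : ℤ) ∣ A * x - y := ⟨A * m - B ^ 2 * y, by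
    linear_combination (A : ℤ) * hm - y * hZ⟩
  have hmn : m ^ 2 + n ^ 2 = (B : ℤ) ^ 2 := by
    have h1 : (p : ℤ) ^ 2 * (m ^ 2 + n ^ 2) = p ^ 2 * B ^ 2 := by
      linear_combination (-(p * m) - (x + A * y)) * hm + (-(p * n) - (A * x - y)) * hn +
        (x ^ 2 + y ^ 2) * hZ + p * B ^ 2 * hxy
    exact mul_left_cancel₀ (pow_ne_zero 2 hp0) h1
  have hcast : ∀ {a b : ℤ}, a = b → (a : 𝓞 K) = b := fun h => by rw [h]
  have hxyK := hcast hxy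
  have hmK := hcast hm
  have hnK := hcast hn
  have hmnK := hcast hmn
  have hZK := hcast hZ
  push_cast at hxyK hmK hnK hmnK hZK
  have hpK : (p : 𝓞 K) ≠ 0 := by exact_mod_cast hpp.out.ne_zero
  have ha : 1 + j * A = (x + y * j) * (m + n * j) := by
    apply mul_left_cancel₀ hpK
    linear_combination (-(1 + j * A)) * hxyK + (x + y * j) * hmK + (x + y * j) * j * hnK +
      (y ^ 2 - A * x * y) * hj2
  have hb : 1 - j * A = (x - y * j) * (m - n * j) := by
    apply mul_left_cancel₀ hpK
    linear_combination (-(1 - j * A)) * hxyK + (x - y * j) * hmK - (x - y * j) * j * hnK +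
      (y ^ 2 - A * x * y) * hj2
  have hcop : IsCoprime (1 + j * A) (1 - j * A) := by
    obtain ⟨k, hk⟩ : ∃ k, p * B ^ 2 = 2 * k + 1 := by
      have hpo : p % 2 = 1 := by omega
      have hB : ¬ 2 ∣ B := by
        rintro ⟨b, rfl⟩
        have h1 : A ^ 2 + 1 = 4 * (p * b ^ 2) := by rw [h]; ring
        rcases Nat.even_or_odd' A with ⟨c, rfl | rfl⟩
        · ring_nf at h1; omega
        · ring_nf at h1; omega
      have : (p * B ^ 2) % 2 = 1 := by
        rw [Nat.mul_mod, Nat.pow_mod, hpo, show B % 2 = 1 by omega]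
      exact ⟨p * B ^ 2 / 2, by omega⟩
    have hkK : (p : 𝓞 K) * B ^ 2 = 2 * k + 1 := by exact_mod_cast congrArg (Nat.cast : ℕ → 𝓞 K) hk
    exact ⟨(1 - j * A) - k, -k, by linear_combination hkK + hZK - A ^ 2 * hj2⟩
  rw [ha, hb] at hcop
  have hcop2 : IsCoprime ((m : 𝓞 K) + n * j) (m - n * j) :=
    (hcop.of_mul_left_right).of_mul_right_right
  obtain ⟨g, hg⟩ := exists_associated_pow_of_mul_eq_pow' (k := 2) (c := (B : 𝓞 K)) hcop2
    (by linear_combination hmnK - n ^ 2 * hj2)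
  obtain ⟨u, hu⟩ := hg
  obtain ⟨h1, h2⟩ := conj_pair_absNorm hK hj x y hxy
  refine ⟨x + y * j, x - y * j, g, u, ?_, ?_, h1, h2⟩
  · rw [ha, ← hu]; ring
  · linear_combination hxyK - y ^ 2 * hj2

end GaussianSplit

section Octic

variable {K E L : Type*} [Field K] [NumberField K] [Field E] [NumberField E] [Algebra K E]
  [Field L] [NumberField L] [Algebra E L]
  {ι : K} {s : E} {t : L} {p q : ℕ} [hpp : Fact p.Prime] [hqp : Fact q.Prime]

theorem norm_norm_ne (hK : QuadBy ℚ K ι (-1)) (hE : QuadBy K E s (2 * q : K))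
    (hL : QuadBy E L t (p : E)) (hp : p % 8 = 5) (x : L) {v : K} (hv : v ^ 2 = -1) :
    Algebra.norm K (Algebra.norm E x) ≠ v := by
  have := hE.isQuadraticExtension
  have := hL.isQuadraticExtension
  obtain ⟨X, Y, rfl⟩ := hL.gen x
  obtain ⟨α, β, rfl⟩ := hE.gen X
  obtain ⟨γ, δ, rfl⟩ := hE.gen Y
  have hs2 : s ^ 2 = 2 * q := by rw [hE.sq, map_mul, map_ofNat, map_natCast]
  rw [hL.norm_eq]
  have h1 : (algebraMap K E α + algebraMap K E β * s) ^ 2 -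
      p * (algebraMap K E γ + algebraMap K E δ * s) ^ 2 =
      algebraMap K E (α ^ 2 + 2 * q * β ^ 2 - p * (γ ^ 2 + 2 * q * δ ^ 2)) +
        algebraMap K E (2 * α * β - 2 * p * γ * δ) * s := by
    simp only [map_add, map_sub, map_mul, map_pow, map_ofNat, map_natCast]
    linear_combination ((algebraMap K E β) ^ 2 - p * (algebraMap K E δ) ^ 2) * hs2
  rw [h1, hE.norm_eq]
  intro h
  obtain ⟨j, hj⟩ : ∃ j : ℚ_[p], j ^ 2 = -1 := by
    have h2 := padic_isSquare_of_zmod (q := p) (by omega) (n := -1)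
      (by push_cast; exact neg_ne_zero.mpr one_ne_zero)
      (by push_cast; exact isSquare_neg_one_zmod (by omega))
    obtain ⟨j, hj⟩ := h2
    exact ⟨j, by rw [sq, ← hj]; push_cast; rfl⟩
  obtain ⟨g, hg, hgι⟩ := hK.exists_lift (algebraMap ℚ ℚ_[p]) (e := j) (by
    rw [hj, map_neg, map_one])
  have hgv : g v ^ 2 = -1 := by rw [← map_pow, hv, map_neg, map_one]
  refine padic_norm_ne_fourth_root hp (a := g (α ^ 2 - 2 * q * β ^ 2 + p * (γ ^ 2 - 2 * q * δ ^ 2)))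
    (b := g (2 * α * γ - 4 * q * β * δ)) hgv ?_
  rw [← h, ← map_pow, ← map_pow, ← map_natCast g p, ← map_mul, ← map_sub]
  congr 1
  ring

/-- The unit of `L` whose norm to `E` is `-i`. -/
theorem exists_norm_eq_neg_i (hK : QuadBy ℚ K ι (-1)) (hE : QuadBy K E s (2 * q : K))
    (hL : QuadBy E L t (p : E)) (hp : p % 8 = 5) (hq : q % 8 = 3)
    (hleg : legendreSym q (p : ℤ) = 1) :
    ∃ v : (𝓞 L)ˣ, Algebra.norm E (algebraMap (𝓞 L) L v) = -algebraMap K E ι := by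
  have := hL.isQuadraticExtension
  obtain ⟨τ, hτ, hτt⟩ := hL.exists_conj
  obtain ⟨a, b, hab⟩ := pell_two_p_q hp hq hleg
  set j := algebraMap K E ι with hjdef
  have hj : j ^ 2 = -1 := by rw [hjdef, ← map_pow, hK.gaussian_sq, map_neg, map_one]
  have hjL : (algebraMap E L j) ^ 2 = -1 := by rw [← map_pow, hj, map_neg, map_one]
  have habE : (q : E) * a ^ 2 = 2 * p * b ^ 2 + 1 := by
    exact_mod_cast congrArg (Nat.cast : ℕ → E) hab
  have habL : (q : L) * a ^ 2 = 2 * p * b ^ 2 + 1 := by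
    exact_mod_cast congrArg (Nat.cast : ℕ → L) hab
  have hs2 : s ^ 2 = 2 * q := by rw [hE.sq, map_mul, map_ofNat, map_natCast]
  have hs2L : (algebraMap E L s) ^ 2 = 2 * q := by
    rw [← map_pow, hs2, map_mul, map_ofNat, map_natCast]
  have ht2 : t ^ 2 = p := by rw [hL.sq, map_natCast]
  have hsI : IsIntegral ℤ (algebraMap E L s) :=
    isIntegral_of_sq_eq_natCast (n := 2 * q) (by rw [hs2L]; push_cast; rfl)
  have htI : IsIntegral ℤ t := isIntegral_of_sq_eq_natCast ht2
  have hjLI := isIntegral_of_sq_eq_neg_one hjL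
  have hjI := isIntegral_of_sq_eq_neg_one hj
  have hN := hL.norm_eq (a * s * (1 - j) / 2) (b * (1 - j))
  have h1 : (a * s * (1 - j) / 2) ^ 2 - p * (b * (1 - j)) ^ 2 = -j := by
    linear_combination (a * (1 - j) / 2) ^ 2 * hs2 + (1 - j) ^ 2 / 2 * habE + hj / 2
  rw [h1] at hN
  obtain ⟨u, hu⟩ := unit_of_mul_eq_one hjI.neg hjI (by linear_combination -hj)
  obtain ⟨v, hv⟩ := exists_unit_of_norm hτ (x := algebraMap E L (a * s * (1 - j) / 2) +
    algebraMap E L (b * (1 - j)) * t) (by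
      apply IsIntegral.of_pow (n := 2) (by norm_num)
      have h2 : (algebraMap E L (a * s * (1 - j) / 2) + algebraMap E L (b * (1 - j)) * t) ^ 2 =
          -algebraMap E L j * (((q * a ^ 2 + 2 * p * b ^ 2 : ℕ) : L) +
            ((2 * a * b : ℕ) : L) * (algebraMap E L s * t)) := by
        simp only [map_mul, map_sub, map_one, map_div₀, map_ofNat, map_natCast]
        push_cast
        linear_combination (((a : L) * (1 - algebraMap E L j) / 2) ^ 2) * hs2L +
          (b * (1 - algebraMap E L j)) ^ 2 * ht2 +
          ((q : L) * a ^ 2 / 2 + p * b ^ 2 + a * b * algebraMap E L s * t) * hjL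
      rw [h2]
      exact hjLI.neg.mul ((isIntegral_natCast _).add
        ((isIntegral_natCast _).mul (hsI.mul htI)))) u
    (by rw [hN, hu])
  exact ⟨v, by rw [hv, hN]⟩

variable {i ρ : 𝓞 E}

theorem unit_norm_lift_octic (hK : QuadBy ℚ K ι (-1)) (hE : QuadBy K E s (2 * q : K))
    (hL : QuadBy E L t (p : E)) (hp : p % 8 = 5) (hq : q % 8 = 3)
    (hleg : legendreSym q (p : ℤ) = 1)
    (hi : algebraMap (𝓞 E) E i = algebraMap K E ι)
    (hρ : 2 * algebraMap (𝓞 E) E ρ = (1 + algebraMap K E ι) * s)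
    (hns : ¬IsSquare (idealCls (lIdeal i ρ))) (u : (𝓞 E)ˣ) (x : L)
    (hx : Algebra.norm E x = (u : 𝓞 E)) :
    ∃ v : (𝓞 L)ˣ, Algebra.norm E ((v : 𝓞 L) : L) = (u : 𝓞 E) := by
  have := hE.isQuadraticExtension
  have := hL.isQuadraticExtension
  have hι := hK.gaussian_sq
  have hi2 := ringOfIntegers_i_sq hK hi
  have hi4 : i ^ 4 = 1 := by
    rw [show 4 = 2 * 2 from rfl, pow_mul, hi2]; norm_num
  have hx' : Algebra.norm E x = algebraMap (𝓞 E) E u := hx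
  obtain ⟨n, hn⟩ := gaussian_units hK (Units.map (RingOfIntegers.norm K) u)
  have hn' : Algebra.norm K (algebraMap (𝓞 E) E u) = ι ^ n := hn
  have key : ∃ (e : (𝓞 E)ˣ) (k : ℕ), (u : 𝓞 E) = i ^ k * (e : 𝓞 E) ^ 2 := by
    have hne := norm_norm_ne hK hE hL hp x (v := ι ^ n)
    rw [hx'] at hne
    rcases Nat.even_or_odd' n with ⟨m, rfl | rfl⟩
    · rw [pow_mul, hι] at hn'
      rcases Nat.even_or_odd m with hm | hm
      · rw [hm.neg_one_pow] at hn'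
        exact unit_norm_one_quartic hK hE hq hi hρ hns u hn'
      · rw [hm.neg_one_pow] at hn'
        let iu : (𝓞 E)ˣ := ⟨i, -i, by linear_combination -hi2, by linear_combination -hi2⟩
        have h1 : Algebra.norm K (algebraMap (𝓞 E) E ((iu * u : (𝓞 E)ˣ) : 𝓞 E)) = 1 := by
          rw [Units.val_mul, map_mul, map_mul, hn']
          change Algebra.norm K (algebraMap (𝓞 E) E i) * -1 = 1
          rw [hi, Algebra.norm_algebraMap, Algebra.IsQuadraticExtension.finrank_eq_two, hι]
          norm_num
        obtain ⟨e, k, h2⟩ := unit_norm_one_quartic hK hE hq hi hρ hns _ h1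
        refine ⟨e, k + 3, ?_⟩
        rw [Units.val_mul] at h2
        change i * u = _ at h2
        rw [pow_add]
        linear_combination i ^ 3 * h2 - u * hi4
    · refine absurd hn' (hne ?_)
      rw [← pow_mul, mul_comm, pow_mul, hι, Odd.neg_one_pow ⟨m, rfl⟩]
  obtain ⟨e, k, he⟩ := key
  obtain ⟨θ, hθ⟩ := exists_norm_eq_neg_i hK hE hL hp hq hleg
  refine ⟨θ ^ (3 * k) * Units.map (algebraMap (𝓞 E) (𝓞 L)).toMonoidHom e, ?_⟩
  change Algebra.norm E (algebraMap (𝓞 L) L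
    ((θ : 𝓞 L) ^ (3 * k) * algebraMap (𝓞 E) (𝓞 L) (e : 𝓞 E))) = algebraMap (𝓞 E) E u
  rw [map_mul, map_mul, map_pow, map_pow, hθ, ← IsScalarTower.algebraMap_apply (𝓞 E) (𝓞 L) L,
    IsScalarTower.algebraMap_apply (𝓞 E) E L, Algebra.norm_algebraMap,
    Algebra.IsQuadraticExtension.finrank_eq_two, he, map_mul, map_pow, map_pow, hi, pow_mul]
  congr 2
  have h3 : (algebraMap K E ι) ^ 2 = -1 := by rw [← map_pow, hι, map_neg, map_one]
  linear_combination (-algebraMap K E ι) * h3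

end Octic

section OcticRamified

variable {K E L : Type*} [Field K] [NumberField K] [Field E] [NumberField E] [Algebra K E]
  [Field L] [NumberField L] [Algebra E L]
  {ι : K} {s : E} {t : L} {p q : ℕ} [hpp : Fact p.Prime] [hqp : Fact q.Prime]

theorem finrank_octic (hK : QuadBy ℚ K ι (-1)) (hE : QuadBy K E s (2 * q : K))
    (hL : QuadBy E L t (p : E)) : Module.finrank ℚ L = 8 := by
  have := hL.isQuadraticExtension
  rw [← Module.finrank_mul_finrank ℚ E L, finrank_quartic hK hE,
    Algebra.IsQuadraticExtension.finrank_eq_two]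

theorem absNorm_map_octic (hE : QuadBy K E s (2 * q : K)) (hL : QuadBy E L t (p : E)) (x : 𝓞 K) :
    absNorm (span {algebraMap (𝓞 E) (𝓞 L) (algebraMap (𝓞 K) (𝓞 E) x)}) =
      (absNorm (span {x}) ^ 2) ^ 2 := by
  have := hE.isQuadraticExtension
  have := hL.isQuadraticExtension
  have h1 : (span {algebraMap (𝓞 E) (𝓞 L) (algebraMap (𝓞 K) (𝓞 E) x)} : Ideal (𝓞 L)) =
      ((span {x} : Ideal (𝓞 K)).map (algebraMap (𝓞 K) (𝓞 E))).map (algebraMap (𝓞 E) (𝓞 L)) := by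
    rw [Ideal.map_span, Ideal.map_span, Set.image_singleton, Set.image_singleton]
  rw [h1, absNorm_algebraMap, absNorm_algebraMap, ← IsFractionRing.finrank_eq (𝓞 K) K (𝓞 E) E,
    ← IsFractionRing.finrank_eq (𝓞 E) E (𝓞 L) L, Algebra.IsQuadraticExtension.finrank_eq_two,
    Algebra.IsQuadraticExtension.finrank_eq_two]

/-- The square root of `p` factors into two integers of absolute norm `p ^ 2`. -/
theorem exists_sqrt_factor (hK : QuadBy ℚ K ι (-1)) (hE : QuadBy K E s (2 * q : K))
    (hL : QuadBy E L t (p : E)) (hp : p % 8 = 5) :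
    ∃ r r' : 𝓞 L, algebraMap (𝓞 L) L (r * r') = t ∧ absNorm (span {r}) = p ^ 2 ∧
      absNorm (span {r'}) = p ^ 2 := by
  obtain ⟨A, B, hAB⟩ := pell_neg_one (p := p) (by omega)
  obtain ⟨j₀, hj₀⟩ := exists_ringOfIntegers (isIntegral_of_sq_eq_neg_one hK.gaussian_sq)
  obtain ⟨π, π', g, u, h1, h2, h3, h4⟩ := gaussian_split hK hj₀ (p := p) (by omega) hAB
  let f : 𝓞 K →+* 𝓞 L := (algebraMap (𝓞 E) (𝓞 L)).comp (algebraMap (𝓞 K) (𝓞 E))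
  let F : 𝓞 K →+* L := (algebraMap (𝓞 L) L).comp f
  have ht2 : t ^ 2 = p := by rw [hL.sq, map_natCast]
  have htI : IsIntegral ℤ t := isIntegral_of_sq_eq_natCast ht2
  have hj2 : j₀ ^ 2 = -1 := by
    apply RingOfIntegers.ext_algebraMap
    rw [map_pow, hj₀, hK.gaussian_sq]
    simp only [map_neg, map_one]
  have hJ2 : F j₀ ^ 2 = -1 := by rw [← map_pow, hj2, map_neg, map_one]
  have h1F : 1 + F j₀ * A = F u * F π * F g ^ 2 := by
    rw [← map_mul, ← map_pow, ← map_mul, ← h1, map_add, map_mul, map_one, map_natCast]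
  have h2F : F π * F π' = p := by rw [← map_mul, h2, map_natCast]
  have hABL : (A : L) ^ 2 + 1 = p * B ^ 2 := by
    exact_mod_cast congrArg (Nat.cast : ℕ → L) hAB
  have huF : F u * F ((u⁻¹ : (𝓞 K)ˣ) : 𝓞 K) = 1 := by rw [← map_mul, Units.mul_inv, map_one]
  set J := F j₀ with hJdef
  set V := F ((u⁻¹ : (𝓞 K)ˣ) : 𝓞 K) with hV
  have hJ1 : 1 + J ≠ 0 := by
    intro h0
    have h5 : (2 : L) = 0 := by linear_combination (1 - J) * h0 + hJ2
    exact two_ne_zero h5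
  have hg0 : F g ≠ 0 := by
    intro h0
    rw [h0] at h1F
    have h5 : ((A ^ 2 + 1 : ℕ) : L) = 0 := by
      push_cast
      linear_combination (1 - J * A) * h1F + A ^ 2 * hJ2
    exact absurd h5 (Nat.cast_ne_zero.mpr (by positivity))
  have ht0 : t ≠ 0 := by
    intro h0
    rw [h0] at ht2
    exact (Nat.cast_ne_zero.mpr hpp.out.ne_zero : (p : L) ≠ 0) (by rw [← ht2]; norm_num)
  have hε : (A + B * t) * (B * t - A) = 1 := by
    linear_combination B ^ 2 * ht2 - hABL
  have hFI : ∀ x : 𝓞 K, IsIntegral ℤ (F x) := fun x => RingOfIntegers.isIntegral_coe (f x)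
  have hεI : IsIntegral ℤ (A + B * t) := (isIntegral_natCast _).add ((isIntegral_natCast _).mul htI)
  have hεI' : IsIntegral ℤ (B * t - A) := ((isIntegral_natCast _).mul htI).sub (isIntegral_natCast _)
  have hr2 : ((1 + J * (A + B * t)) / ((1 + J) * F g)) ^ 2 = (A + B * t) * F u * F π := by
    rw [div_pow, div_eq_iff (pow_ne_zero 2 (mul_ne_zero hJ1 hg0))]
    have hε2 : (A + B * t) ^ 2 = 2 * A * (A + B * t) + 1 := by
      linear_combination B ^ 2 * ht2 - hABL
    linear_combination (A + B * t) * (1 + J) ^ 2 * h1F + J ^ 2 * hε2 +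
      (1 - (A + B * t) * (1 + J * A)) * hJ2
  set x := (1 + J * (A + B * t)) / ((1 + J) * F g) with hx
  have hp0 : (p : L) ≠ 0 := Nat.cast_ne_zero.mpr hpp.out.ne_zero
  have hx0 : x ≠ 0 := by
    intro h0
    rw [h0] at hr2
    apply hp0
    linear_combination (-F π' * (B * t - A) * V) * hr2 - h2F - F π * F π' * hε -
      F π * F π' * (A + B * t) * (B * t - A) * huF
  have hr2' : (t / x) ^ 2 = (B * t - A) * V * F π' := by
    rw [div_pow, div_eq_iff (pow_ne_zero 2 hx0), hr2, ht2]
    linear_combination (-1 : L) * h2F - F π * F π' * hε -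
      F π * F π' * (A + B * t) * (B * t - A) * huF
  obtain ⟨r, hr⟩ := exists_ringOfIntegers (x := x) (by
    apply IsIntegral.of_pow (n := 2) (by norm_num)
    rw [hr2]
    exact (hεI.mul (hFI _)).mul (hFI _))
  obtain ⟨r', hr'⟩ := exists_ringOfIntegers (x := t / x) (by
    apply IsIntegral.of_pow (n := 2) (by norm_num)
    rw [hr2']
    exact (hεI'.mul (hFI _)).mul (hFI _))
  obtain ⟨v, hv⟩ := unit_of_mul_eq_one (x := (A + B * t) * F u) (y := (B * t - A) * V)
    (hεI.mul (hFI _)) (hεI'.mul (hFI _)) (by 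
      linear_combination (A + B * t) * (B * t - A) * huF + hε)
  have hvv : algebraMap (𝓞 L) L ((v⁻¹ : (𝓞 L)ˣ) : 𝓞 L) = (B * t - A) * V := by
    have h5 : algebraMap (𝓞 L) L v * algebraMap (𝓞 L) L ((v⁻¹ : (𝓞 L)ˣ) : 𝓞 L) = 1 := by
      rw [← map_mul, Units.mul_inv, map_one]
    rw [hv] at h5
    linear_combination (B * t - A) * V * h5 -
      algebraMap (𝓞 L) L ((v⁻¹ : (𝓞 L)ˣ) : 𝓞 L) * (A + B * t) * (B * t - A) * huF -
      algebraMap (𝓞 L) L ((v⁻¹ : (𝓞 L)ˣ) : 𝓞 L) * hε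
  have hn : ∀ (w : (𝓞 L)ˣ) (y : 𝓞 L) (z : 𝓞 K), y ^ 2 = w * f z → absNorm (span {z}) = p →
      absNorm (span {y}) = p ^ 2 := by
    intro w y z h5 h6
    have h7 : absNorm (span {y}) ^ 2 = (p ^ 2) ^ 2 := by
      rw [← map_pow, span_singleton_pow, h5, span_singleton_mul_left_unit w.isUnit, ← h6]
      exact absNorm_map_octic hE hL z
    exact Nat.pow_left_injective (n := 2) (by norm_num) h7
  refine ⟨r, r', ?_, hn v r π ?_ h3, hn v⁻¹ r' π' ?_ h4⟩
  · rw [map_mul, hr, hr']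
    field_simp
  · apply RingOfIntegers.ext_algebraMap
    rw [map_pow, map_mul, hr, hv, hr2]
    rfl
  · apply RingOfIntegers.ext_algebraMap
    rw [map_pow, map_mul, hr', hvv, hr2']
    rfl

variable {i ρ : 𝓞 E}

theorem ramified_octic (hK : QuadBy ℚ K ι (-1)) (hE : QuadBy K E s (2 * q : K))
    (hL : QuadBy E L t (p : E)) (hp : p % 8 = 5) (hq : q % 8 = 3)
    (hleg : legendreSym q (p : ℤ) = 1)
    (hi : algebraMap (𝓞 E) E i = algebraMap K E ι)
    (hρ : 2 * algebraMap (𝓞 E) E ρ = (1 + algebraMap K E ι) * s)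
    {τ : Gal(L/E)} (hτ : τ ≠ 1) {P : Ideal (𝓞 L)} (hP : P.IsPrime) (hne : P ≠ ⊥)
    (hin : ∀ x : 𝓞 L, τ • x - x ∈ P) : ∃ r, P = span {r} := by
  have := hL.isQuadraticExtension
  have ht2 : t ^ 2 = p := by rw [hL.sq, map_natCast]
  obtain ⟨k, hk⟩ : ∃ k, p = 4 * k + 1 := ⟨p / 4, by omega⟩
  have hpL : (p : L) = 4 * k + 1 := by rw [hk]; push_cast; rfl
  obtain ⟨z, hz⟩ := exists_ringOfIntegers (x := (1 + t) / 2) (by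
    refine ⟨Polynomial.X ^ 2 - Polynomial.X - Polynomial.C (k : ℤ), ?_, ?_⟩
    · monicity!
    · simp only [Polynomial.eval₂_sub, Polynomial.eval₂_pow, Polynomial.eval₂_X,
        map_natCast, Polynomial.eval₂_natCast]
      linear_combination ht2 / 4 + hpL / 4)
  obtain ⟨r, r', hrr, hr, hr'⟩ := exists_sqrt_factor hK hE hL hp
  have hT : r * r' ∈ P := by
    have h1 := P.neg_mem (hin z)
    have h2 : -(τ • z - z) = r * r' := by
      apply RingOfIntegers.ext_algebraMap
      rw [map_neg, map_sub]
      change -(τ (algebraMap (𝓞 L) L z) - _) = _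
      rw [hz, map_div₀, map_add, map_one, map_ofNat, hL.conj_apply hτ, hrr]
      ring
    rwa [h2] at h1
  have hpP : (p : 𝓞 L) ∈ P := by
    have h2 : (p : 𝓞 L) = r * r' * (r * r') := by
      apply RingOfIntegers.ext_algebraMap
      rw [map_mul, hrr, ← sq, ht2, map_natCast]
    rw [h2]
    exact P.mul_mem_left _ hT
  have hcop : ∀ m : ℕ, ¬ p ∣ m → (m : 𝓞 L) ∉ P := by
    intro m hm hmP
    have h1 : IsCoprime (p : ℤ) m := by
      rw [Nat.isCoprime_iff_coprime]
      exact (Nat.Prime.coprime_iff_not_dvd hpp.out).mpr hm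
    obtain ⟨a, b, hab⟩ := h1
    have h2 : (a : 𝓞 L) * p + b * m = 1 := by exact_mod_cast congrArg (Int.cast : ℤ → 𝓞 L) hab
    apply hP.ne_top
    rw [eq_top_iff_one, ← h2]
    exact P.add_mem (P.mul_mem_left _ hpP) (P.mul_mem_left _ hmP)
  have hPn : absNorm P ≠ p := by
    intro h
    obtain ⟨hqs, hq0⟩ := isSquare_q_zmod_p (p := p) (q := q) (by omega) (by omega) hleg
    set R := algebraMap (𝓞 E) (𝓞 L) ρ with hR
    set I := algebraMap (𝓞 E) (𝓞 L) i with hI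
    have hI2 : I ^ 2 = -1 := by
      rw [hI, ← map_pow, ringOfIntegers_i_sq hK hi, map_neg, map_one]
    have hR2 : R ^ 2 = I * q := by
      rw [hR, ← map_pow, ringOfIntegers_rho_sq hK hE hi hρ, map_mul, map_natCast]
    have hRP : R ∉ P := by
      intro hRP
      apply hcop q (by rwa [Ne, ZMod.natCast_eq_zero_iff] at hq0)
      have h2 : (q : 𝓞 L) = (-I * R) * R := by
        linear_combination I * hR2 + q * hI2
      rw [h2]
      exact P.mul_mem_left _ hRP
    have h1 := pow_absNorm_sub_one_mem hne hRP
    obtain ⟨m, hm⟩ : ∃ m, p - 1 = 2 * (2 * (2 * m + 1)) := ⟨p / 8, by omega⟩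
    have hm2 : p / 2 = 2 * (2 * m + 1) := by omega
    rw [h, hm, pow_mul, hR2, mul_pow, pow_mul, hI2, Odd.neg_one_pow ⟨m, rfl⟩] at h1
    have h2 := (ZMod.euler_criterion p hq0).mp hqs
    rw [hm2] at h2
    have h3 : (p : ℤ) ∣ (q : ℤ) ^ (2 * (2 * m + 1)) - 1 := by
      rw [← ZMod.intCast_zmod_eq_zero_iff_dvd]
      push_cast
      rw [h2, sub_self]
    obtain ⟨c, hc⟩ := h3
    have hcO : (q : 𝓞 L) ^ (2 * (2 * m + 1)) - 1 = p * c := by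
      exact_mod_cast congrArg (Int.cast : ℤ → 𝓞 L) hc
    have h4 := P.add_mem h1 (P.mul_mem_right (c : 𝓞 L) hpP)
    apply hcop 2 (by
      intro h5
      have := Nat.le_of_dvd (by norm_num) h5
      omega)
    have h6 : ((2 : ℕ) : 𝓞 L) = -(-1 * (q : 𝓞 L) ^ (2 * (2 * m + 1)) - 1 + p * c) := by
      rw [← hcO]
      push_cast
      ring
    rw [h6]
    exact P.neg_mem h4
  rcases hP.mem_or_mem hT with h | h
  · exact ⟨r, eq_span_of_absNorm_prime_sq hpp.out h hr hPn⟩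
  · refine ⟨r', ?_⟩
    have hr_norm := hr'
    exact eq_span_of_absNorm_prime_sq hpp.out h hr_norm hPn

/-- Classes of two-power order fixed by the Galois group of `L/E`. -/
theorem ambiguous_octic (hK : QuadBy ℚ K ι (-1)) (hE : QuadBy K E s (2 * q : K))
    (hL : QuadBy E L t (p : E)) (hp : p % 8 = 5) (hq : q % 8 = 3)
    (hleg : legendreSym q (p : ℤ) = 1)
    (hi : algebraMap (𝓞 E) E i = algebraMap K E ι)
    (hρ : 2 * algebraMap (𝓞 E) E ρ = (1 + algebraMap K E ι) * s)
    (hns : ¬IsSquare (idealCls (lIdeal i ρ)))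
    {τ : Gal(L/E)} (hτ : τ ≠ 1) (c : ClassGroup (𝓞 L)) (h2 : ∃ n : ℕ, c ^ 2 ^ n = 1)
    (hc : galCls τ c = c) : c = 1 ∨ c = extCls E L (idealCls (lIdeal i ρ)) := by
  have := hL.isQuadraticExtension
  obtain ⟨n, hn⟩ := h2
  obtain ⟨J, hJ, hJτ, rfl⟩ := exists_invariant_ideal hτ
    (unit_norm_lift_octic hK hE hL hp hq hleg hi hρ hns) hc
  obtain ⟨b, hb⟩ : idealCls J ∈ (extCls E L).range := by
    refine idealCls_mem_of_invariant hτ _ (fun c => MonoidHom.mem_range.mpr ⟨c, rfl⟩) ?_ hJ hJτ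
    intro P hP hne _ hin
    obtain ⟨r, rfl⟩ := ramified_octic hK hE hL hp hq hleg hi hρ hτ hP hne hin
    rw [idealCls_span]
    exact Subgroup.one_mem _
  rw [← hb] at hn ⊢
  have hl2 : idealCls (lIdeal i ρ) ^ 2 = 1 := by
    rw [← idealCls_pow (lIdeal_ne_bot hK hE hq hi hρ),
      lIdeal_sq (ringOfIntegers_i_sq hK hi) (ringOfIntegers_rho_sq hK hE hi hρ) (by omega),
      idealCls_span]
  obtain ⟨a, m, hm, ham⟩ := Nat.exists_eq_two_pow_mul_odd (n := orderOf b) (orderOf_pos b).ne'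
  have h3 : (b ^ m) ^ 2 ^ a = 1 := by
    rw [← pow_mul, mul_comm, ← ham, pow_orderOf_eq_one]
  have h4 := cls_quartic hK hE hq hi hρ hns _ h3
  obtain ⟨k, hk⟩ : ∃ k, extCls E L b = (extCls E L (b ^ m)) ^ k := by
    have h5 : (orderOf (extCls E L b)).Coprime m :=
      Nat.Coprime.coprime_dvd_left (orderOf_dvd_of_pow_eq_one hn)
        (Nat.Coprime.pow_left n (Nat.coprime_two_left.mpr hm))
    obtain ⟨k, hk⟩ := exists_pow_eq_self_of_coprime h5.symm
    exact ⟨k, by rw [map_pow, hk]⟩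
  rw [hk]
  rcases h4 with h4 | h4
  · left
    rw [h4, map_one, one_pow]
  · rw [h4]
    rcases Nat.even_or_odd' k with ⟨d, rfl | rfl⟩
    · left
      rw [pow_mul, ← map_pow, hl2, map_one, one_pow]
    · right
      rw [pow_succ, pow_mul, ← map_pow, hl2, map_one, one_pow, one_mul]

end OcticRamified

section PadicPrime

/-- An embedding into `ℚ_[l]` yields an integral ideal of absolute norm `l`. -/
theorem exists_absNorm_eq_of_padic {L : Type*} [Field L] [NumberField L] {l : ℕ} [hl : Fact l.Prime]
    (φ : L →+* ℚ_[l]) : ∃ I : Ideal (𝓞 L), absNorm I = l := by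
  have key : ∀ x : 𝓞 L, ∃ y : ℤ_[l], algebraMap ℤ_[l] ℚ_[l] y = φ (algebraMap (𝓞 L) L x) := by
    intro x
    rw [← IsIntegrallyClosed.isIntegral_iff]
    have h1 : IsIntegral ℤ (φ (algebraMap (𝓞 L) L x)) :=
      (RingOfIntegers.isIntegral_coe x).map φ.toIntAlgHom
    exact h1.tower_top
  choose f hf using key
  have hinj : Function.Injective (algebraMap ℤ_[l] ℚ_[l]) := IsFractionRing.injective _ _
  let g : 𝓞 L →+* ℤ_[l] :=
    { toFun := f
      map_one' := hinj (by rw [hf, map_one, map_one, map_one])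
      map_zero' := hinj (by rw [hf, map_zero, map_zero, map_zero])
      map_mul' := fun x y => hinj (by rw [hf, map_mul, map_mul, map_mul, hf, hf])
      map_add' := fun x y => hinj (by rw [hf, map_add, map_add, map_add, hf, hf]) }
  let ψ : 𝓞 L →+* ZMod l := PadicInt.toZMod.comp g
  refine ⟨RingHom.ker ψ, ?_⟩
  rw [absNorm_apply, Submodule.cardQuot_apply,
    Nat.card_congr (RingHom.quotientKerEquivOfSurjective (ZMod.ringHom_surjective ψ)).toEquiv,
    Nat.card_zmod]

theorem exists_auxiliary_prime {p q : ℕ} [hpp : Fact p.Prime] [hqp : Fact q.Prime]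
    (hp : p % 8 = 5) (hq : q % 8 = 3) : ∃ l : ℕ, l.Prime ∧ l % 8 = 5 ∧ (l : ZMod p) = 1 ∧
      (l : ZMod q) = -1 ∧ l > p + q := by
  have hpq : p ≠ q := by omega
  have h8 : ∀ m, m % 2 = 1 → Nat.Coprime 8 m := fun m hm =>
    Nat.Coprime.pow_left 3 (Nat.coprime_two_left.mpr (Nat.odd_iff.mpr hm))
  have hc1 : Nat.Coprime 8 p := h8 p (by omega)
  have hc2 : Nat.Coprime (8 * p) q :=
    Nat.Coprime.mul_left (h8 q (by omega)) ((Nat.coprime_primes hpp.out hqp.out).mpr hpq)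
  obtain ⟨a, ha8, hap⟩ := Nat.chineseRemainder hc1 5 1
  obtain ⟨b, hba, hbq⟩ := Nat.chineseRemainder hc2 a (q - 1)
  have hb8 : b ≡ 5 [MOD 8] := (hba.of_mul_right p).trans ha8
  have hbp : b ≡ 1 [MOD p] := (hba.of_mul_left 8).trans hap
  have hcop : b.Coprime (8 * p * q) := by
    refine Nat.Coprime.mul_right (Nat.Coprime.mul_right ?_ ?_) ?_
    · rw [Nat.coprime_iff_gcd_eq_one, hb8.gcd_eq]; rfl
    · rw [Nat.coprime_iff_gcd_eq_one, hbp.gcd_eq]; simp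
    · rw [Nat.coprime_iff_gcd_eq_one, hbq.gcd_eq]
      have h1 := Nat.coprime_of_lt_prime (n := q - 1) (p := q) (by omega) (by omega) hqp.out
      exact h1.symm
  have : NeZero (8 * p * q) := ⟨by
    have := hpp.out.ne_zero
    have := hqp.out.ne_zero
    positivity⟩
  obtain ⟨l, hlt, hl, hlb⟩ := Nat.forall_exists_prime_gt_and_eq_mod
    ((ZMod.isUnit_iff_coprime b (8 * p * q)).mpr hcop) (p + q)
  rw [ZMod.natCast_eq_natCast_iff] at hlb
  refine ⟨l, hl, ?_, ?_, ?_, hlt⟩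
  · exact ((hlb.of_mul_right q).of_mul_right p).trans hb8
  · have h1 : l ≡ 1 [MOD p] := ((hlb.of_mul_right q).of_mul_left 8).trans hbp
    have h2 := (ZMod.natCast_eq_natCast_iff l 1 p).mpr h1
    rw [h2, Nat.cast_one]
  · have h1 : l ≡ q - 1 [MOD q] := (hlb.of_mul_left (8 * p)).trans hbq
    have h2 := (ZMod.natCast_eq_natCast_iff l (q - 1) q).mpr h1
    rw [h2, Nat.cast_sub hqp.out.one_le]
    simp

end PadicPrime

section Main

variable {K E L F k : Type*} [Field K] [NumberField K] [Field E] [NumberField E] [Algebra K E]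
  [Field L] [NumberField L] [Algebra E L] [Field F] [NumberField F] [Field k] [NumberField k]
  [Algebra F k] [Algebra k L] [Algebra F L] [IsScalarTower F k L]
  {ι : K} {s : E} {t : L} {r : F} {ι' : k} {s' : L}
  {p q : ℕ} [hpp : Fact p.Prime] [hqp : Fact q.Prime]

theorem exists_absNorm_eq_prime (hK : QuadBy ℚ K ι (-1)) (hE : QuadBy K E s (2 * q : K))
    (hL : QuadBy E L t (p : E)) (hp : p % 8 = 5) (hq : q % 8 = 3) :
    ∃ (l : ℕ) (I : Ideal (𝓞 L)), l.Prime ∧ (l : ZMod q) = -1 ∧ absNorm I = l := by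
  obtain ⟨l, hl, hl8, hlp, hlq, hlt⟩ := exists_auxiliary_prime hp hq
  have : Fact l.Prime := ⟨hl⟩
  have hpl0 : (p : ZMod l) ≠ 0 := by
    rw [Ne, ZMod.natCast_eq_zero_iff]
    exact Nat.not_dvd_of_pos_of_lt hpp.out.pos (by omega)
  have hql0 : (q : ZMod l) ≠ 0 := by
    rw [Ne, ZMod.natCast_eq_zero_iff]
    exact Nat.not_dvd_of_pos_of_lt hqp.out.pos (by omega)
  have hpl : IsSquare (p : ZMod l) := by
    rw [ZMod.exists_sq_eq_prime_iff_of_mod_four_eq_one (by omega) (by omega), hlp]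
    exact IsSquare.one
  have hql : ¬ IsSquare (q : ZMod l) := by
    rw [ZMod.exists_sq_eq_prime_iff_of_mod_four_eq_one (by omega) (by omega), hlq]
    exact not_isSquare_neg_one_zmod (by omega)
  have h2ql := isSquare_mul_of_not_isSquare
    (not_isSquare_zmod_of_mod_eight (q := l) (Or.inr hl8)) hql
  have hroot : ∀ n : ℤ, (n : ZMod l) ≠ 0 → IsSquare (n : ZMod l) → ∃ y : ℚ_[l], y ^ 2 = n := by
    intro n h0 h
    obtain ⟨y, hy⟩ := padic_isSquare_of_zmod (by omega) h0 h
    exact ⟨y, by rw [hy, sq]⟩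
  obtain ⟨y₁, hy₁⟩ := hroot (-1) (by push_cast; exact neg_ne_zero.mpr one_ne_zero)
    (by push_cast; exact isSquare_neg_one_zmod (by omega))
  obtain ⟨y₂, hy₂⟩ := hroot (2 * q : ℤ)
    (by push_cast; exact mul_ne_zero (two_ne_zero_zmod (by omega)) hql0) (by push_cast; exact h2ql)
  obtain ⟨y₃, hy₃⟩ := hroot (p : ℤ) (by push_cast; exact hpl0) (by push_cast; exact hpl)
  push_cast at hy₁ hy₂ hy₃
  obtain ⟨f₁, -, -⟩ := hK.exists_lift (algebraMap ℚ ℚ_[l]) (e := y₁)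
    (by rw [hy₁, map_neg, map_one])
  obtain ⟨f₂, -, -⟩ := hE.exists_lift f₁ (e := y₂)
    (by rw [hy₂, map_mul, map_ofNat, map_natCast])
  obtain ⟨f₃, -, -⟩ := hL.exists_lift f₂ (e := y₃) (by rw [hy₃, map_natCast])
  obtain ⟨I, hI⟩ := exists_absNorm_eq_of_padic f₃
  exact ⟨l, I, hl, hlq, hI⟩

theorem sylow_two_octic (hK : QuadBy ℚ K ι (-1)) (hE : QuadBy K E s (2 * q : K))
    (hL : QuadBy E L t (p : E)) (hF : QuadBy ℚ F r (p : ℚ)) (hk : QuadBy F k ι' (-1))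
    (hkL : QuadBy k L s' (2 * q : k)) (hp : p % 8 = 5) (hq : q % 8 = 3)
    (hleg : legendreSym q (p : ℤ) = 1) (P : Sylow 2 (ClassGroup (𝓞 L))) :
    Nonempty (P ≃* Multiplicative (ZMod 2 × ZMod 2)) := by
  have := hL.isQuadraticExtension
  obtain ⟨τ, hτ, -⟩ := hL.exists_conj
  obtain ⟨i, ρ, hi, hρ⟩ := exists_i_rho hK hE
  have hi2 := ringOfIntegers_i_sq hK hi
  have hρ2 := ringOfIntegers_rho_sq hK hE hi hρ
  have hE0 := lIdeal_ne_bot hK hE hq hi hρ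
  obtain ⟨hpq, hpq0⟩ := isSquare_p_zmod_q (p := p) (q := q) hleg
  have hpq' : IsSquare ((p : ℤ) : ZMod q) := by rwa [Int.cast_natCast]
  have hpq0' : ((p : ℤ) : ZMod q) ≠ 0 := by rwa [Int.cast_natCast]
  set Λ := (lIdeal i ρ).map (algebraMap (𝓞 E) (𝓞 L)) with hΛ
  have hΛ0 : Λ ≠ ⊥ := map_ne_bot' hE0
  have hΛ4 : Λ ^ 4 = span {2} := by
    rw [hΛ, ← Ideal.map_pow, lIdeal_pow_four hi2 hρ2 (by omega), Ideal.map_span,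
      Set.image_singleton, map_ofNat]
  have hext : extCls E L (idealCls (lIdeal i ρ)) = idealCls Λ := extCls_idealCls hE0
  have hl : ¬ IsSquare (idealCls Λ) :=
    not_isSquare_cls_of_pow_four (by omega) hF hk hkL hq hpq' hpq0' hΛ4
  have hns : ¬ IsSquare (idealCls (lIdeal i ρ)) := fun h => hl (hext ▸ h.map (extCls E L))
  have hΛn : absNorm Λ = 4 := by
    have h1 := congrArg absNorm hΛ4
    rw [map_pow, show (2 : 𝓞 L) = ((2 : ℕ) : 𝓞 L) by norm_num, absNorm_span_natCast,
      RingOfIntegers.rank, finrank_octic hK hE hL] at h1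
    exact Nat.pow_left_injective (n := 4) (by norm_num) h1
  obtain ⟨l, J, hlp, hlq, hJ⟩ := exists_absNorm_eq_prime hK hE hL hp hq
  have hJ0 : J ≠ ⊥ := by
    rintro rfl
    rw [absNorm_bot] at hJ
    exact hlp.ne_zero hJ.symm
  have hlns : ¬ IsSquare (l : ℚ_[q]) := by
    intro h
    have h1 := zmod_isSquare_of_padic (q := q) (n := (l : ℤ))
      (by rw [Int.cast_natCast, hlq]; exact neg_ne_zero.mpr one_ne_zero)
      (by rwa [Int.cast_natCast])
    rw [Int.cast_natCast, hlq] at h1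
    exact not_isSquare_neg_one_zmod (by omega) h1
  have hJns : ¬ IsSquare (idealCls J) := by
    intro h
    have h1 := isSquare_absNorm_of_isSquare_cls (by omega) hF hk hkL (by omega) hpq' hpq0' hJ0 h
    rw [hJ] at h1
    exact hlns h1
  have hΛJns : ¬ IsSquare (idealCls Λ * idealCls J) := by
    intro h
    rw [← idealCls_mul hΛ0 hJ0] at h
    have h1 := isSquare_absNorm_of_isSquare_cls (by omega) hF hk hkL (by omega) hpq' hpq0'
      (mul_ne_zero hΛ0 hJ0) h
    rw [map_mul, hΛn, hJ, mul_comm, Nat.cast_mul] at h1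
    refine hlns (isSquare_mul_self_right (y := ((4 : ℕ) : ℚ_[q])) ⟨2, by norm_num⟩ ?_ h1)
    exact Nat.cast_ne_zero.mpr (by norm_num)
  refine sylow_kleinFour_of_involution (galCls τ) (galCls_galCls hτ) (idealCls Λ) (idealCls J) ?_ ?_
    hl hJns hΛJns P
  · rw [← sq, ← idealCls_pow hΛ0, hΛ, ← Ideal.map_pow, lIdeal_sq hi2 hρ2 (by omega),
      Ideal.map_span, Set.image_singleton, idealCls_span]
  · intro c hc2 hc
    rw [← hext]
    exact ambiguous_octic hK hE hL hp hq hleg hi hρ hns hτ c hc2 hc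

end Main

section RationalSquares

theorem not_isSquare_rat_natCast {n : ℕ} (hn : ¬ IsSquare n) : ¬ IsSquare (n : ℚ) := by
  rwa [Rat.isSquare_natCast_iff]

theorem map_two_mul_natCast {R S : Type*} [CommRing R] [CommRing S] (f : R →+* S) (n : ℕ) :
    f (2 * n) = 2 * n := by
  rw [map_mul, map_ofNat, map_natCast]

end RationalSquares

theorem nonempty_sylow_two_equiv_of_adjoin_eq_top {L : Type*} [Field L] [NumberField L] {p q : ℕ}
    [hpp : Fact p.Prime] [hqp : Fact q.Prime] (hp : p % 8 = 5) (hq : q % 8 = 3)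
    (hleg : legendreSym q (p : ℤ) = 1) {r s ι : L} (hr : r ^ 2 = p) (hs : s ^ 2 = 2 * q)
    (hι : ι ^ 2 = -1) (htop : IntermediateField.adjoin ℚ {r, s, ι} = ⊤)
    (P : Sylow 2 (ClassGroup (𝓞 L))) : Nonempty (P ≃* Multiplicative (ZMod 2 × ZMod 2)) := by
  have hp0 : (0 : ℚ) < p := by exact_mod_cast hpp.out.pos
  have hq0 : (0 : ℚ) < q := by exact_mod_cast hqp.out.pos
  have sq1 : ¬ IsSquare (-1 : ℚ) := not_isSquare_of_neg (by norm_num)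
  have sqp : ¬ IsSquare (p : ℚ) := not_isSquare_rat_natCast hpp.out.prime.not_isSquare
  have sq2q : ¬ IsSquare (2 * q : ℚ) := by
    have := not_isSquare_rat_natCast (not_isSquare_two_mul (m := q) (by omega))
    exact_mod_cast this
  have sq2pq : ¬ IsSquare (2 * (q * p) : ℚ) := by
    have := not_isSquare_rat_natCast (not_isSquare_two_mul (m := q * p) (by
      rw [Nat.mul_mod]
      have h1 : q % 2 = 1 := by omega
      have h2 : p % 2 = 1 := by omega
      simp [h1, h2]))
    exact_mod_cast this
  have sqnp : ¬ IsSquare (-p : ℚ) := not_isSquare_of_neg (by linarith)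
  have sqn2q : ¬ IsSquare (-(2 * q) : ℚ) := not_isSquare_of_neg (by linarith)
  have sqn2pq : ¬ IsSquare (-(2 * (q * p)) : ℚ) :=
    not_isSquare_of_neg (by have := mul_pos hq0 hp0; linarith)
  -- any intermediate field containing the three generators is everything
  have htop' : ∀ T : IntermediateField ℚ L, r ∈ T → s ∈ T → ι ∈ T → T = ⊤ := by
    intro T h1 h2 h3
    rw [eq_top_iff, ← htop, IntermediateField.adjoin_le_iff]
    rintro x (rfl | rfl | rfl) <;> assumption
  -- the tower through the fourth roots of unity
  have hK := QuadBy.adjoin (K := ℚ) (F := L) (s := ι) (d := -1) (by rw [hι]; simp) sq1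
  let K := IntermediateField.adjoin ℚ {ι}
  have K2q : ¬ IsSquare (2 * q : K) := by
    intro h
    have h' : IsSquare (algebraMap ℚ K (2 * q)) := by simpa using h
    rcases hK.isSquare_descent h' with h1 | h1
    · exact sq2q h1
    · exact sqn2q (by simpa using h1)
  have hE := QuadBy.adjoin (K := K) (F := L) (s := s) (d := 2 * q) (hs.trans (map_two_mul_natCast _ q).symm) K2q
  let E := IntermediateField.adjoin K {s}
  have Kp : ¬ IsSquare (p : K) := by
    intro h
    have h' : IsSquare (algebraMap ℚ K p) := by simpa using h
    rcases hK.isSquare_descent h' with h1 | h1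
    · exact sqp h1
    · exact sqnp (by simpa using h1)
  have K2pq : ¬ IsSquare (p * (2 * q) : K) := by
    intro h
    have h' : IsSquare (algebraMap ℚ K (2 * (q * p))) := by
      convert h using 1
      simp only [map_mul, map_natCast, map_ofNat]
      ring
    rcases hK.isSquare_descent h' with h1 | h1
    · exact sq2pq h1
    · exact sqn2pq (by simpa using h1)
  have Ep : ¬ IsSquare (p : E) := by
    intro h
    have h' : IsSquare (algebraMap K E p) := by simpa using h
    rcases hE.isSquare_descent h' with h1 | h1
    · exact Kp h1
    · exact K2pq h1
  have hιE : ι ∈ (IntermediateField.restrictScalars ℚ E) :=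
    E.algebraMap_mem ⟨ι, IntermediateField.mem_adjoin_simple_self ℚ ι⟩
  have hL : QuadBy E L r (p : E) := by
    refine QuadBy.of_adjoin_eq_top (by rw [hr]; simp) Ep ?_
    apply IntermediateField.restrictScalars_injective K
    apply IntermediateField.restrictScalars_injective ℚ
    rw [htop' (IntermediateField.restrictScalars ℚ (IntermediateField.restrictScalars K
      (IntermediateField.adjoin E {r})))
      (IntermediateField.mem_adjoin_simple_self E r)
      ((IntermediateField.adjoin E {r}).algebraMap_mem
        ⟨s, IntermediateField.mem_adjoin_simple_self K s⟩)
      ((IntermediateField.adjoin E {r}).algebraMap_mem ⟨ι, hιE⟩)]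
    rfl
  -- the tower through the real quadratic field
  have hF := QuadBy.adjoin (K := ℚ) (F := L) (s := r) (d := (p : ℚ)) (by rw [hr]; simp) sqp
  let F := IntermediateField.adjoin ℚ {r}
  have Fn1 : ¬ IsSquare (-1 : F) := by
    intro h
    have h' : IsSquare (algebraMap ℚ F (-1)) := by simpa using h
    rcases hF.isSquare_descent h' with h1 | h1
    · exact sq1 h1
    · exact sqnp (by simpa using h1)
  have hk := QuadBy.adjoin (K := F) (F := L) (s := ι) (d := -1) (by rw [hι]; simp) Fn1
  let k := IntermediateField.adjoin F {ι}
  have F2q : ¬ IsSquare (2 * q : F) := by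
    intro h
    have h' : IsSquare (algebraMap ℚ F (2 * q)) := by simpa using h
    rcases hF.isSquare_descent h' with h1 | h1
    · exact sq2q h1
    · exact sq2pq (by rwa [mul_assoc] at h1)
  have Fn2q : ¬ IsSquare (2 * q * (-1) : F) := by
    intro h
    have h' : IsSquare (algebraMap ℚ F (-(2 * q))) := by simpa using h
    rcases hF.isSquare_descent h' with h1 | h1
    · exact sqn2q h1
    · exact sqn2pq (by rwa [neg_mul, mul_assoc] at h1)
  have k2q : ¬ IsSquare (2 * q : k) := by
    intro h
    have h' : IsSquare (algebraMap F k (2 * q)) := by rwa [map_two_mul_natCast]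
    rcases hk.isSquare_descent h' with h1 | h1
    · exact F2q h1
    · exact Fn2q h1
  have hrk : r ∈ (IntermediateField.restrictScalars ℚ k) :=
    k.algebraMap_mem ⟨r, IntermediateField.mem_adjoin_simple_self ℚ r⟩
  have hkL : QuadBy k L s (2 * q : k) := by
    refine QuadBy.of_adjoin_eq_top (hs.trans (map_two_mul_natCast _ q).symm) k2q ?_
    apply IntermediateField.restrictScalars_injective F
    apply IntermediateField.restrictScalars_injective ℚ
    rw [htop' (IntermediateField.restrictScalars ℚ (IntermediateField.restrictScalars F
      (IntermediateField.adjoin k {s})))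
      ((IntermediateField.adjoin k {s}).algebraMap_mem ⟨r, hrk⟩)
      (IntermediateField.mem_adjoin_simple_self k s)
      ((IntermediateField.adjoin k {s}).algebraMap_mem
        ⟨ι, IntermediateField.mem_adjoin_simple_self F ι⟩)]
    rfl
  have : NumberField K := NumberField.of_intermediateField K
  have : NumberField F := NumberField.of_intermediateField F
  have : Module.Finite K E := hE.moduleFinite
  have : Module.Finite F k := hk.moduleFinite
  have : NumberField E := NumberField.of_module_finite K E
  have : NumberField k := NumberField.of_module_finite F k
  exact sylow_two_octic hK hE hL hF hk hkL hp hq hleg P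

theorem twoClassGroup_Qsqrtp_sqrt2q_i_type_two_two
    (p q : ℕ) [Fact (Nat.Prime p)] [Fact (Nat.Prime q)]
    (hp : p % 8 = 5) (hq : q % 8 = 3) (hleg : legendreSym q (p : ℤ) = 1) :
    TwoClassGroupIsTypeTwoTwo (IntermediateField.adjoin ℚ
      {((Real.sqrt p : ℝ) : ℂ), ((Real.sqrt (2 * q) : ℝ) : ℂ), Complex.I}) := by
  obtain ⟨S, hS⟩ : ∃ S : Set ℂ,
      S = {((Real.sqrt p : ℝ) : ℂ), ((Real.sqrt (2 * q) : ℝ) : ℂ), Complex.I} := ⟨_, rfl⟩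
  rw [← hS]
  intro P
  have hr : ((Real.sqrt p : ℝ) : ℂ) ^ 2 = p := by
    rw [← Complex.ofReal_pow, Real.sq_sqrt p.cast_nonneg, Complex.ofReal_natCast]
  have hs : ((Real.sqrt (2 * q) : ℝ) : ℂ) ^ 2 = 2 * q := by
    rw [← Complex.ofReal_pow, Real.sq_sqrt (by positivity)]
    simp
  have mem : ∀ x ∈ S, x ∈ IntermediateField.adjoin ℚ S :=
    fun x hx => IntermediateField.subset_adjoin ℚ S hx
  have m1 := mem ((Real.sqrt p : ℝ) : ℂ) (by simp [hS])
  have m2 := mem ((Real.sqrt (2 * q) : ℝ) : ℂ) (by simp [hS])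
  have m3 := mem Complex.I (by simp [hS])
  have hfin : FiniteDimensional ℚ (IntermediateField.adjoin ℚ S) := by
    have : Finite S := by rw [hS]; exact Set.toFinite _
    refine IntermediateField.finiteDimensional_adjoin fun x hx => ?_
    apply IsIntegral.of_pow (n := 2) two_pos
    rw [hS] at hx
    rcases hx with rfl | rfl | rfl
    · rw [hr]; exact map_natCast (algebraMap ℚ ℂ) p ▸ isIntegral_algebraMap
    · rw [hs]; exact map_two_mul_natCast (algebraMap ℚ ℂ) q ▸ isIntegral_algebraMap
    · rw [Complex.I_sq]; exact isIntegral_one.neg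
  have : NumberField (IntermediateField.adjoin ℚ S) := ⟨⟩
  refine nonempty_sylow_two_equiv_of_adjoin_eq_top hp hq hleg (L := IntermediateField.adjoin ℚ S)
    (r := ⟨_, m1⟩) (s := ⟨_, m2⟩) (ι := ⟨_, m3⟩) (Subtype.ext hr) (Subtype.ext hs)
    (Subtype.ext Complex.I_sq) ?_ P
  have key : @IntermediateField.adjoin ℚ _ (IntermediateField.adjoin ℚ S) _
      (IntermediateField.algebra' _) {⟨_, m1⟩, ⟨_, m2⟩, ⟨_, m3⟩} = ⊤ := by
    apply IntermediateField.lift_injective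
    rw [IntermediateField.lift_adjoin, IntermediateField.lift_top]
    congr 1
    simp [Set.image_insert_eq, hS]
  convert key <;> exact Subsingleton.elim _ _
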